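/- arXiv:1302.5008 — 2 statements merged into one kernel-verified Lean document; each statement's English description precedes it below -/
import Mathlib

section
/- For every d ≥ 2, the Selmer algorithm S : Σ_d → Σ_d is ergodic with respect to d-dimensional Lebesgue measure restricted to Σ_d: every Lebesgue-measurable set A ⊆ Σ_d satisfying {x ∈ Σ_d : S(x) ∈ A} = A has either λ(A) = 0 or λ(Σ_d ∖ A) = 0. -/
open MeasureTheory

/-- The ascending cone `Σ_d = {x ∈ ℝ^d : 0 ≤ x[1] ≤ x[2] ≤ … ≤ x[d]}`, for `d = n + 2`. -/
def SigmaCone (n : ℕ) : Set (Fin (n + 2) → ℝ) := {x | 0 ≤ x 0 ∧ Monotone x}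

/-- The Selmer algorithm: `x` is sent to the nondecreasing rearrangement of the tuple
`(x[1], …, x[d−1], x[d] − x[1])`. -/
noncomputable def selmerAlg (n : ℕ) (x : Fin (n + 2) → ℝ) : Fin (n + 2) → ℝ :=
  let t : Fin (n + 2) → ℝ :=
    fun i => if i = Fin.last (n + 1) then x (Fin.last (n + 1)) - x 0 else x i
  t ∘ Tuple.sort t

namespace Selmer

/-- Pigeonhole core of the contraction argument. -/
lemma comb_core (m : ℕ) (l h sl sh : ℕ → Prop)
    (H2 : ∀ k, h (k + m) → h k ∧ sh k)
    (H1 : ∀ k, l (k + m) → l k ∧ sl k)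
    (H3 : ∀ k, sh (k + 1) → sh k ∨ h k)
    (H5 : ∀ k, ¬ (sl k ∧ sh k))
    (p q : ℕ) (hpq : p < q) (hq : q < m)
    (hl : l (p + m * m)) (hh : h (q + m * m)) : False := by
  have hl' : ∀ i, i ≤ m → l (p + (m - i) * m) := by
    intro i
    induction i with
    | zero => intro _; simpa using hl
    | succ i ih =>
      intro hi
      have h1 := ih (by omega)
      have e : p + (m - i) * m = (p + (m - (i+1)) * m) + m := by
        have : m - i = (m - (i+1)) + 1 := by omega
        rw [this]; ring
      rw [e] at h1
      exact (H1 _ h1).1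
  have hh' : ∀ i, i ≤ m → h (q + (m - i) * m) := by
    intro i
    induction i with
    | zero => intro _; simpa using hh
    | succ i ih =>
      intro hi
      have h1 := ih (by omega)
      have e : q + (m - i) * m = (q + (m - (i+1)) * m) + m := by
        have : m - i = (m - (i+1)) + 1 := by omega
        rw [this]; ring
      rw [e] at h1
      exact (H2 _ h1).1
  have hl2 : ∀ i, i ≤ m → l (p + i * m) := by
    intro i hi
    have := hl' (m - i) (by omega)
    rwa [show m - (m - i) = i by omega] at this
  have hh2 : ∀ i, i ≤ m → h (q + i * m) := by
    intro i hi
    have := hh' (m - i) (by omega)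
    rwa [show m - (m - i) = i by omega] at this
  have hsl : ∀ i, i < m → sl (p + i * m) := by
    intro i hi
    have := hl2 (i+1) (by omega)
    rw [show p + (i+1) * m = (p + i * m) + m by ring] at this
    exact (H1 _ this).2
  have hsh : ∀ i, i < m → sh (q + i * m) := by
    intro i hi
    have := hh2 (i+1) (by omega)
    rw [show q + (i+1) * m = (q + i * m) + m by ring] at this
    exact (H2 _ this).2
  have key : ∀ i : Fin m, ∃ r : ℕ, p ≤ r ∧ r < q ∧ h (r + i * m) ∧ ¬ h (r + (i + 1) * m) := by
    intro i
    have h0 : ¬ sh (p + i * m) := fun hs => H5 _ ⟨hsl i i.2, hs⟩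
    have h1 : sh (q + i * m) := hsh i i.2
    by_contra hcon
    push Not at hcon
    have : ∀ t, p + t ≤ q → ¬ sh (p + t + i * m) := by
      intro t
      induction t with
      | zero => intro _; simpa using h0
      | succ t ih =>
        intro ht hs
        have h2 := ih (by omega)
        rw [show p + (t+1) + (i:ℕ) * m = (p + t + i * m) + 1 by ring] at hs
        rcases H3 _ hs with h3 | h3
        · exact h2 h3
        · have h4 := hcon (p + t) (by omega) (by omega) h3
          rw [show p + t + ((i:ℕ) + 1) * m = (p + t + i * m) + m by ring] at h4
          exact h2 (H2 _ h4).2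
    have h2 := this (q - p) (by omega)
    rw [show p + (q - p) = q by omega] at h2
    exact h2 h1
  choose r hr1 hr2 hr3 hr4 using key
  have hdown : ∀ s i j : ℕ, h (s + (i + j) * m) → h (s + i * m) := by
    intro s i j
    induction j with
    | zero => simp
    | succ j ih =>
      intro hj
      rw [show s + (i + (j+1)) * m = (s + (i + j) * m) + m by ring] at hj
      exact ih (H2 _ hj).1
  have hinj : Function.Injective (fun i : Fin m => (⟨r i, by have := hr2 i; omega⟩ : Fin q)) := by
    have aux : ∀ i j : Fin m, i < j → r i ≠ r j := by
      intro i j hij e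
      have h1 := hr3 j
      rw [← e] at h1
      apply hr4 i
      have e2 : (j : ℕ) = (i + 1) + (j - (i + 1)) := by
        have : (i:ℕ) < j := hij
        omega
      rw [e2] at h1
      exact hdown _ _ _ h1
    intro i j hij
    have hij' : r i = r j := by simpa using hij
    rcases lt_trichotomy i j with h1 | h1 | h1
    · exact absurd hij' (aux i j h1)
    · exact h1
    · exact absurd hij'.symm (aux j i h1)
  have := Fintype.card_le_of_injective _ hinj
  simp at this
  omega

lemma comb_core2 (m : ℕ) (l h sl sh : ℕ → Prop)
    (H1 : ∀ k, l (k + m) → l k ∧ sl k)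
    (H2 : ∀ k, h (k + m) → h k ∧ sh k)
    (H3 : ∀ k, sl (k + 1) → sl k ∨ l k)
    (H3' : ∀ k, sh (k + 1) → sh k ∨ h k)
    (H4 : ∀ k, ¬ (l k ∧ h k))
    (H5 : ∀ k, ¬ (sl k ∧ sh k))
    (p q : ℕ) (hp : p < m) (hq : q < m)
    (hl : l (p + m * m)) (hh : h (q + m * m)) : False := by
  rcases lt_trichotomy p q with h1 | h1 | h1
  · exact comb_core m l h sl sh H2 H1 H3' H5 p q h1 hq hl hh
  · subst h1; exact H4 _ ⟨hl, hh⟩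
  · exact comb_core m h l sh sl H1 H2 H3 (fun k hk => H5 k hk.symm) q p h1 hp hh hl

/-- one-sided: special low, high in the queue -/
lemma comb_core3 (m : ℕ) (l h sl sh : ℕ → Prop)
    (H1 : ∀ k, l (k + m) → l k ∧ sl k)
    (H2 : ∀ k, h (k + m) → h k ∧ sh k)
    (H3 : ∀ k, sl (k + 1) → sl k ∨ l k)
    (H3' : ∀ k, sh (k + 1) → sh k ∨ h k)
    (H4 : ∀ k, ¬ (l k ∧ h k))
    (H5 : ∀ k, ¬ (sl k ∧ sh k))
    (q : ℕ) (hq : q < m) (hs : sl ((m + 1) * m)) (hh : h (q + (m + 1) * m)) : False := by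
  rw [show q + (m + 1) * m = (q + m * m) + m by ring] at hh
  obtain ⟨hh1, hh2⟩ := H2 _ hh
  have h0 : ¬ sl (q + m * m) := fun h => H5 _ ⟨h, hh2⟩
  by_contra _
  have : ∀ t, q + t ≤ m → ¬ sl (q + t + m * m) := by
    intro t
    induction t with
    | zero => intro _; simpa using h0
    | succ t ih =>
      intro ht hs
      rw [show q + (t+1) + m * m = (q + t + m * m) + 1 by ring] at hs
      rcases H3 _ hs with h3 | h3
      · exact ih (by omega) h3
      · exact comb_core2 m l h sl sh H1 H2 H3 H3' H4 H5 (q+t) q (by omega) hq h3 hh1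
  have h2 := this (m - q) (by omega)
  rw [show q + (m - q) + m * m = (m + 1) * m by rw [show q + (m - q) = m by omega]; ring] at h2
  exact h2 hs

lemma comb (m : ℕ) (l h sl sh : ℕ → Prop)
    (H1 : ∀ k, l (k + m) → l k ∧ sl k)
    (H2 : ∀ k, h (k + m) → h k ∧ sh k)
    (H3 : ∀ k, sl (k + 1) → sl k ∨ l k)
    (H3' : ∀ k, sh (k + 1) → sh k ∨ h k)
    (H4 : ∀ k, ¬ (l k ∧ h k))
    (H5 : ∀ k, ¬ (sl k ∧ sh k)) :
    (¬ sl ((m + 1) * m) ∧ ∀ j < m, ¬ l (j + (m + 1) * m)) ∨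
    (¬ sh ((m + 1) * m) ∧ ∀ j < m, ¬ h (j + (m + 1) * m)) := by
  by_contra hcon
  rw [not_or] at hcon
  obtain ⟨c1, c2⟩ := hcon
  have d1 : sl ((m + 1) * m) ∨ ∃ j < m, l (j + (m + 1) * m) := by
    by_contra h'; push Not at h'; exact c1 h'
  have d2 : sh ((m + 1) * m) ∨ ∃ j < m, h (j + (m + 1) * m) := by
    by_contra h'; push Not at h'; exact c2 h'
  rcases d1 with d1 | ⟨p, hp, d1⟩ <;> rcases d2 with d2 | ⟨q, hq, d2⟩
  · exact H5 _ ⟨d1, d2⟩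
  · exact comb_core3 m l h sl sh H1 H2 H3 H3' H4 H5 q hq d1 d2
  · exact comb_core3 m h l sh sl H2 H1 H3' H3 (fun k hk => H4 k hk.symm)
      (fun k hk => H5 k hk.symm) p hp d2 d1
  · rw [show p + (m + 1) * m = (p + m * m) + m by ring] at d1
    rw [show q + (m + 1) * m = (q + m * m) + m by ring] at d2
    exact comb_core2 m l h sl sh H1 H2 H3 H3' H4 H5 p q hp hq (H1 _ d1).1 (H2 _ d2).1

end Selmer

namespace Selmer

abbrev V (n : ℕ) := Fin (n + 2) → ℝ

def m1 (n : ℕ) : V n →ₗ[ℝ] V n where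
  toFun b := (Fin.cons (b 0 + b (Fin.last (n+1))) (fun j : Fin (n+1) => b (j-1).succ) : Fin (n+2) → ℝ)
  map_add' x y := by
    ext i
    refine Fin.cases ?_ (fun j => ?_) i
    · simp; ring
    · simp
  map_smul' a x := by
    ext i
    refine Fin.cases ?_ (fun j => ?_) i
    · simp; ring
    · simp

def sw (n : ℕ) : V n →ₗ[ℝ] V n := LinearMap.funLeft ℝ ℝ (Equiv.swap (0 : Fin (n+2)) 1)

def m0 (n : ℕ) : V n →ₗ[ℝ] V n := sw n ∘ₗ m1 n

def t1 {n : ℕ} (c : V n) : V n :=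
  (Fin.cons (c 0) (fun j : Fin (n+1) => c (j+1).succ + if j = Fin.last n then c 0 else 0) : Fin (n+2) → ℝ)

def t0 {n : ℕ} (c : V n) : V n := t1 (c ∘ Equiv.swap (0 : Fin (n+2)) 1)

lemma m1_zero {n : ℕ} (b : V n) : m1 n b 0 = b 0 + b (Fin.last (n+1)) := rfl
lemma m1_succ {n : ℕ} (b : V n) (j : Fin (n+1)) : m1 n b j.succ = b (j-1).succ := rfl
lemma m1_one {n : ℕ} (b : V n) : m1 n b 1 = b (Fin.last (n+1)) := by
  have h := m1_succ b 0
  have e : (0 - 1 : Fin (n+1)) = Fin.last n := by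
    rw [sub_eq_iff_eq_add]; simp
  rw [e, Fin.succ_last, Fin.succ_zero_eq_one] at h
  exact h
lemma sw_apply {n : ℕ} (b : V n) (i : Fin (n+2)) : sw n b i = b (Equiv.swap 0 1 i) := rfl
lemma m0_apply {n : ℕ} (b : V n) (i : Fin (n+2)) : m0 n b i = m1 n b (Equiv.swap 0 1 i) := rfl

lemma t1_zero {n : ℕ} (c : V n) : t1 c 0 = c 0 := rfl
lemma t1_cs {n : ℕ} (c : V n) (i : Fin n) : t1 c i.castSucc.succ = c i.succ.succ := by
  have : i.castSucc ≠ Fin.last n := Fin.castSucc_ne_last i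
  simp [t1, this]
lemma t1_last {n : ℕ} (c : V n) : t1 c (Fin.last n).succ = c 0 + c 1 := by
  simp [t1]; ring

lemma swap_ss {n : ℕ} (i : Fin n) : Equiv.swap (0 : Fin (n+2)) 1 i.succ.succ = i.succ.succ := by
  apply Equiv.swap_apply_of_ne_of_ne
  · exact Fin.succ_ne_zero _
  · rw [← Fin.succ_zero_eq_one]
    intro h
    exact Fin.succ_ne_zero _ (Fin.succ_injective _ h)

lemma t0_zero {n : ℕ} (c : V n) : t0 c 0 = c 1 := by simp [t0, t1_zero]
lemma t0_cs {n : ℕ} (c : V n) (i : Fin n) : t0 c i.castSucc.succ = c i.succ.succ := by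
  simp [t0, t1_cs, swap_ss]
lemma t0_last {n : ℕ} (c : V n) : t0 c (Fin.last n).succ = c 0 + c 1 := by
  rw [t0, t1_last]; simp; ring

lemma dot_m1 {n : ℕ} (c b : V n) : c ⬝ᵥ m1 n b = t1 c ⬝ᵥ b := by
  unfold dotProduct
  rw [Fin.sum_univ_succ, Fin.sum_univ_succ (n := n+1)]
  simp only [m1_zero, m1_succ, t1_zero]
  have e1 : ∑ j : Fin (n+1), c j.succ * b (j-1).succ = ∑ j : Fin (n+1), c (j+1).succ * b j.succ := by
    rw [← Equiv.sum_comp (Equiv.addRight (1 : Fin (n+1))) (fun j => c j.succ * b (j-1).succ)]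
    simp
  have e2 : ∑ j : Fin (n+1), t1 c j.succ * b j.succ
      = ∑ j : Fin (n+1), c (j+1).succ * b j.succ + c 0 * b (Fin.last (n+1)) := by
    have : ∀ j : Fin (n+1), t1 c j.succ * b j.succ = c (j+1).succ * b j.succ +
        (if j = Fin.last n then c 0 * b (Fin.last (n+1)) else 0) := by
      intro j
      by_cases h : j = Fin.last n
      · subst h; simp [t1]; ring
      · simp [t1, h]
    simp only [this, Finset.sum_add_distrib]
    simp
  rw [e1, e2]; ring

lemma dot_m0 {n : ℕ} (c b : V n) : c ⬝ᵥ m0 n b = t0 c ⬝ᵥ b := by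
  rw [t0, ← dot_m1]
  unfold dotProduct
  rw [← Equiv.sum_comp (Equiv.swap (0 : Fin (n+2)) 1)]
  simp [m0_apply]

def K (n : ℕ) : Set (V n) := {b | ∀ i, 0 < b i}

lemma m1_inj (n : ℕ) : Function.Injective (m1 n) := by
  intro x y h
  have hs : ∀ j : Fin (n+1), x j.succ = y j.succ := by
    intro j
    have := congrFun h (j+1).succ
    simpa [m1_succ] using this
  have h0 := congrFun h 0
  rw [m1_zero, m1_zero, ← Fin.succ_last, hs] at h0
  ext i
  refine Fin.cases ?_ (fun j => hs j) i
  linarith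

lemma sw_sw {n : ℕ} (b : V n) : sw n (sw n b) = b := by
  ext i; simp [sw_apply]

lemma m0_inj (n : ℕ) : Function.Injective (m0 n) := by
  intro x y h
  have h' : sw n (sw n (m1 n x)) = sw n (sw n (m1 n y)) := congrArg (sw n) h
  rw [sw_sw, sw_sw] at h'
  exact m1_inj n h'

lemma m1_K {n : ℕ} {b : V n} (hb : b ∈ K n) : m1 n b ∈ K n := by
  intro i
  refine Fin.cases ?_ (fun j => ?_) i
  · rw [m1_zero]; exact add_pos (hb _) (hb _)
  · rw [m1_succ]; exact hb _

lemma m0_K {n : ℕ} {b : V n} (hb : b ∈ K n) : m0 n b ∈ K n := fun i => m1_K hb _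

lemma m1_lt {n : ℕ} {b : V n} (hb : b ∈ K n) : m1 n b 1 < m1 n b 0 := by
  rw [m1_one, m1_zero]; linarith [hb 0]

lemma m0_lt {n : ℕ} {b : V n} (hb : b ∈ K n) : m0 n b 0 < m0 n b 1 := by
  simpa [m0_apply] using m1_lt hb

lemma m1_surj {n : ℕ} {b : V n} (hb : b ∈ K n) (h : b 1 < b 0) :
    ∃ x ∈ K n, m1 n x = b ∧ x 0 = b 0 - b 1 ∧ ∀ j : Fin (n+1), x j.succ = b (j+1).succ := by
  refine ⟨(Fin.cons (b 0 - b 1) (fun j : Fin (n+1) => b (j+1).succ) : Fin (n+2) → ℝ), ?_, ?_, rfl, fun j => rfl⟩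
  · intro i
    refine Fin.cases ?_ (fun j => ?_) i
    · simpa using h
    · simpa using hb _
  · ext i
    refine Fin.cases ?_ (fun j => ?_) i
    · rw [m1_zero, ← Fin.succ_last]; simp
    · rw [m1_succ]; simp

lemma m0_surj {n : ℕ} {b : V n} (hb : b ∈ K n) (h : b 0 < b 1) :
    ∃ x ∈ K n, m0 n x = b := by
  have h1 : sw n b ∈ K n := fun i => hb _
  obtain ⟨x, hx, hx1, -⟩ := m1_surj h1 (by simpa [sw_apply] using h)
  refine ⟨x, hx, ?_⟩
  change sw n (m1 n x) = b
  rw [hx1, sw_sw]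

/-- letters -/
def mb (n : ℕ) (a : Bool) : V n →ₗ[ℝ] V n := if a then m1 n else m0 n
def tb {n : ℕ} (a : Bool) (c : V n) : V n := if a then t1 c else t0 c

lemma dot_mb {n : ℕ} (a : Bool) (c b : V n) : c ⬝ᵥ mb n a b = tb a c ⬝ᵥ b := by
  cases a
  · simpa [mb, tb] using dot_m0 c b
  · simpa [mb, tb] using dot_m1 c b

lemma tb_cs {n : ℕ} (a : Bool) (c : V n) (i : Fin n) : tb a c i.castSucc.succ = c i.succ.succ := by
  cases a
  · simpa [tb] using t0_cs c i
  · simpa [tb] using t1_cs c i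
lemma tb_last {n : ℕ} (a : Bool) (c : V n) : tb a c (Fin.last n).succ = c 0 + c 1 := by
  cases a
  · simpa [tb] using t0_last c
  · simpa [tb] using t1_last c
lemma tb_zero {n : ℕ} (a : Bool) (c : V n) : tb a c 0 = if a then c 0 else c 1 := by
  cases a
  · simpa [tb] using t0_zero c
  · simpa [tb] using t1_zero c

lemma fin_cases3 {n : ℕ} {P : Fin (n+2) → Prop} (h0 : P 0) (hc : ∀ i : Fin n, P i.castSucc.succ)
    (hl : P (Fin.last n).succ) : ∀ i, P i := by
  intro i
  refine Fin.cases h0 (fun j => ?_) i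
  exact Fin.lastCases hl hc j

lemma tb_sub {n : ℕ} (a : Bool) (c g : V n) : tb a (c - g) = tb a c - tb a g := by
  ext i
  revert i
  apply fin_cases3
  · cases a <;> simp [tb_zero]
  · intro i; simp [tb_cs]
  · simp only [tb_last, Pi.sub_apply]; ring

lemma tb_smul {n : ℕ} (a : Bool) (s : ℝ) (g : V n) : tb a (s • g) = s • tb a g := by
  ext i
  revert i
  apply fin_cases3
  · cases a <;> simp [tb_zero]
  · intro i; simp [tb_cs]
  · simp only [tb_last, Pi.smul_apply, smul_eq_mul]; ring

lemma tb_ge {n : ℕ} (a : Bool) {c : V n} {s : ℝ} (hs : 0 ≤ s) (h : ∀ i, s ≤ c i) :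
    ∀ i, s ≤ tb a c i := by
  apply fin_cases3
  · cases a <;> simp [tb_zero, h]
  · intro i; rw [tb_cs]; exact h _
  · rw [tb_last]; linarith [h 0, h 1]

lemma tb_le {n : ℕ} (a : Bool) {c : V n} {s : ℝ} (hs : 0 ≤ s) (h : ∀ i, c i ≤ s) :
    ∀ i, tb a c i ≤ 2 * s := by
  apply fin_cases3
  · cases a <;> simp only [tb_zero] <;> simp <;> linarith [h 0, h 1]
  · intro i; rw [tb_cs]; linarith [h i.succ.succ]
  · rw [tb_last]; linarith [h 0, h 1]

lemma tb_mono {n : ℕ} (a : Bool) {c g : V n} (h : ∀ i, c i ≤ g i) : ∀ i, tb a c i ≤ tb a g i := by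
  have := tb_ge (n := n) a (c := g - c) le_rfl (fun i => by simpa using h i)
  intro i
  have := this i
  rw [tb_sub] at this
  simpa using this

/-- class of functionals -/
def DD {n : ℕ} (c : V n) : Prop :=
  0 < c 0 ∧ c 0 ≤ c 1 ∧ Monotone (fun j : Fin (n+1) => c j.succ) ∧ c (Fin.last n).succ ≤ c 0 + c 1

lemma DD_tb {n : ℕ} (a : Bool) {c : V n} (h : DD c) : DD (tb a c) := by
  obtain ⟨h0, h1, hm, hl⟩ := h
  have hall : ∀ j : Fin (n+1), c 1 ≤ c j.succ := fun j => by
    have := hm (Fin.zero_le j); simpa using this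
  have hall2 : ∀ j : Fin (n+1), c j.succ ≤ c 0 + c 1 := fun j => (hm (Fin.le_last j)).trans hl
  have hge : ∀ j : Fin (n+1), c 1 ≤ tb a c j.succ := by
    refine Fin.lastCases ?_ (fun i => ?_)
    · rw [tb_last]; linarith
    · rw [tb_cs]; exact hall _
  have hz : 0 < tb a c 0 ∧ tb a c 0 ≤ c 1 := by
    cases a <;> simp [tb_zero] <;> first | exact ⟨h0, h1⟩ | linarith
  have hz2 : c 0 ≤ tb a c 0 := by cases a <;> simp [tb_zero, h1]
  refine ⟨hz.1, ?_, ?_, ?_⟩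
  · have := hge 0
    simp only [Fin.succ_zero_eq_one] at this
    linarith
  · intro j k
    refine Fin.lastCases ?_ (fun i => ?_) k
    · intro _
      simp only [tb_last]
      refine Fin.lastCases ?_ (fun i => ?_) j
      · simp only [tb_last]; rfl
      · simp only [tb_cs]; exact hall2 i.succ
    · refine Fin.lastCases ?_ (fun i' => ?_) j
      · intro hh
        exact absurd (lt_of_lt_of_le (Fin.castSucc_lt_last i) hh) (lt_irrefl _)
      · intro hh
        simp only [tb_cs]
        apply hm
        simpa using hh
  · rw [tb_last]
    have := hge 0
    simp only [Fin.succ_zero_eq_one] at this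
    linarith

def Bal {n : ℕ} (c : V n) : Prop := DD c ∧ ∀ i, c 0 ≤ c i ∧ c i ≤ 2 * c 0

lemma Bal_of {n : ℕ} {c : V n} (h : DD c) : Bal (t0 c) := by
  have hd : DD (t0 c) := DD_tb false h
  refine ⟨hd, ?_⟩
  obtain ⟨h0, h1, hm, hl⟩ := h
  have hall : ∀ j : Fin (n+1), c 1 ≤ c j.succ := fun j => by
    have := hm (Fin.zero_le j); simpa using this
  have hall2 : ∀ j : Fin (n+1), c j.succ ≤ c 0 + c 1 := fun j => (hm (Fin.le_last j)).trans hl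
  rw [t0_zero]
  apply fin_cases3
  · rw [t0_zero]; constructor <;> linarith
  · intro i; rw [t0_cs]; exact ⟨hall i.succ, by linarith [hall2 i.succ]⟩
  · rw [t0_last]; constructor <;> linarith

lemma DD_iter {n : ℕ} (j : ℕ) {c : V n} (h : DD c) : DD (t1^[j] c) := by
  induction j with
  | zero => exact h
  | succ j ih => rw [Function.iterate_succ_apply']; exact DD_tb true ih

/-- words -/
def MW (n : ℕ) : List Bool → (V n →ₗ[ℝ] V n)
  | [] => LinearMap.id
  | a :: w => mb n a ∘ₗ MW n w

def TW {n : ℕ} (w : List Bool) (c : V n) : V n := w.foldl (fun c a => tb a c) c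

lemma TW_cons {n : ℕ} (a : Bool) (w : List Bool) (c : V n) : TW (a :: w) c = TW w (tb a c) := rfl
lemma TW_append {n : ℕ} (w w' : List Bool) (c : V n) : TW (w ++ w') c = TW w' (TW w c) := by
  simp [TW]

lemma MW_append {n : ℕ} (w w' : List Bool) (b : V n) : MW n (w ++ w') b = MW n w (MW n w' b) := by
  induction w with
  | nil => rfl
  | cons a w ih => simp [MW, ih]

lemma dot_MW {n : ℕ} (w : List Bool) (c b : V n) : c ⬝ᵥ MW n w b = TW w c ⬝ᵥ b := by
  induction w generalizing c with
  | nil => rfl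
  | cons a w ih => rw [TW_cons, ← ih, ← dot_mb]; rfl

def ex : List ℕ → List Bool
  | [] => []
  | j :: l => List.replicate j true ++ false :: ex l

lemma ex_append (l l' : List ℕ) : ex (l ++ l') = ex l ++ ex l' := by
  induction l with
  | nil => rfl
  | cons j l ih => simp [ex, ih]

lemma ex_length (l : List ℕ) : l.length ≤ (ex l).length := by
  induction l with
  | nil => simp
  | cons j l ih => simp [ex]; omega

lemma DD_TW {n : ℕ} (w : List Bool) {c : V n} (h : DD c) : DD (TW w c) := by
  induction w generalizing c with
  | nil => exact h
  | cons a w ih => exact ih (DD_tb a h)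

lemma Bal_ex {n : ℕ} (l : List ℕ) {c : V n} (h : Bal c) : Bal (TW (ex l) c) := by
  induction l generalizing c with
  | nil => exact h
  | cons j l ih =>
    simp only [ex]
    rw [TW_append, TW_cons]
    exact ih (Bal_of (DD_TW _ h.1))

lemma TW_smul {n : ℕ} (w : List Bool) (s : ℝ) (g : V n) : TW w (s • g) = s • TW w g := by
  induction w generalizing g with
  | nil => rfl
  | cons a w ih => rw [TW_cons, tb_smul, ih]; rfl
lemma TW_sub {n : ℕ} (w : List Bool) (c g : V n) : TW w (c - g) = TW w c - TW w g := by
  induction w generalizing c g with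
  | nil => rfl
  | cons a w ih => rw [TW_cons, tb_sub, ih]; rfl
lemma TW_ge {n : ℕ} (w : List Bool) {c : V n} {s : ℝ} (hs : 0 ≤ s) (h : ∀ i, s ≤ c i) :
    ∀ i, s ≤ TW w c i := by
  induction w generalizing c with
  | nil => exact h
  | cons a w ih => exact ih (tb_ge a hs h)
lemma TW_mono {n : ℕ} (w : List Bool) {c g : V n} (h : ∀ i, c i ≤ g i) :
    ∀ i, TW w c i ≤ TW w g i := by
  induction w generalizing c g with
  | nil => exact h
  | cons a w ih => exact ih (tb_mono a h)
lemma TW_le {n : ℕ} (w : List Bool) {c : V n} {s : ℝ} (hs : 0 ≤ s) (h : ∀ i, c i ≤ s) :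
    ∀ i, TW w c i ≤ 2 ^ w.length * s := by
  induction w generalizing c s with
  | nil => intro i; simpa [TW] using h i
  | cons a w ih =>
    intro i
    have := ih (c := tb a c) (s := 2 * s) (by linarith) (tb_le a hs h) i
    rw [TW_cons]
    simp only [List.length_cons]
    calc _ ≤ _ := this
      _ = _ := by ring

/-- state sequence -/
def st {n : ℕ} (w : ℕ → Bool) (c : V n) (k : ℕ) : V n := TW ((List.range k).map w) c

lemma st_succ {n : ℕ} (w : ℕ → Bool) (c : V n) (k : ℕ) : st w c (k+1) = tb (w k) (st w c k) := by
  simp [st, List.range_succ, TW]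

lemma st_queue {n : ℕ} (w : ℕ → Bool) (c : V n) (j : ℕ) : ∀ (hj : j < n + 1) (k : ℕ),
    st w c k (Fin.succ ⟨j, hj⟩) = st w c (j + k) 1 := by
  induction j with
  | zero => intro hj k; simp
  | succ j ih =>
    intro hj k
    have h1 := ih (by omega) (k+1)
    have h2 := tb_cs (w k) (st w c k) ⟨j, by omega⟩
    rw [← st_succ] at h2
    rw [show j + 1 + k = j + (k+1) by ring, ← h1]
    exact h2.symm

lemma st_one {n : ℕ} (w : ℕ → Bool) (c : V n) (k : ℕ) :
    st w c (k + (n+1)) 1 = st w c k 0 + st w c k 1 := by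
  have h1 := st_queue w c n (by omega) (k+1)
  have h2 := tb_last (w k) (st w c k)
  rw [← st_succ] at h2
  rw [show k + (n+1) = n + (k+1) by ring, ← h1, ← h2]
  rfl

lemma st_zero {n : ℕ} (w : ℕ → Bool) (c : V n) (k : ℕ) :
    st w c (k+1) 0 = if w k then st w c k 0 else st w c k 1 := by
  rw [st_succ, tb_zero]

def NN (n : ℕ) : ℕ := (n + 2) * (n + 1)

lemma contr_seq {n : ℕ} (w : ℕ → Bool) {c g : V n} {s : ℝ} (hs : 0 < s) (hc : ∀ i, s ≤ c i)
    (hg0 : ∀ i, 0 ≤ g i) (hg1 : ∀ i, g i ≤ c i) :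
    (∀ i, s / 2 ≤ st w g (NN n) i) ∨ (∀ i, s / 2 ≤ st w (c - g) (NN n) i) := by
  have G0 : ∀ k i, 0 ≤ st w g k i := fun k => TW_ge _ le_rfl hg0
  have H0 : ∀ k i, 0 ≤ st w (c - g) k i := fun k => TW_ge _ le_rfl (fun i => by simpa using hg1 i)
  have C0 : ∀ k i, s ≤ st w c k i := fun k => TW_ge _ hs.le hc
  have E : ∀ k i, st w (c - g) k i = st w c k i - st w g k i := fun k i => by
    simp only [st, TW_sub]; rfl
  have := comb (n+1) (fun k => st w g k 1 < s / 2) (fun k => st w (c - g) k 1 < s / 2)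
    (fun k => st w g k 0 < s / 2) (fun k => st w (c - g) k 0 < s / 2)
    (fun k hk => by
      rw [st_one] at hk
      constructor <;> linarith [G0 k 0, G0 k 1])
    (fun k hk => by
      rw [st_one] at hk
      constructor <;> linarith [H0 k 0, H0 k 1])
    (fun k hk => by
      rw [st_zero] at hk
      split_ifs at hk
      · exact Or.inl hk
      · exact Or.inr hk)
    (fun k hk => by
      rw [st_zero] at hk
      split_ifs at hk
      · exact Or.inl hk
      · exact Or.inr hk)
    (fun k hk => by
      have := E k 1
      linarith [hk.1, hk.2, C0 k 1])
    (fun k hk => by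
      have := E k 0
      linarith [hk.1, hk.2, C0 k 0])
  rcases this with ⟨h1, h2⟩ | ⟨h1, h2⟩
  · left
    intro i
    refine Fin.cases ?_ (fun j => ?_) i
    · exact not_lt.mp h1
    · have := st_queue w g j j.2 (NN n)
      rw [show (⟨(j:ℕ), j.2⟩ : Fin (n+1)) = j from rfl] at this
      rw [this]
      exact not_lt.mp (h2 j j.2)
  · right
    intro i
    refine Fin.cases ?_ (fun j => ?_) i
    · exact not_lt.mp h1
    · have := st_queue w (c - g) j j.2 (NN n)
      rw [show (⟨(j:ℕ), j.2⟩ : Fin (n+1)) = j from rfl] at this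
      rw [this]
      exact not_lt.mp (h2 j j.2)

noncomputable def del (n : ℕ) : ℝ := 1 / (4 * 2 ^ NN n)

lemma del_pos (n : ℕ) : 0 < del n := by unfold del; positivity
lemma del_lt (n : ℕ) : del n < 1 := by
  unfold del
  rw [div_lt_one (by positivity)]
  have : (1:ℝ) ≤ 2 ^ NN n := one_le_pow₀ (by norm_num)
  linarith

lemma list_eq (w : List Bool) : w = (List.range w.length).map (fun k => w.getD k true) := by
  apply List.ext_getElem
  · simp
  · intro i h1 h2
    simp [List.getD_eq_getElem?_getD, List.getElem?_eq_getElem h1]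

lemma contr_list {n : ℕ} (w : List Bool) (hw : NN n ≤ w.length) {c g : V n} (hc : Bal c)
    (hg0 : ∀ i, 0 ≤ g i) (hg1 : ∀ i, g i ≤ c i) :
    (∀ i, del n * TW w c i ≤ TW w g i) ∨ (∀ i, TW w g i ≤ (1 - del n) * TW w c i) := by
  have hlen : (w.take (NN n)).length = NN n := by simp [hw]
  have e1 : ∀ x : V n, TW w x = TW (w.drop (NN n)) (st (fun k => (w.take (NN n)).getD k true) x (NN n)) := by
    intro x
    conv_lhs => rw [← List.take_append_drop (NN n) w]
    rw [TW_append]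
    congr 1
    unfold st
    conv_lhs => rw [list_eq (w.take (NN n))]
    rw [hlen]
  have hc0 : 0 < c 0 := hc.1.1
  have hup : ∀ i, st (fun k => (w.take (NN n)).getD k true) c (NN n) i ≤ 2 ^ (NN n) * (2 * c 0) := by
    intro i
    have := TW_le ((List.range (NN n)).map (fun k => (w.take (NN n)).getD k true)) (c := c)
      (s := 2 * c 0) (by linarith) (fun i => (hc.2 i).2) i
    simpa [st] using this
  have hp : (0:ℝ) < 2 ^ NN n := by positivity
  have hd : del n * (2 ^ (NN n) * (2 * c 0)) = c 0 / 2 := by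
    unfold del; field_simp; ring
  rcases contr_seq (fun k => (w.take (NN n)).getD k true) hc0 (fun i => (hc.2 i).1) hg0 hg1 with h | h
  · left
    have : ∀ i, (del n • st (fun k => (w.take (NN n)).getD k true) c (NN n)) i ≤
        st (fun k => (w.take (NN n)).getD k true) g (NN n) i := by
      intro i
      have h1 := mul_le_mul_of_nonneg_left (hup i) (del_pos n).le
      have h2 := h i
      simp only [Pi.smul_apply, smul_eq_mul]
      linarith
    have h3 := TW_mono (w.drop (NN n)) this
    rw [TW_smul] at h3
    rw [← e1, ← e1] at h3
    exact h3
  · right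
    have : ∀ i, (del n • st (fun k => (w.take (NN n)).getD k true) c (NN n)) i ≤
        st (fun k => (w.take (NN n)).getD k true) (c - g) (NN n) i := by
      intro i
      have h1 := mul_le_mul_of_nonneg_left (hup i) (del_pos n).le
      have h2 := h i
      simp only [Pi.smul_apply, smul_eq_mul]
      linarith
    have h3 := TW_mono (w.drop (NN n)) this
    rw [TW_smul] at h3
    rw [← e1, ← e1, TW_sub] at h3
    intro i
    have := h3 i
    simp only [Pi.smul_apply, smul_eq_mul, Pi.sub_apply] at this
    linarith

lemma contr_osc {n : ℕ} (l : List ℕ) (hl : NN n ≤ l.length) {c g : V n} (hc : Bal c) {a b : ℝ}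
    (hab : a ≤ b) (hg0 : ∀ i, a * c i ≤ g i) (hg1 : ∀ i, g i ≤ b * c i) :
    ∃ a' b', a' ≤ b' ∧ b' - a' = (1 - del n) * (b - a) ∧
      (∀ i, a' * TW (ex l) c i ≤ TW (ex l) g i) ∧ (∀ i, TW (ex l) g i ≤ b' * TW (ex l) c i) := by
  have hd := del_lt n
  have hd' := del_pos n
  have hlow := TW_mono (ex l) (c := a • c) (g := g) hg0
  have hupp := TW_mono (ex l) (c := g) (g := b • c) hg1
  rw [TW_smul] at hlow hupp
  simp only [Pi.smul_apply, smul_eq_mul] at hlow hupp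
  rcases eq_or_lt_of_le hab with h | h
  · refine ⟨a, b, hab, by rw [h]; ring, hlow, hupp⟩
  have hba : 0 < b - a := by linarith
  have hx0 : ∀ i, 0 ≤ ((b - a)⁻¹ • (g - a • c)) i := fun i => by
    simp only [Pi.smul_apply, Pi.sub_apply, smul_eq_mul]
    have := hg0 i
    exact mul_nonneg (inv_nonneg.mpr hba.le) (by linarith)
  have hx1 : ∀ i, ((b - a)⁻¹ • (g - a • c)) i ≤ c i := fun i => by
    simp only [Pi.smul_apply, Pi.sub_apply, smul_eq_mul]
    rw [inv_mul_le_iff₀ hba]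
    have := hg1 i
    linarith
  have := contr_list (ex l) (hl.trans (ex_length l)) hc hx0 hx1
  rw [TW_smul, TW_sub, TW_smul] at this
  simp only [Pi.smul_apply, Pi.sub_apply, smul_eq_mul] at this
  rcases this with h1 | h1
  · refine ⟨a + del n * (b - a), b, by nlinarith, by ring, fun i => ?_, hupp⟩
    have := h1 i
    rw [le_inv_mul_iff₀ hba] at this
    linarith
  · refine ⟨a, b - del n * (b - a), by nlinarith, by ring, hlow, fun i => ?_⟩
    have := h1 i
    rw [inv_mul_le_iff₀ hba] at this
    linarith

lemma contr_iter {n : ℕ} (k : ℕ) (l : List ℕ) (hl : l.length = k * NN n) {c g : V n} (hc : Bal c)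
    {a b : ℝ} (hab : a ≤ b) (hg0 : ∀ i, a * c i ≤ g i) (hg1 : ∀ i, g i ≤ b * c i) :
    ∃ a' b', a' ≤ b' ∧ b' - a' = (1 - del n) ^ k * (b - a) ∧
      (∀ i, a' * TW (ex l) c i ≤ TW (ex l) g i) ∧ (∀ i, TW (ex l) g i ≤ b' * TW (ex l) c i) := by
  induction k generalizing l c g a b with
  | zero =>
    have : l = [] := by simpa using hl
    subst this
    exact ⟨a, b, hab, by simp, hg0, hg1⟩
  | succ k ih =>
    have e : (k + 1) * NN n = k * NN n + NN n := by ring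
    obtain ⟨a', b', h1, h2, h3, h4⟩ := contr_osc (l.take (NN n)) (by simp [hl, e]) hc hab hg0 hg1
    obtain ⟨a2, b2, h5, h6, h7, h8⟩ := ih (l.drop (NN n)) (by simp [hl, e])
      (Bal_ex (l.take (NN n)) hc) h1 h3 h4
    rw [← TW_append, ← TW_append, ← ex_append, List.take_append_drop] at h7 h8
    exact ⟨a2, b2, h5, by rw [h6, h2]; ring, h7, h8⟩

/-- diameter of cylinders -/
lemma dot_mono {n : ℕ} {c g b : V n} (hb : b ∈ K n) (h : ∀ i, c i ≤ g i) : c ⬝ᵥ b ≤ g ⬝ᵥ b :=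
  Finset.sum_le_sum fun i _ => mul_le_mul_of_nonneg_right (h i) (hb i).le

def one (n : ℕ) : V n := fun _ => 1

lemma Bal_one (n : ℕ) : Bal (one n) := by
  refine ⟨⟨by simp [one], by simp [one], fun _ _ _ => le_rfl, by simp [one]⟩, fun i => by simp [one]⟩

lemma dot_pos {n : ℕ} {c b : V n} (hc : ∀ i, 0 < c i) (hb : b ∈ K n) : 0 < c ⬝ᵥ b :=
  Finset.sum_pos (fun i _ => mul_pos (hc i) (hb i)) Finset.univ_nonempty

lemma diam {n : ℕ} (k : ℕ) (l : List ℕ) (hl : l.length = k * NN n) {x y : V n}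
    (hx : x ∈ MW n (ex l) '' K n) (hy : y ∈ MW n (ex l) '' K n) (i : Fin (n+2)) :
    |x i * (one n ⬝ᵥ y) - y i * (one n ⬝ᵥ x)| ≤ (1 - del n) ^ k * (one n ⬝ᵥ x) * (one n ⬝ᵥ y) := by
  obtain ⟨a, b, -, h2, h3, h4⟩ := contr_iter k l hl (Bal_one n) (g := Pi.single i 1) (a := 0) (b := 1)
    zero_le_one (fun j => by
      by_cases h : j = i
      · subst h; simp
      · simp [h]) (fun j => by
      by_cases h : j = i
      · subst h; simp [one]
      · simp [h, one])
  have key : ∀ z ∈ MW n (ex l) '' K n, 0 < one n ⬝ᵥ z ∧ a * (one n ⬝ᵥ z) ≤ z i ∧ z i ≤ b * (one n ⬝ᵥ z) := by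
    rintro z ⟨u, hu, rfl⟩
    have hz : (MW n (ex l) u) i = (Pi.single i 1 : V n) ⬝ᵥ MW n (ex l) u := by simp
    rw [hz, dot_MW, dot_MW]
    refine ⟨dot_pos (fun j => ?_) hu, ?_, ?_⟩
    · have := TW_ge (ex l) (c := one n) (s := 1) zero_le_one (fun i => by simp [one]) j
      linarith
    · have := dot_mono (c := a • TW (ex l) (one n)) (g := TW (ex l) (Pi.single i 1)) hu h3
      simpa [smul_dotProduct] using this
    · have := dot_mono (g := b • TW (ex l) (one n)) (c := TW (ex l) (Pi.single i 1)) hu h4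
      simpa [smul_dotProduct] using this
  obtain ⟨x0, x1, x2⟩ := key x hx
  obtain ⟨y0, y1, y2⟩ := key y hy
  have hb : (1 - del n) ^ k = b - a := by rw [h2]; ring
  rw [hb]
  have e1 := mul_le_mul_of_nonneg_right x1 y0.le
  have e2 := mul_le_mul_of_nonneg_right x2 y0.le
  have e3 := mul_le_mul_of_nonneg_right y1 x0.le
  have e4 := mul_le_mul_of_nonneg_right y2 x0.le
  rw [abs_le]
  constructor <;> nlinarith

end Selmer

namespace Selmer

lemma MW_inj (n : ℕ) (w : List Bool) : Function.Injective (MW n w) := by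
  induction w with
  | nil => exact Function.injective_id
  | cons a w ih =>
    have : Function.Injective (mb n a) := by
      cases a
      · simpa [mb] using m0_inj n
      · simpa [mb] using m1_inj n
    exact this.comp ih

lemma MW_K {n : ℕ} (w : List Bool) {b : V n} (hb : b ∈ K n) : MW n w b ∈ K n := by
  induction w with
  | nil => exact hb
  | cons a w ih =>
    change mb n a (MW n w b) ∈ K n
    cases a
    · exact m0_K ih
    · exact m1_K ih

lemma det_ne_of_inj {n : ℕ} {L : V n →ₗ[ℝ] V n} (h : Function.Injective L) : LinearMap.det L ≠ 0 := by
  intro h0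
  have := LinearMap.bot_lt_ker_of_det_eq_zero h0
  rw [LinearMap.ker_eq_bot.mpr h] at this
  exact lt_irrefl _ this

lemma K_open (n : ℕ) : IsOpen (K n) := by
  have : K n = Set.pi Set.univ (fun _ => Set.Ioi 0) := by
    ext b; simp [K]
  rw [this]
  exact isOpen_set_pi Set.finite_univ (fun _ _ => isOpen_Ioi)

lemma K_meas (n : ℕ) : MeasurableSet (K n) := (K_open n).measurableSet

lemma img_meas {n : ℕ} {L : V n →ₗ[ℝ] V n} (h : Function.Injective L) {s : Set (V n)}
    (hs : MeasurableSet s) : MeasurableSet (L '' s) :=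
  hs.image_of_continuousOn_injOn (L.continuous_of_finiteDimensional.continuousOn) h.injOn

lemma cover_one {n : ℕ} (N : ℕ) : ∀ (b : V n) (_ : b ∈ K n) (μ : ℝ) (_ : ∀ j : Fin (n+1), μ ≤ b j.succ)
    (_ : b 0 < N * μ),
    (∃ j, ∃ x ∈ K n, MW n (ex [j]) x = b) ∨
      (∃ j, ∃ x ∈ K n, x 0 = x 1 ∧ MW n (List.replicate j true) x = b) := by
  induction N with
  | zero =>
    intro b hb μ _ h
    have := hb 0
    simp at h
    linarith
  | succ N ih =>
    intro b hb μ hμ h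
    rcases lt_trichotomy (b 0) (b 1) with h1 | h1 | h1
    · left
      obtain ⟨x, hx, hxb⟩ := m0_surj hb h1
      exact ⟨0, x, hx, hxb⟩
    · right
      exact ⟨0, b, hb, h1, rfl⟩
    · obtain ⟨x, hx, hxb, hx0, hxs⟩ := m1_surj hb h1
      have := ih x hx μ (fun j => by rw [hxs]; exact hμ _) (by
        rw [hx0]
        have h2 := hμ 0
        rw [Fin.succ_zero_eq_one] at h2
        push_cast at h
        linarith)
      rcases this with ⟨j, y, hy, hyx⟩ | ⟨j, y, hy, hy1, hyx⟩
      · left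
        refine ⟨j+1, y, hy, ?_⟩
        rw [← hxb, ← hyx]
        rfl
      · right
        refine ⟨j+1, y, hy, hy1, ?_⟩
        rw [← hxb, ← hyx]
        rfl

lemma cover_one' {n : ℕ} {b : V n} (hb : b ∈ K n) :
    (∃ j, ∃ x ∈ K n, MW n (ex [j]) x = b) ∨
      (∃ j, ∃ x ∈ K n, x 0 = x 1 ∧ MW n (List.replicate j true) x = b) := by
  obtain ⟨j0, hj0⟩ := Finite.exists_min (fun j : Fin (n+1) => b j.succ)
  obtain ⟨N, hN⟩ := exists_nat_gt (b 0 / b j0.succ)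
  refine cover_one N b hb (b j0.succ) hj0 ?_
  rwa [div_lt_iff₀ (hb _)] at hN

lemma img_null {n : ℕ} (L : V n →ₗ[ℝ] V n) {s : Set (V n)} (h : volume s = 0) : volume (L '' s) = 0 := by
  rw [Measure.addHaar_image_linearMap, h, mul_zero]

lemma hyper_null {n : ℕ} (L : V n →ₗ[ℝ] ℝ) (hL : L ≠ 0) : volume {b : V n | L b = 0} = 0 := by
  have := Measure.addHaar_submodule (volume : Measure (V n)) (LinearMap.ker L) (by
    intro h
    exact hL (LinearMap.ker_eq_top.mp h))
  exact this

lemma diag_null (n : ℕ) : volume {b : V n | b 0 = b 1} = 0 := by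
  have := hyper_null (n := n) ((LinearMap.proj (0 : Fin (n+2)) : V n →ₗ[ℝ] ℝ) - (LinearMap.proj (1 : Fin (n+2)) : V n →ₗ[ℝ] ℝ)) (by
    intro h
    have := LinearMap.congr_fun h (Pi.single 0 1)
    simp at this)
  simpa [sub_eq_zero] using this

lemma cover_null (n k : ℕ) :
    volume {b : V n | b ∈ K n ∧ ∀ l : List ℕ, l.length = k → b ∉ MW n (ex l) '' K n} = 0 := by
  induction k with
  | zero =>
    convert measure_empty (μ := (volume : Measure (V n)))
    ext b
    simp only [Set.mem_ofPred_eq, Set.mem_empty_iff_false, iff_false, not_and]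
    intro hb h
    exact h [] rfl ⟨b, hb, rfl⟩
  | succ k ih =>
    refine measure_mono_null (t := (⋃ j : ℕ, MW n (List.replicate j true) '' {b : V n | b 0 = b 1}) ∪
      ⋃ j : ℕ, MW n (ex [j]) '' {b : V n | b ∈ K n ∧ ∀ l : List ℕ, l.length = k → b ∉ MW n (ex l) '' K n}) ?_ ?_
    · rintro b ⟨hb, h⟩
      rcases cover_one' hb with ⟨j, x, hx, hxb⟩ | ⟨j, x, hx, hx1, hxb⟩
      · right
        refine Set.mem_iUnion.mpr ⟨j, x, ⟨hx, ?_⟩, hxb⟩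
        rintro l hl ⟨y, hy, rfl⟩
        refine h (j :: l) (by simp [hl]) ⟨y, hy, ?_⟩
        rw [← hxb, ← MW_append, ← ex_append]
        rfl
      · left
        exact Set.mem_iUnion.mpr ⟨j, x, hx1, hxb⟩
    · refine measure_union_null ?_ ?_
      · exact measure_iUnion_null fun j => img_null _ (diag_null n)
      · exact measure_iUnion_null fun j => img_null _ ih

lemma first_uniq {n : ℕ} (j : ℕ) : ∀ (j' : ℕ) (x y : V n) (_ : x ∈ K n) (_ : y ∈ K n)
    (_ : MW n (List.replicate j true) (m0 n x) = MW n (List.replicate j' true) (m0 n y)), j = j' ∧ x = y := by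
  have aux : ∀ (j : ℕ) (x y : V n) (_ : x ∈ K n) (_ : y ∈ K n),
      m0 n x ≠ MW n (List.replicate (j+1) true) (m0 n y) := by
    intro j x y hx hy h
    have h1 := m0_lt hx
    have h2 := m1_lt (MW_K (List.replicate j true) (m0_K hy))
    rw [h] at h1
    exact lt_asymm h1 h2
  induction j with
  | zero =>
    intro j' x y hx hy h
    cases j' with
    | zero => exact ⟨rfl, m0_inj n h⟩
    | succ j' => exact absurd h (aux j' x y hx hy)
  | succ j ih =>
    intro j' x y hx hy h
    cases j' with
    | zero => exact absurd h.symm (aux j y x hy hx)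
    | succ j' =>
      have h' := m1_inj n (show m1 n (MW n (List.replicate j true) (m0 n x)) =
        m1 n (MW n (List.replicate j' true) (m0 n y)) from h)
      obtain ⟨h1, h2⟩ := ih j' x y hx hy h'
      exact ⟨by rw [h1], h2⟩

lemma tile_uniq {n : ℕ} (l : List ℕ) : ∀ (l' : List ℕ) (_ : l.length = l'.length) (x y : V n)
    (_ : x ∈ K n) (_ : y ∈ K n) (_ : MW n (ex l) x = MW n (ex l') y), l = l' := by
  induction l with
  | nil =>
    intro l' h _ _ _ _ _
    exact (List.length_eq_zero_iff.mp h.symm).symm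
  | cons j l ih =>
    intro l' hl x y hx hy h
    cases l' with
    | nil => simp at hl
    | cons j' l' =>
      simp only [ex] at h
      rw [MW_append, MW_append] at h
      obtain ⟨h1, h2⟩ := first_uniq j j' _ _ (MW_K (ex l) hx) (MW_K (ex l') hy) h
      rw [h1, ih l' (by simpa using hl) x y hx hy h2]

abbrev Idx (k : ℕ) := {l : List ℕ // l.length = k}

def tile (n : ℕ) (l : List ℕ) : Set (V n) := MW n (ex l) '' K n

lemma tile_meas (n : ℕ) (l : List ℕ) : MeasurableSet (tile n l) := img_meas (MW_inj n _) (K_meas n)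

lemma tile_sub (n : ℕ) (l : List ℕ) : tile n l ⊆ K n := by
  rintro _ ⟨x, hx, rfl⟩
  exact MW_K _ hx

lemma tile_disj (n k : ℕ) : Pairwise (Function.onFun Disjoint fun l : Idx k => tile n l.1) := by
  intro l l' h
  refine Set.disjoint_left.mpr ?_
  rintro _ ⟨x, hx, rfl⟩ ⟨y, hy, hxy⟩
  apply h
  apply Subtype.ext
  exact tile_uniq _ _ (l.2.trans l'.2.symm) x y hx hy hxy.symm

lemma tile_cover (n k : ℕ) : volume (K n \ ⋃ l : Idx k, tile n l.1) = 0 := by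
  refine measure_mono_null ?_ (cover_null n k)
  rintro b ⟨hb, h⟩
  refine ⟨hb, fun l hl hbl => h (Set.mem_iUnion.mpr ⟨⟨l, hl⟩, hbl⟩)⟩

end Selmer

namespace Selmer

lemma lint_img {n : ℕ} {Z : V n →ₗ[ℝ] V n} (hZ : Function.Injective Z) {s : Set (V n)}
    (hs : MeasurableSet s) (φ : V n → ENNReal) :
    ∫⁻ x in Z '' s, φ x = ENNReal.ofReal |LinearMap.det Z| * ∫⁻ x in s, φ (Z x) := by
  have h := lintegral_image_eq_lintegral_abs_det_fderiv_mul (volume : Measure (V n)) hs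
    (f := Z) (f' := fun _ => LinearMap.toContinuousLinearMap Z)
    (fun x _ => (LinearMap.toContinuousLinearMap Z).hasFDerivWithinAt) hZ.injOn φ
  rw [h, lintegral_const_mul' _ _ ENNReal.ofReal_ne_top]
  simp [ContinuousLinearMap.det]

lemma inj_of_det {n : ℕ} {Z : V n →ₗ[ℝ] V n} (h : LinearMap.det Z ≠ 0) : Function.Injective Z := by
  have := LinearMap.equivOfDetNeZero Z h
  exact (LinearMap.equivOfDetNeZero Z h).injective

lemma lint_comp_le {n : ℕ} {Z : V n →ₗ[ℝ] V n} {δ : ℝ} (hδ : 0 < δ) (hd : δ ≤ |LinearMap.det Z|)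
    {s s' : Set (V n)} (hs : MeasurableSet s) (hm : Set.MapsTo Z s s') (φ : V n → ENNReal) :
    ∫⁻ x in s, φ (Z x) ≤ ENNReal.ofReal δ⁻¹ * ∫⁻ x in s', φ x := by
  have hZ : Function.Injective Z := inj_of_det (by
    intro h0; rw [h0] at hd; simp at hd; linarith)
  have h1 := lint_img hZ hs φ
  have h2 : ∫⁻ x in Z '' s, φ x ≤ ∫⁻ x in s', φ x :=
    lintegral_mono_set (Set.image_subset_iff.mpr hm)
  rw [h1] at h2
  calc ∫⁻ x in s, φ (Z x) = ENNReal.ofReal δ⁻¹ * (ENNReal.ofReal δ * ∫⁻ x in s, φ (Z x)) := by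
        rw [← mul_assoc, ← ENNReal.ofReal_mul (by positivity), inv_mul_cancel₀ hδ.ne']
        simp
    _ ≤ _ := by
        gcongr
        refine le_trans ?_ h2
        gcongr

def rk {n : ℕ} (τ : ℝ) (c v : V n) : V n →ₗ[ℝ] V n where
  toFun b := τ • b + (c ⬝ᵥ b) • v
  map_add' x y := by
    simp only [dotProduct_add, smul_add, add_smul]; abel
  map_smul' a x := by
    simp only [dotProduct_smul, smul_add, smul_smul, RingHom.id_apply, smul_eq_mul]
    congr 2; ring

lemma rk_apply {n : ℕ} (τ : ℝ) (c v b : V n) : rk τ c v b = τ • b + (c ⬝ᵥ b) • v := rfl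

lemma dot_rk {n : ℕ} (τ : ℝ) (g c v b : V n) :
    g ⬝ᵥ rk τ c v b = τ * (g ⬝ᵥ b) + (c ⬝ᵥ b) * (g ⬝ᵥ v) := by
  rw [rk_apply, dotProduct_add, dotProduct_smul, dotProduct_smul]; rfl

lemma det_rk_one {n : ℕ} (c v : V n) : LinearMap.det (rk 1 c v) = 1 + c ⬝ᵥ v := by
  have : rk 1 c v = Matrix.toLin' (1 + Matrix.replicateCol Unit v * Matrix.replicateRow Unit c) := by
    apply LinearMap.ext
    intro b
    ext i
    simp only [rk_apply, Matrix.toLin'_apply, Matrix.add_mulVec, Matrix.one_mulVec, one_smul, Pi.add_apply,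
      ← Matrix.mulVec_mulVec]
    simp [Matrix.mulVec, dotProduct, Matrix.replicateCol, Matrix.replicateRow]
    ring
  rw [this, LinearMap.det_toLin', Matrix.det_one_add_replicateCol_mul_replicateRow]

lemma det_rk {n : ℕ} {τ : ℝ} (hτ : τ ≠ 0) (c v : V n) :
    LinearMap.det (rk τ c v) = τ ^ (n+1) * (τ + c ⬝ᵥ v) := by
  have : rk τ c v = τ • rk 1 c (τ⁻¹ • v) := by
    apply LinearMap.ext
    intro b
    simp only [rk_apply, LinearMap.smul_apply, smul_add, smul_smul]
    congr 2
    · ring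
    · field_simp
  rw [this, LinearMap.det_smul, det_rk_one, dotProduct_smul]
  simp only [Module.finrank_fintype_fun_eq_card, Fintype.card_fin, smul_eq_mul]
  field_simp
  ring

def Sr {n : ℕ} (c : V n) (R : ℝ) : Set (V n) := {b | b ∈ K n ∧ c ⬝ᵥ b < R}

lemma dot_cont {n : ℕ} (c : V n) : Continuous (fun b : V n => c ⬝ᵥ b) := by
  unfold dotProduct; fun_prop

lemma Sr_meas {n : ℕ} (c : V n) (R : ℝ) : MeasurableSet (Sr c R) :=
  (K_meas n).inter ((dot_cont c).measurable measurableSet_Iio)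

noncomputable def dl (n : ℕ) : ℝ := min |LinearMap.det (m1 n)| 1 * (1/2) ^ (n+1)

lemma dl_pos (n : ℕ) : 0 < dl n := by
  unfold dl
  have : 0 < |LinearMap.det (m1 n)| := abs_pos.mpr (det_ne_of_inj (m1_inj n))
  have : 0 < min |LinearMap.det (m1 n)| 1 := lt_min this one_pos
  positivity

lemma dl_le1 (n : ℕ) {x : ℝ} (hx : (1/2:ℝ) ^ (n+1) ≤ x) : dl n ≤ x := by
  unfold dl
  refine le_trans ?_ hx
  have := min_le_right |LinearMap.det (m1 n)| 1
  have h : (0:ℝ) < (1/2) ^ (n+1) := by positivity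
  nlinarith

lemma dl_le2 (n : ℕ) {x : ℝ} (hx : (1/2:ℝ) ^ (n+1) ≤ x) : dl n ≤ |LinearMap.det (m1 n)| * x := by
  unfold dl
  have := min_le_left |LinearMap.det (m1 n)| 1
  have h : (0:ℝ) < (1/2) ^ (n+1) := by positivity
  gcongr

lemma sum_t1 {n : ℕ} (c : V n) : ∑ j : Fin (n+1), t1 c j.succ = ∑ j : Fin (n+1), c j.succ + c 0 := by
  rw [← Equiv.sum_comp (Equiv.addRight (1 : Fin (n+1))) (fun j => c j.succ)]
  simp [t1, Finset.sum_add_distrib]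

noncomputable def pv {n : ℕ} (c : V n) (lam : ℝ) : V n :=
  (Fin.cons ((1 - (2*(lam-1)/c 0) * ∑ j : Fin (n+1), c j.succ) / c 0)
    (fun _ => 2*(lam-1)/c 0) : Fin (n+2) → ℝ)

lemma dot_pv {n : ℕ} (g c : V n) (lam : ℝ) : g ⬝ᵥ pv c lam =
    g 0 * ((1 - (2*(lam-1)/c 0) * ∑ j : Fin (n+1), c j.succ) / c 0) +
      (∑ j : Fin (n+1), g j.succ) * (2*(lam-1)/c 0) := by
  unfold dotProduct
  rw [Fin.sum_univ_succ, Finset.sum_mul]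
  rfl

noncomputable def lam0 (n : ℕ) : ℝ := 1 + 1 / (4 * (n+1))

lemma pv_nonneg {n : ℕ} {c : V n} (hc : Bal c) {lam : ℝ} (h1 : 1 ≤ lam) (h2 : lam ≤ lam0 n) :
    ∀ i, 0 ≤ pv c lam i := by
  have hc0 : 0 < c 0 := hc.1.1
  intro i
  refine Fin.cases ?_ (fun j => ?_) i
  · change 0 ≤ (1 - (2*(lam-1)/c 0) * ∑ j : Fin (n+1), c j.succ) / c 0
    refine div_nonneg ?_ hc0.le
    have hs : ∑ j : Fin (n+1), c j.succ ≤ (n+1) * (2 * c 0) := by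
      calc ∑ j : Fin (n+1), c j.succ ≤ ∑ j : Fin (n+1), 2 * c 0 :=
            Finset.sum_le_sum fun j _ => (hc.2 _).2
        _ = _ := by simp
    have hb : 0 ≤ 2*(lam-1)/c 0 := div_nonneg (by linarith) hc0.le
    have := mul_le_mul_of_nonneg_left hs hb
    have e : 2*(lam-1)/c 0 * ((n+1) * (2 * c 0)) = 4 * (n+1) * (lam - 1) := by
      field_simp; ring
    have e2 : 4 * ((n:ℝ)+1) * (lam - 1) ≤ 1 := by
      unfold lam0 at h2
      have h3 : lam - 1 ≤ 1 / (4 * (n+1)) := by linarith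
      rw [le_div_iff₀ (by positivity)] at h3
      linarith
    linarith
  · change 0 ≤ 2*(lam-1)/c 0
    exact div_nonneg (by linarith) hc0.le

lemma t1_le3 {n : ℕ} {c : V n} (hc : Bal c) : ∀ i, t1 c i ≤ 3 * c i := by
  have hc0 : 0 < c 0 := hc.1.1
  apply fin_cases3
  · rw [t1_zero]; linarith
  · intro i; rw [t1_cs]; linarith [(hc.2 i.succ.succ).2, (hc.2 i.castSucc.succ).1]
  · rw [t1_last]; linarith [(hc.2 1).2, (hc.2 (Fin.last n).succ).1]

lemma lam0_le (n : ℕ) : lam0 n ≤ 5/4 := by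
  unfold lam0
  have : (1:ℝ) / (4 * (n+1)) ≤ 1 / 4 := by
    apply one_div_le_one_div_of_le <;> norm_num
  linarith

lemma rk_K {n : ℕ} {τ : ℝ} (hτ : 0 < τ) {c v b : V n} (hc : 0 ≤ c ⬝ᵥ b) (hv : ∀ i, 0 ≤ v i)
    (hb : b ∈ K n) : rk τ c v b ∈ K n := by
  intro i
  rw [rk_apply]
  simp only [Pi.add_apply, Pi.smul_apply, smul_eq_mul]
  have := mul_pos hτ (hb i)
  have := mul_nonneg hc (hv i)
  linarith

lemma ae_comp {n : ℕ} {Z : V n →ₗ[ℝ] V n} (hZ : LinearMap.det Z ≠ 0) {f : V n → ENNReal}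
    (hf : AEMeasurable f volume) : AEMeasurable (fun b => f (Z b)) volume :=
  hf.comp_quasiMeasurePreserving (Measure.LinearMap.quasiMeasurePreserving volume Z hZ)

lemma local_est {n : ℕ} {f : V n → ℝ} (hfm : AEMeasurable f volume)
    (hf1 : ∀ b ∈ K n, f (m1 n b) = f b) {c : V n} (hc : Bal c) {g : ℝ → ℝ} (hg : Measurable g)
    {R lam : ℝ} (h1 : 1 ≤ lam) (h2 : lam ≤ lam0 n) :
    ∫⁻ b in Sr c (R/3), edist (f b) (f (lam • b)) ≤
      6 * ENNReal.ofReal (dl n)⁻¹ * ∫⁻ b in Sr c R, edist (f b) (g (c ⬝ᵥ b)) := by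
  set H : V n → ENNReal := fun b => edist (f b) (g (c ⬝ᵥ b)) with hH
  have hHm : AEMeasurable H volume := by
    refine AEMeasurable.edist hfm ?_
    exact (hg.comp (dot_cont c).measurable).aemeasurable
  have hc0 : 0 < c 0 := hc.1.1
  have h54 := lam0_le n
  have hcpos : ∀ i, 0 < c i := fun i => lt_of_lt_of_le hc0 (hc.2 i).1
  set X := rk (1/2) c ((1/2 : ℝ) • pv c lam) with hX
  set q : V n := Pi.single 0 ((lam - 1/2)/c 0) with hq
  set Y := rk (1/2) c q with hY
  have hq0 : ∀ i, 0 ≤ q i := fun i => by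
    rw [hq]
    by_cases h : i = 0
    · subst h
      simp
      exact div_nonneg (by linarith) hc0.le
    · simp [h]
  have hp0 : ∀ i, 0 ≤ ((1/2 : ℝ) • pv c lam) i := fun i => by
    have := pv_nonneg hc h1 h2 i
    simp only [Pi.smul_apply, smul_eq_mul]; linarith
  have cp : c ⬝ᵥ pv c lam = 1 := by
    rw [dot_pv]; field_simp; ring
  have tp : t1 c ⬝ᵥ pv c lam = 2 * lam - 1 := by
    rw [dot_pv, sum_t1, t1_zero]; field_simp; ring
  have cq : c ⬝ᵥ q = lam - 1/2 := by
    rw [hq]; simp; field_simp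
  have tq : t1 c ⬝ᵥ q = lam - 1/2 := by
    rw [hq]; simp [t1_zero]; field_simp
  have cX : ∀ b, c ⬝ᵥ X b = c ⬝ᵥ b := fun b => by
    rw [hX, dot_rk, dotProduct_smul, cp]; simp; ring
  have cY : ∀ b, c ⬝ᵥ Y b = lam * (c ⬝ᵥ b) := fun b => by
    rw [hY, dot_rk, cq]; ring
  have cmX : ∀ b, c ⬝ᵥ m1 n (X b) = 1/2 * (t1 c ⬝ᵥ b) + (lam - 1/2) * (c ⬝ᵥ b) := fun b => by
    rw [dot_m1, hX, dot_rk, dotProduct_smul, tp]; simp; ring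
  have cmY : ∀ b, c ⬝ᵥ m1 n (Y b) = 1/2 * (t1 c ⬝ᵥ b) + (lam - 1/2) * (c ⬝ᵥ b) := fun b => by
    rw [dot_m1, hY, dot_rk, tq]; ring
  have dX : LinearMap.det X = (1/2) ^ (n+1) := by
    rw [hX, det_rk (by norm_num), dotProduct_smul, cp]; norm_num
  have dY : LinearMap.det Y = (1/2) ^ (n+1) * lam := by
    rw [hY, det_rk (by norm_num), cq]; norm_num
  have hpw : (0:ℝ) < (1/2) ^ (n+1) := by positivity
  have dY' : (1/2:ℝ) ^ (n+1) ≤ LinearMap.det Y := by rw [dY]; nlinarith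
  have hdot : ∀ b ∈ K n, 0 < c ⬝ᵥ b := fun b hb => dot_pos hcpos hb
  have hXK : ∀ b ∈ K n, X b ∈ K n := fun b hb => rk_K (by norm_num) (hdot b hb).le hp0 hb
  have hYK : ∀ b ∈ K n, Y b ∈ K n := fun b hb => rk_K (by norm_num) (hdot b hb).le hq0 hb
  have ht3 : ∀ b ∈ K n, t1 c ⬝ᵥ b ≤ 3 * (c ⬝ᵥ b) := fun b hb => by
    have := dot_mono (c := t1 c) (g := (3:ℝ) • c) hb (t1_le3 hc)
    rwa [smul_dotProduct] at this
  have key : ∀ Z : V n →ₗ[ℝ] V n, dl n ≤ |LinearMap.det Z| → Set.MapsTo Z (Sr c (R/3)) (Sr c R) →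
      ∫⁻ b in Sr c (R/3), H (Z b) ≤ ENNReal.ofReal (dl n)⁻¹ * ∫⁻ b in Sr c R, H b :=
    fun Z hd hm => lint_comp_le (dl_pos n) hd (Sr_meas _ _) hm H
  have hpw1 : (1/2:ℝ) ^ (n+1) ≤ 1 := pow_le_one₀ (by norm_num) (by norm_num)
  have did : dl n ≤ |LinearMap.det (LinearMap.id : V n →ₗ[ℝ] V n)| := by
    rw [LinearMap.det_id, abs_one]; exact dl_le1 n hpw1
  have dX2 : dl n ≤ |LinearMap.det X| := by
    rw [dX, abs_of_pos hpw]; exact dl_le1 n le_rfl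
  have dY2 : dl n ≤ |LinearMap.det Y| := dl_le1 n (dY'.trans (le_abs_self _))
  have dmX : dl n ≤ |LinearMap.det (m1 n ∘ₗ X)| := by
    rw [LinearMap.det_comp, abs_mul, dX, abs_of_pos hpw]; exact dl_le2 n le_rfl
  have dmY : dl n ≤ |LinearMap.det (m1 n ∘ₗ Y)| := by
    rw [LinearMap.det_comp, abs_mul]; exact dl_le2 n (dY'.trans (le_abs_self _))
  have dla : dl n ≤ |LinearMap.det (lam • (LinearMap.id : V n →ₗ[ℝ] V n))| := by
    rw [LinearMap.det_smul, LinearMap.det_id, mul_one]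
    have : (1:ℝ) ≤ lam ^ (Module.finrank ℝ (V n)) := one_le_pow₀ h1
    exact dl_le1 n (hpw1.trans (this.trans (le_abs_self _)))
  have ne : ∀ {Z : V n →ₗ[ℝ] V n}, dl n ≤ |LinearMap.det Z| → LinearMap.det Z ≠ 0 := by
    intro Z hZ h0
    rw [h0, abs_zero] at hZ
    linarith [dl_pos n]
  have kid := key LinearMap.id did (fun b hb => ⟨hb.1, by
    have := hdot b hb.1
    have := hb.2
    simp only [LinearMap.id_apply]; linarith⟩)
  have kX := key X dX2 (fun b hb => ⟨hXK b hb.1, by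
    have := hdot b hb.1
    have := hb.2
    rw [cX]; linarith⟩)
  have kY := key Y dY2 (fun b hb => ⟨hYK b hb.1, by
    have := hdot b hb.1
    have := hb.2
    rw [cY]; nlinarith⟩)
  have kmX := key (m1 n ∘ₗ X) dmX (fun b hb => ⟨m1_K (hXK b hb.1), by
    have := hdot b hb.1
    have := hb.2
    have := ht3 b hb.1
    rw [LinearMap.comp_apply, cmX]; nlinarith⟩)
  have kmY := key (m1 n ∘ₗ Y) dmY (fun b hb => ⟨m1_K (hYK b hb.1), by
    have := hdot b hb.1
    have := hb.2
    have := ht3 b hb.1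
    rw [LinearMap.comp_apply, cmY]; nlinarith⟩)
  have kla := key (lam • LinearMap.id) dla (fun b hb => ⟨fun i => mul_pos (by linarith) (hb.1 i), by
    have := hdot b hb.1
    have := hb.2
    simp only [LinearMap.smul_apply, LinearMap.id_apply, dotProduct_smul, smul_eq_mul]
    nlinarith⟩)
  have pt : ∀ b ∈ Sr c (R/3), edist (f b) (f (lam • b)) ≤
      H ((LinearMap.id : V n →ₗ[ℝ] V n) b) + (H (X b) + (H ((m1 n ∘ₗ X) b) + (H ((m1 n ∘ₗ Y) b) + (H (Y b) +
        H ((lam • LinearMap.id : V n →ₗ[ℝ] V n) b))))) := by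
    intro b hb
    simp only [hH, LinearMap.id_apply, LinearMap.comp_apply, LinearMap.smul_apply]
    rw [cX, cmX, cmY, cY, hf1 _ (hXK b hb.1), hf1 _ (hYK b hb.1), dotProduct_smul, smul_eq_mul]
    generalize f b = a0
    generalize g (c ⬝ᵥ b) = a1
    generalize f (X b) = a2
    generalize g (1/2 * (t1 c ⬝ᵥ b) + (lam - 1/2) * (c ⬝ᵥ b)) = a3
    generalize f (Y b) = a4
    generalize g (lam * (c ⬝ᵥ b)) = a5
    generalize f (lam • b) = a6
    calc edist a0 a6 ≤ edist a0 a1 + edist a1 a6 := edist_triangle _ _ _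
      _ ≤ edist a0 a1 + (edist a1 a2 + edist a2 a6) := by gcongr; exact edist_triangle _ _ _
      _ ≤ edist a0 a1 + (edist a1 a2 + (edist a2 a3 + edist a3 a6)) := by
        gcongr; exact edist_triangle _ _ _
      _ ≤ edist a0 a1 + (edist a1 a2 + (edist a2 a3 + (edist a3 a4 + edist a4 a6))) := by
        gcongr; exact edist_triangle _ _ _
      _ ≤ edist a0 a1 + (edist a1 a2 + (edist a2 a3 + (edist a3 a4 + (edist a4 a5 + edist a5 a6)))) := by
        gcongr; exact edist_triangle _ _ _
      _ = _ := by rw [edist_comm a1 a2, edist_comm a3 a4, edist_comm a5 a6]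
  refine (setLIntegral_mono_ae' (Sr_meas _ _) (Filter.Eventually.of_forall pt)).trans ?_
  have rs : ∀ {φ : V n → ENNReal}, AEMeasurable φ volume →
    AEMeasurable φ (volume.restrict (Sr c (R/3))) := fun h => h.restrict
  rw [lintegral_add_left' (rs (ae_comp (ne did) hHm)), lintegral_add_left' (rs (ae_comp (ne dX2) hHm)),
    lintegral_add_left' (rs (ae_comp (ne dmX) hHm)), lintegral_add_left' (rs (ae_comp (ne dmY) hHm)),
    lintegral_add_left' (rs (ae_comp (ne dY2) hHm))]
  calc _ ≤ _ := add_le_add kid (add_le_add kX (add_le_add kmX (add_le_add kmY (add_le_add kY kla))))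
    _ = _ := by ring

end Selmer

namespace Selmer

def Tl (n : ℕ) (l : List ℕ) (R : ℝ) : Set (V n) := tile n l ∩ {x | one n ⬝ᵥ x < R}

noncomputable def cl (n : ℕ) (l : List ℕ) : V n := TW (ex l) (one n)

lemma cl_Bal (n : ℕ) (l : List ℕ) : Bal (cl n l) := Bal_ex l (Bal_one n)

lemma dot_cl {n : ℕ} (l : List ℕ) (b : V n) : one n ⬝ᵥ MW n (ex l) b = cl n l ⬝ᵥ b := dot_MW _ _ _

lemma Tl_eq (n : ℕ) (l : List ℕ) (R : ℝ) : Tl n l R = MW n (ex l) '' Sr (cl n l) R := by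
  ext x
  constructor
  · rintro ⟨⟨b, hb, rfl⟩, h⟩
    exact ⟨b, ⟨hb, by rw [← dot_cl]; exact h⟩, rfl⟩
  · rintro ⟨b, ⟨hb, h⟩, rfl⟩
    exact ⟨⟨b, hb, rfl⟩, by rw [← dot_cl] at h; exact h⟩

lemma Tl_meas (n : ℕ) (l : List ℕ) (R : ℝ) : MeasurableSet (Tl n l R) :=
  (tile_meas n l).inter ((dot_cont _).measurable measurableSet_Iio)

lemma Tl_cover (n k : ℕ) (R : ℝ) :
    (⋃ l : Idx k, Tl n l.1 R) =ᵐ[volume] Sr (one n) R := by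
  refine Filter.EventuallyLE.antisymm ?_ ?_
  · refine Filter.Eventually.of_forall ?_
    intro x hx
    obtain ⟨l, hl⟩ := Set.mem_iUnion.mp hx
    exact ⟨tile_sub n _ hl.1, hl.2⟩
  · rw [ae_le_set]
    refine measure_mono_null ?_ (tile_cover n k)
    rintro x ⟨hx, h⟩
    refine ⟨hx.1, fun h' => h ?_⟩
    obtain ⟨l, hl⟩ := Set.mem_iUnion.mp h'
    exact Set.mem_iUnion.mpr ⟨l, hl, hx.2⟩

lemma Tl_disj (n k : ℕ) (R : ℝ) : Pairwise (Function.onFun Disjoint fun l : Idx k => Tl n l.1 R) := by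
  intro l l' h
  exact (tile_disj n k h).mono Set.inter_subset_left Set.inter_subset_left

lemma lint_tile (n k : ℕ) (R : ℝ) (φ : V n → ENNReal) :
    ∫⁻ x in Sr (one n) R, φ x = ∑' l : Idx k, ∫⁻ x in Tl n l.1 R, φ x := by
  have h := lintegral_iUnion (μ := volume) (s := fun l : Idx k => Tl n l.1 R) (fun l => Tl_meas n l.1 R) (Tl_disj n k R) φ
  rw [← h]
  exact setLIntegral_congr (Tl_cover n k R).symm

lemma f_MW {n : ℕ} {f : V n → ℝ} (hf1 : ∀ b ∈ K n, f (m1 n b) = f b)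
    (hf0 : ∀ b ∈ K n, f (m0 n b) = f b) (w : List Bool) : ∀ b ∈ K n, f (MW n w b) = f b := by
  induction w with
  | nil => intro b _; rfl
  | cons a w ih =>
    intro b hb
    change f (mb n a (MW n w b)) = f b
    cases a
    · exact (hf0 _ (MW_K w hb)).trans (ih b hb)
    · exact (hf1 _ (MW_K w hb)).trans (ih b hb)

lemma smul_K {n : ℕ} {b : V n} (hb : b ∈ K n) {r : ℝ} (hr : 0 < r) : r • b ∈ K n :=
  fun i => mul_pos hr (hb i)

lemma tile_est {n : ℕ} {f : V n → ℝ} (hfm : AEMeasurable f volume)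
    (hf1 : ∀ b ∈ K n, f (m1 n b) = f b) (hf0 : ∀ b ∈ K n, f (m0 n b) = f b) (l : List ℕ)
    {g : ℝ → ℝ} (hg : Measurable g) {R lam : ℝ} (h1 : 1 ≤ lam) (h2 : lam ≤ lam0 n) :
    ∫⁻ x in Tl n l (R/3), edist (f x) (f (lam • x)) ≤
      6 * ENNReal.ofReal (dl n)⁻¹ * ∫⁻ x in Tl n l R, edist (f x) (g (one n ⬝ᵥ x)) := by
  rw [Tl_eq, Tl_eq, lint_img (MW_inj n _) (Sr_meas _ _), lint_img (MW_inj n _) (Sr_meas _ _)]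
  have hfw := f_MW hf1 hf0 (ex l)
  have e1 : ∫⁻ x in Sr (cl n l) (R/3), edist (f (MW n (ex l) x)) (f (lam • MW n (ex l) x)) =
      ∫⁻ x in Sr (cl n l) (R/3), edist (f x) (f (lam • x)) := by
    refine setLIntegral_congr_fun (Sr_meas _ _) ?_
    intro x hx
    simp only
    rw [← map_smul, hfw x hx.1, hfw _ (smul_K hx.1 (by linarith))]
  have e2 : ∫⁻ x in Sr (cl n l) R, edist (f (MW n (ex l) x)) (g (one n ⬝ᵥ MW n (ex l) x)) =
      ∫⁻ x in Sr (cl n l) R, edist (f x) (g (cl n l ⬝ᵥ x)) := by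
    refine setLIntegral_congr_fun (Sr_meas _ _) ?_
    intro x hx
    simp only
    rw [hfw x hx.1, dot_cl]
  rw [e1, e2]
  refine (mul_le_mul_right (local_est hfm hf1 (cl_Bal n l) hg (R := R) h1 h2) _).trans (le_of_eq ?_)
  ring

lemma one_dot_pos {n : ℕ} {b : V n} (hb : b ∈ K n) : 0 < one n ⬝ᵥ b :=
  dot_pos (fun i => by simp [one]) hb

lemma le_one_dot {n : ℕ} {b : V n} (hb : b ∈ K n) (i : Fin (n+2)) : b i ≤ one n ⬝ᵥ b := by
  have := Finset.single_le_sum (f := fun i => one n i * b i) (s := Finset.univ)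
    (fun j _ => by simpa [one] using (hb j).le) (Finset.mem_univ i)
  simpa [one, dotProduct] using this

lemma Sr_fin (n : ℕ) (R : ℝ) : volume (Sr (one n) R) < ⊤ := by
  refine lt_of_le_of_lt (measure_mono (t := Set.Icc (fun _ => 0) (fun _ => R)) ?_)
    isCompact_Icc.measure_lt_top
  rintro b ⟨hb, h⟩
  exact ⟨fun i => (hb i).le, fun i => (le_one_dot hb i).trans h.le⟩

lemma one_K (n : ℕ) : one n ∈ K n := fun _ => by simp [one]

lemma tile_smul {n : ℕ} {l : List ℕ} {x : V n} (hx : x ∈ tile n l) {r : ℝ} (hr : 0 < r) :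
    r • x ∈ tile n l := by
  obtain ⟨b, hb, rfl⟩ := hx
  exact ⟨r • b, smul_K hb hr, by rw [map_smul]⟩

lemma tile_pt (n : ℕ) (l : List ℕ) : ∃ p ∈ tile n l, one n ⬝ᵥ p = 1 := by
  have h : MW n (ex l) (one n) ∈ tile n l := ⟨_, one_K n, rfl⟩
  have hp := one_dot_pos (tile_sub n l h)
  refine ⟨_, tile_smul h (inv_pos.mpr hp), ?_⟩
  rw [dotProduct_smul, smul_eq_mul, inv_mul_cancel₀ hp.ne']

lemma stepI_bound {n : ℕ} {f : V n → ℝ} (hfm : AEMeasurable f volume) (hfb : ∀ x, |f x| ≤ 1)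
    (hf1 : ∀ b ∈ K n, f (m1 n b) = f b) (hf0 : ∀ b ∈ K n, f (m0 n b) = f b)
    {R lam : ℝ} (hR : 0 < R) (h1 : 1 ≤ lam) (h2 : lam ≤ lam0 n) {ε : ℝ} (hε : 0 < ε) :
    ∫⁻ x in Sr (one n) (R/3), edist (f x) (f (lam • x)) ≤
      6 * ENNReal.ofReal (dl n)⁻¹ * (ENNReal.ofReal ε + ENNReal.ofReal ε * volume (Sr (one n) R)) := by
  have hfInt : Integrable ((Sr (one n) R).indicator f) volume := by
    rw [integrable_indicator_iff (Sr_meas _ _)]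
    refine Measure.integrableOn_of_bounded (M := 1) (Sr_fin n R).ne hfm.aestronglyMeasurable ?_
    exact Filter.Eventually.of_forall hfb
  obtain ⟨F, hFc, hFi, hFcont, -⟩ := hfInt.exists_hasCompactSupport_lintegral_sub_le
    (ε := ENNReal.ofReal ε) (by simpa using hε)
  have hFu := hFc.uniformContinuous_of_continuous hFcont
  obtain ⟨ρ, hρ, hFρ⟩ := Metric.uniformContinuous_iff.mp hFu ε hε
  obtain ⟨k, hk⟩ := exists_pow_lt_of_lt_one (show 0 < ρ / R by positivity)
    (show 1 - del n < 1 by linarith [del_pos n])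
  have hk' : (1 - del n) ^ k * R < ρ := by rwa [lt_div_iff₀ hR] at hk
  have hdn : 0 ≤ (1 - del n) ^ k := pow_nonneg (by linarith [del_lt n]) _
  have htile : ∀ l : Idx (k * NN n), ∫⁻ x in Tl n l.1 (R/3), edist (f x) (f (lam • x)) ≤
      6 * ENNReal.ofReal (dl n)⁻¹ * ∫⁻ x in Tl n l.1 R, (edist (f x) (F x) + ENNReal.ofReal ε) := by
    intro l
    obtain ⟨p, hp, hp1⟩ := tile_pt n l.1
    have hg : Measurable (fun r : ℝ => F (r • p)) := by
      apply Continuous.measurable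
      exact hFcont.comp (by fun_prop)
    refine (tile_est hfm hf1 hf0 l.1 hg (R := R) h1 h2).trans ?_
    refine mul_le_mul_right ?_ _
    refine setLIntegral_mono_ae' (Tl_meas _ _ _) (Filter.Eventually.of_forall ?_)
    intro x hx
    refine (edist_triangle _ (F x) _).trans ?_
    gcongr
    rw [edist_dist]
    apply ENNReal.ofReal_le_ofReal
    apply le_of_lt
    apply hFρ
    rw [dist_pi_lt_iff hρ]
    intro i
    have hd := diam k l.1 l.2 hx.1 hp i
    have hx0 := one_dot_pos (tile_sub n _ hx.1)
    rw [hp1, mul_one, mul_one] at hd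
    rw [Real.dist_eq, Pi.smul_apply, smul_eq_mul, mul_comm (one n ⬝ᵥ x)]
    refine lt_of_le_of_lt hd (lt_of_le_of_lt ?_ hk')
    exact mul_le_mul_of_nonneg_left (le_of_lt hx.2) hdn
  calc ∫⁻ x in Sr (one n) (R/3), edist (f x) (f (lam • x))
      = ∑' l : Idx (k * NN n), ∫⁻ x in Tl n l.1 (R/3), edist (f x) (f (lam • x)) := lint_tile _ _ _ _
    _ ≤ ∑' l : Idx (k * NN n), 6 * ENNReal.ofReal (dl n)⁻¹ *
          ∫⁻ x in Tl n l.1 R, (edist (f x) (F x) + ENNReal.ofReal ε) := ENNReal.tsum_le_tsum htile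
    _ = 6 * ENNReal.ofReal (dl n)⁻¹ * ∫⁻ x in Sr (one n) R, (edist (f x) (F x) + ENNReal.ofReal ε) := by
        rw [ENNReal.tsum_mul_left, ← lint_tile]
    _ ≤ _ := by
        gcongr
        rw [lintegral_add_right _ measurable_const, setLIntegral_const]
        gcongr
        refine le_trans ?_ hFi
        refine le_trans (le_of_eq ?_) (setLIntegral_le_lintegral (Sr (one n) R) _)
        refine setLIntegral_congr_fun (Sr_meas _ _) ?_
        intro x hx
        simp only [Set.indicator_of_mem hx, edist_eq_enorm_sub]

lemma stepI {n : ℕ} {f : V n → ℝ} (hfm : AEMeasurable f volume) (hfb : ∀ x, |f x| ≤ 1)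
    (hf1 : ∀ b ∈ K n, f (m1 n b) = f b) (hf0 : ∀ b ∈ K n, f (m0 n b) = f b)
    {lam : ℝ} (h1 : 1 ≤ lam) (h2 : lam ≤ lam0 n) :
    ∀ᵐ x, x ∈ K n → f (lam • x) = f x := by
  have hR : ∀ N : ℕ, ∀ᵐ x, x ∈ Sr (one n) (N : ℝ) → f (lam • x) = f x := by
    intro N
    have hz : ∫⁻ x in Sr (one n) (N:ℝ), edist (f x) (f (lam • x)) = 0 := by
      set M := 6 * ENNReal.ofReal (dl n)⁻¹ * (1 + volume (Sr (one n) (3 * (N+1)))) with hM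
      have hMt : M ≠ ⊤ := by
        refine ENNReal.mul_ne_top (ENNReal.mul_ne_top (by simp) ENNReal.ofReal_ne_top) ?_
        exact ENNReal.add_ne_top.mpr ⟨by simp, (Sr_fin n _).ne⟩
      have hb : ∀ ε : ℝ, 0 < ε → ∫⁻ x in Sr (one n) (N:ℝ), edist (f x) (f (lam • x)) ≤ ENNReal.ofReal ε * M := by
        intro ε hε
        have := stepI_bound hfm hfb hf1 hf0 (R := 3 * (N+1)) (by positivity) h1 h2 hε
        refine le_trans (lintegral_mono_set ?_) (this.trans (le_of_eq ?_))
        · rintro x ⟨hx, hx'⟩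
          refine ⟨hx, ?_⟩
          rw [mul_div_cancel_left₀ _ (by norm_num : (3:ℝ) ≠ 0)]
          linarith
        · rw [hM]; ring
      by_contra hne
      have hpos := pos_iff_ne_zero.mpr hne
      have hMr : M ≤ ENNReal.ofReal (M.toReal + 1) := by
        rw [← ENNReal.ofReal_toReal hMt]
        apply ENNReal.ofReal_le_ofReal
        rw [ENNReal.toReal_ofReal ENNReal.toReal_nonneg]; linarith
      obtain ⟨r, hr0, hr⟩ := ENNReal.lt_iff_exists_real_btwn.mp hpos
      have hr' : 0 < r := by simpa using hr.1
      have := hb (r / (M.toReal + 1)) (div_pos hr' (by positivity))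
      have h3 : ENNReal.ofReal (r / (M.toReal + 1)) * M ≤ ENNReal.ofReal r := by
        calc _ ≤ ENNReal.ofReal (r / (M.toReal + 1)) * ENNReal.ofReal (M.toReal + 1) := by gcongr
          _ = _ := by
            rw [← ENNReal.ofReal_mul (by positivity), div_mul_cancel₀ _ (by positivity)]
      exact absurd (this.trans h3) (not_le.mpr hr.2)
    have hm : AEMeasurable (fun x => edist (f x) (f (lam • x))) (volume.restrict (Sr (one n) (N:ℝ))) := by
      refine AEMeasurable.restrict (AEMeasurable.edist hfm ?_)
      exact hfm.comp_quasiMeasurePreserving (Measure.quasiMeasurePreserving_smul volume (by linarith))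
    rw [lintegral_eq_zero_iff' hm] at hz
    have := (ae_restrict_iff' (Sr_meas _ _)).mp hz
    filter_upwards [this] with x hx hxs
    have := hx hxs
    simpa using (edist_eq_zero.mp this).symm
  filter_upwards [ae_all_iff.mpr hR] with x hx hxK
  obtain ⟨N, hN⟩ := exists_nat_gt (one n ⬝ᵥ x)
  exact hx N ⟨hxK, hN⟩

end Selmer

namespace Selmer

lemma hom_all {n : ℕ} {f : V n → ℝ}
    (h : ∀ lam : ℝ, 1 ≤ lam → lam ≤ lam0 n → ∀ᵐ x, x ∈ K n → f (lam • x) = f x)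
    {r : ℝ} (hr : 0 < r) : ∀ᵐ x, x ∈ K n → f (r • x) = f x := by
  have pull : ∀ (μ : ℝ), 0 < μ → ∀ {P : V n → Prop}, (∀ᵐ x, P x) → ∀ᵐ x : V n, P (μ • x) := by
    intro μ hμ P hP
    exact (Measure.quasiMeasurePreserving_smul (E := V n) volume hμ.ne').ae hP
  have hl0 : 1 < lam0 n := by
    unfold lam0
    have : (0:ℝ) < 1 / (4 * (n+1)) := by positivity
    linarith
  have big : ∀ k : ℕ, ∀ lam : ℝ, 1 ≤ lam → lam ≤ lam0 n ^ k → ∀ᵐ x, x ∈ K n → f (lam • x) = f x := by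
    intro k
    induction k with
    | zero =>
      intro lam h1 h2
      have : lam = 1 := le_antisymm (by simpa using h2) h1
      subst this
      simp
    | succ k ih =>
      intro lam h1 h2
      rcases le_total lam (lam0 n) with h3 | h3
      · exact h lam h1 h3
      · have h4 := ih (lam / lam0 n) (by rwa [one_le_div (by linarith)])
          (by rw [div_le_iff₀ (by linarith), ← pow_succ]; exact h2)
        have h5 := pull (lam / lam0 n) (div_pos (by linarith) (by linarith)) (h (lam0 n) hl0.le le_rfl)
        filter_upwards [h4, h5] with x h6 h7 hx
        have h8 := h7 (smul_K hx (div_pos (by linarith) (by linarith)))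
        rw [smul_smul, mul_div_cancel₀ _ (by linarith : lam0 n ≠ 0)] at h8
        rw [h8, h6 hx]
  have ge1 : ∀ lam : ℝ, 1 ≤ lam → ∀ᵐ x, x ∈ K n → f (lam • x) = f x := by
    intro lam h1
    obtain ⟨k, hk⟩ := pow_unbounded_of_one_lt lam hl0
    exact big k lam h1 hk.le
  rcases le_total 1 r with h1 | h1
  · exact ge1 r h1
  · have h2 := pull r hr (ge1 r⁻¹ ((one_le_inv₀ hr).mpr h1))
    filter_upwards [h2] with x h3 hx
    have h4 := h3 (smul_K hx hr)
    rw [smul_smul, inv_mul_cancel₀ hr.ne', one_smul] at h4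
    exact h4.symm

def Hom {n : ℕ} (φ : V n → ENNReal) : Prop := ∀ r : ℝ, 0 < r → ∀ᵐ x, x ∈ K n → φ (r • x) = φ x

lemma det_smul_id (n : ℕ) (r : ℝ) : LinearMap.det (r • (LinearMap.id : V n →ₗ[ℝ] V n)) = r ^ (n+2) := by
  rw [LinearMap.det_smul, LinearMap.det_id, mul_one]; simp

lemma scale {n : ℕ} {φ : V n → ENNReal} (hφ : Hom φ) {C : Set (V n)} (hC : MeasurableSet C)
    (hCK : C ⊆ K n) (hCs : ∀ x ∈ C, ∀ r : ℝ, 0 < r → r • x ∈ C) {r : ℝ} (hr : 0 ≤ r) :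
    ∫⁻ x in C ∩ {x | one n ⬝ᵥ x < r}, φ x =
      ENNReal.ofReal (r ^ (n+2)) * ∫⁻ x in C ∩ {x | one n ⬝ᵥ x < 1}, φ x := by
  rcases hr.eq_or_lt with h0 | h0
  · subst h0
    have : C ∩ {x | one n ⬝ᵥ x < 0} = ∅ := by
      ext x
      simp only [Set.mem_inter_iff, Set.mem_ofPred_eq, Set.mem_empty_iff_false, iff_false, not_and, not_lt]
      intro hx
      exact (one_dot_pos (hCK hx)).le
    rw [this]; simp
  · have hset : C ∩ {x | one n ⬝ᵥ x < r} =
        (r • (LinearMap.id : V n →ₗ[ℝ] V n)) '' (C ∩ {x | one n ⬝ᵥ x < 1}) := by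
      ext x
      constructor
      · rintro ⟨hx, hxr⟩
        refine ⟨r⁻¹ • x, ⟨hCs x hx _ (inv_pos.mpr h0), ?_⟩, ?_⟩
        · change one n ⬝ᵥ (r⁻¹ • x) < 1
          rw [dotProduct_smul, smul_eq_mul, inv_mul_lt_iff₀ h0, mul_one]; exact hxr
        · simp [smul_smul, h0.ne']
      · rintro ⟨y, ⟨hy, hy1⟩, rfl⟩
        refine ⟨hCs y hy r h0, ?_⟩
        change one n ⬝ᵥ (r • y) < r
        rw [dotProduct_smul, smul_eq_mul]
        have : one n ⬝ᵥ y < 1 := hy1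
        nlinarith
    have hm : MeasurableSet (C ∩ {x | one n ⬝ᵥ x < 1}) :=
      hC.inter ((dot_cont _).measurable measurableSet_Iio)
    rw [hset, lint_img (inj_of_det (by rw [det_smul_id]; positivity)) hm, det_smul_id,
      abs_of_pos (by positivity)]
    congr 1
    refine setLIntegral_congr_fun_ae hm ?_
    filter_upwards [hφ r h0] with x hx hxC
    exact hx (hCK hxC.1)

lemma cancel_lemma {A a v w δ : ENNReal} {p q : ℝ} (hq : 0 ≤ q) (hpq : q < p) (hA : A ≠ ⊤) (hv : v ≠ ⊤)
    (h1 : ENNReal.ofReal p * A = ENNReal.ofReal q * A + a)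
    (h2 : ENNReal.ofReal p * v = ENNReal.ofReal q * v + w) (h : a ≤ δ * w) : A ≤ δ * v := by
  have hp : ENNReal.ofReal p = ENNReal.ofReal q + ENNReal.ofReal (p - q) := by
    rw [← ENNReal.ofReal_add hq (by linarith)]; congr 1; ring
  rw [hp, add_mul] at h1 h2
  have h1' := (ENNReal.add_right_inj (ENNReal.mul_ne_top ENNReal.ofReal_ne_top hA)).mp h1
  have h2' := (ENNReal.add_right_inj (ENNReal.mul_ne_top ENNReal.ofReal_ne_top hv)).mp h2
  rw [← h1', ← h2'] at h
  have h3 : ENNReal.ofReal (p - q) * A ≤ ENNReal.ofReal (p - q) * (δ * v) := by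
    refine h.trans (le_of_eq (by ring))
  refine (ENNReal.mul_le_mul_iff_right ?_ ENNReal.ofReal_ne_top).mp h3
  simpa using hpq

lemma hom_one (n : ℕ) : Hom (fun _ : V n => (1:ENNReal)) := fun r _ => by simp

def cell (n : ℕ) (M : ℕ) (l : List ℕ) (j : ℕ) : Set (V n) :=
  tile n l ∩ {x | ⌊(M:ℝ) * (one n ⬝ᵥ x)⌋₊ = j}

lemma cell_meas (n M : ℕ) (l : List ℕ) (j : ℕ) : MeasurableSet (cell n M l j) := by
  refine (tile_meas n l).inter ?_
  have : Measurable (fun x : V n => ⌊(M:ℝ) * (one n ⬝ᵥ x)⌋₊) :=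
    Nat.measurable_floor.comp ((dot_cont (one n)).measurable.const_mul _)
  exact this (measurableSet_singleton j)

lemma cell_iff {n M : ℕ} (hM : 0 < M) (l : List ℕ) (j : ℕ) (x : V n) :
    x ∈ cell n M l j ↔ x ∈ tile n l ∧ (j:ℝ)/M ≤ one n ⬝ᵥ x ∧ one n ⬝ᵥ x < ((j:ℝ)+1)/M := by
  have hM' : (0:ℝ) < M := by exact_mod_cast hM
  unfold cell
  simp only [Set.mem_inter_iff, Set.mem_ofPred_eq]
  refine and_congr_right fun hx => ?_
  have := one_dot_pos (tile_sub n l hx)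
  rw [Nat.floor_eq_iff (by positivity), div_le_iff₀ hM', lt_div_iff₀ hM', mul_comm]

lemma cell_union {n M : ℕ} (hM : 0 < M) (l : List ℕ) (j : ℕ) (φ : V n → ENNReal) :
    ∫⁻ x in Tl n l (((j:ℝ)+1)/M), φ x = (∫⁻ x in Tl n l ((j:ℝ)/M), φ x) + ∫⁻ x in cell n M l j, φ x := by
  have hM' : (0:ℝ) < M := by exact_mod_cast hM
  have hu := lintegral_union (μ := volume) (f := φ) (A := Tl n l ((j:ℝ)/M)) (cell_meas n M l j) ?_
  · rw [← hu]
    congr 2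
    ext x
    simp only [Set.mem_union, cell_iff hM, Tl, Set.mem_inter_iff, Set.mem_ofPred_eq]
    have : (j:ℝ)/M < ((j:ℝ)+1)/M := by gcongr; linarith
    constructor
    · rintro ⟨h1, h2⟩
      rcases lt_or_ge (one n ⬝ᵥ x) ((j:ℝ)/M) with h | h
      · exact Or.inl ⟨h1, h⟩
      · exact Or.inr ⟨h1, h, h2⟩
    · rintro (⟨h1, h2⟩ | ⟨h1, h2, h3⟩)
      · exact ⟨h1, h2.trans this⟩
      · exact ⟨h1, h3⟩
  · refine Set.disjoint_left.mpr ?_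
    intro x hx hx'
    rw [cell_iff hM] at hx'
    exact absurd hx.2 (not_lt.mpr hx'.2.1)

lemma Tl_scale {n : ℕ} {φ : V n → ENNReal} (hφ : Hom φ) (l : List ℕ) {r : ℝ} (hr : 0 ≤ r) :
    ∫⁻ x in Tl n l r, φ x = ENNReal.ofReal (r ^ (n+2)) * ∫⁻ x in Tl n l 1, φ x :=
  scale hφ (tile_meas n l) (tile_sub n l) (fun _ hx _ hr => tile_smul hx hr) hr

lemma Sr_scale {n : ℕ} {φ : V n → ENNReal} (hφ : Hom φ) {r : ℝ} (hr : 0 ≤ r) :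
    ∫⁻ x in Sr (one n) r, φ x = ENNReal.ofReal (r ^ (n+2)) * ∫⁻ x in Sr (one n) 1, φ x :=
  scale hφ (K_meas n) le_rfl (fun _ hx _ hr => smul_K hx hr) hr

lemma Tl_fin (n : ℕ) (l : List ℕ) (R : ℝ) : volume (Tl n l R) < ⊤ :=
  lt_of_le_of_lt (measure_mono (t := Sr (one n) R) fun _ hx => ⟨tile_sub n l hx.1, hx.2⟩) (Sr_fin n R)

lemma cell_to_tile {n M : ℕ} (hM : 0 < M) (l : List ℕ) (j : ℕ) {φ : V n → ENNReal} (hφ : Hom φ)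
    {B : ENNReal} (hB : B ≠ ⊤) (hφB : ∀ x, φ x ≤ B) {δ : ENNReal}
    (h : ∫⁻ x in cell n M l j, φ x ≤ δ * volume (cell n M l j)) :
    ∫⁻ x in Tl n l 1, φ x ≤ δ * volume (Tl n l 1) := by
  have hM' : (0:ℝ) < M := by exact_mod_cast hM
  have e1 := cell_union hM l j φ
  have e2 := cell_union (n := n) hM l j (fun _ => 1)
  rw [Tl_scale hφ l (r := ((j:ℝ)+1)/M) (by positivity), Tl_scale hφ l (r := (j:ℝ)/M) (by positivity)] at e1
  rw [Tl_scale (hom_one n) l (r := ((j:ℝ)+1)/M) (by positivity), Tl_scale (hom_one n) l (r := (j:ℝ)/M) (by positivity)] at e2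
  simp only [setLIntegral_const, one_mul] at e2
  refine cancel_lemma (p := (((j:ℝ)+1)/M) ^ (n+2)) (q := ((j:ℝ)/M) ^ (n+2)) (by positivity) ?_ ?_
    (Tl_fin n l 1).ne e1 e2 h
  · gcongr; linarith
  · refine ne_of_lt (lt_of_le_of_lt (lintegral_mono hφB) ?_)
    rw [setLIntegral_const]
    exact ENNReal.mul_lt_top hB.lt_top (Tl_fin n l 1)

lemma tile_to_all {n : ℕ} (l : List ℕ) {φ : V n → ENNReal} (hφ : Hom φ)
    (hφW : ∀ b ∈ K n, φ (MW n (ex l) b) = φ b) {δ : ENNReal}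
    (h : ∫⁻ x in Tl n l 1, φ x ≤ δ * volume (Tl n l 1)) :
    ∫⁻ x in Sr (one n) 1, φ x ≤ δ * (2 ^ (n+2) * volume (Sr (one n) 1)) := by
  have hdet := abs_pos.mpr (det_ne_of_inj (MW_inj n (ex l)))
  have hc := cl_Bal n l
  have hc0 : 0 < cl n l 0 := hc.1.1
  rw [Tl_eq, lint_img (MW_inj n _) (Sr_meas _ _), Measure.addHaar_image_linearMap] at h
  have h1 : ∫⁻ x in Sr (cl n l) 1, φ x ≤ δ * volume (Sr (cl n l) 1) := by
    have e : ∫⁻ x in Sr (cl n l) 1, φ (MW n (ex l) x) = ∫⁻ x in Sr (cl n l) 1, φ x :=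
      setLIntegral_congr_fun (Sr_meas _ _) (fun x hx => hφW x hx.1)
    rw [e] at h
    refine (ENNReal.mul_le_mul_iff_right (a := ENNReal.ofReal |LinearMap.det (MW n (ex l))|) (by simpa using hdet) ENNReal.ofReal_ne_top).mp ?_
    refine h.trans (le_of_eq (by ring))
  have s1 : Sr (one n) (1 / (2 * cl n l 0)) ⊆ Sr (cl n l) 1 := by
    rintro x ⟨hx, hx1⟩
    refine ⟨hx, ?_⟩
    have := dot_mono (c := cl n l) (g := (2 * cl n l 0) • one n) hx (fun i => by
      simpa [one] using (hc.2 i).2)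
    rw [smul_dotProduct, smul_eq_mul] at this
    rw [lt_div_iff₀ (by positivity)] at hx1
    linarith
  have s2 : Sr (cl n l) 1 ⊆ Sr (one n) (1 / cl n l 0) := by
    rintro x ⟨hx, hx1⟩
    refine ⟨hx, ?_⟩
    have := dot_mono (g := cl n l) (c := (cl n l 0) • one n) hx (fun i => by
      simpa [one] using (hc.2 i).1)
    rw [smul_dotProduct, smul_eq_mul] at this
    rw [lt_div_iff₀ (by positivity)]
    linarith
  have h2 : ∫⁻ x in Sr (one n) (1 / (2 * cl n l 0)), φ x ≤ δ * ∫⁻ x in Sr (one n) (1 / cl n l 0), 1 := by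
    refine (lintegral_mono_set s1).trans (h1.trans ?_)
    rw [setLIntegral_const, one_mul]
    gcongr
  rw [Sr_scale hφ (by positivity), Sr_scale (hom_one n) (by positivity), setLIntegral_const, one_mul] at h2
  have hpos : (0:ℝ) < (1 / (2 * cl n l 0)) ^ (n+2) := by positivity
  refine (ENNReal.mul_le_mul_iff_right (a := ENNReal.ofReal ((1 / (2 * cl n l 0)) ^ (n+2))) (ENNReal.ofReal_pos.mpr hpos).ne' ENNReal.ofReal_ne_top).mp ?_
  refine h2.trans (le_of_eq ?_)
  have : (1 / cl n l 0) ^ (n+2) = (1 / (2 * cl n l 0)) ^ (n+2) * 2 ^ (n+2) := by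
    rw [← mul_pow]; congr 1; field_simp
  rw [this, ENNReal.ofReal_mul hpos.le, ENNReal.ofReal_pow (by norm_num : (0:ℝ) ≤ 2)]
  simp only [ENNReal.ofReal_ofNat]
  ring

lemma cell_cover (n k : ℕ) {M : ℕ} (hM : 0 < M) :
    (⋃ l : Idx k × Fin M, cell n M l.1.1 l.2) =ᵐ[volume] Sr (one n) 1 := by
  have hM' : (0:ℝ) < M := by exact_mod_cast hM
  refine Filter.EventuallyLE.antisymm ?_ ?_
  · refine Filter.Eventually.of_forall ?_
    intro x hx
    obtain ⟨l, hl⟩ := Set.mem_iUnion.mp hx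
    rw [cell_iff hM] at hl
    refine ⟨tile_sub n _ hl.1, hl.2.2.trans_le ?_⟩
    rw [div_le_one hM']
    have := l.2.2
    exact_mod_cast this
  · rw [ae_le_set]
    refine measure_mono_null ?_ (tile_cover n k)
    rintro x ⟨hx, h⟩
    refine ⟨hx.1, fun h' => h ?_⟩
    obtain ⟨l, hl⟩ := Set.mem_iUnion.mp h'
    have h0 := one_dot_pos hx.1
    refine Set.mem_iUnion.mpr ⟨⟨l, ⟨⌊(M:ℝ) * (one n ⬝ᵥ x)⌋₊, ?_⟩⟩, hl, rfl⟩
    rw [Nat.floor_lt (by positivity)]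
    have := hx.2
    nlinarith

lemma cell_disj (n k M : ℕ) :
    Pairwise (Function.onFun Disjoint fun l : Idx k × Fin M => cell n M l.1.1 l.2) := by
  intro l l' h
  refine Set.disjoint_left.mpr ?_
  rintro x ⟨hx1, hx2⟩ ⟨hy1, hy2⟩
  apply h
  have h1 : l.1 = l'.1 := by
    by_contra hne
    exact Set.disjoint_left.mp (tile_disj n k hne) hx1 hy1
  have h2 : (l.2 : ℕ) = l'.2 := hx2.symm.trans hy2
  exact Prod.ext h1 (Fin.ext h2)

lemma lint_cell (n k : ℕ) {M : ℕ} (hM : 0 < M) (φ : V n → ENNReal) :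
    ∫⁻ x in Sr (one n) 1, φ x = ∑' l : Idx k × Fin M, ∫⁻ x in cell n M l.1.1 l.2, φ x := by
  have h := lintegral_iUnion (μ := volume) (s := fun l : Idx k × Fin M => cell n M l.1.1 l.2)
    (fun l => cell_meas n M l.1.1 l.2) (cell_disj n k M) φ
  rw [← h]
  exact setLIntegral_congr (cell_cover n k hM).symm

lemma Sr_pos (n : ℕ) : 0 < volume (Sr (one n) 1) := by
  have ho : IsOpen (Sr (one n) 1) := (K_open n).inter (isOpen_Iio.preimage (dot_cont _))
  refine ho.measure_pos _ ⟨(1 / (2 * ((n:ℝ)+2))) • one n, smul_K (one_K n) (by positivity), ?_⟩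
  have : one n ⬝ᵥ one n = (n:ℝ) + 2 := by simp [one, dotProduct]
  rw [dotProduct_smul, this, smul_eq_mul]
  field_simp
  norm_num

lemma exists_const {n : ℕ} {f : V n → ℝ} (hfm : AEMeasurable f volume) (hfb : ∀ x, |f x| ≤ 1)
    (hf1 : ∀ b ∈ K n, f (m1 n b) = f b) (hf0 : ∀ b ∈ K n, f (m0 n b) = f b) {δ : ℝ} (hδ : 0 < δ) :
    ∃ γ : ℝ, ∫⁻ x in Sr (one n) 1, edist (f x) γ ≤ ENNReal.ofReal δ * (2 ^ (n+2) * volume (Sr (one n) 1)) := by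
  have hhom : ∀ γ : ℝ, Hom (fun x => edist (f x) γ) := by
    intro γ r hr
    filter_upwards [hom_all (fun lam h1 h2 => stepI hfm hfb hf1 hf0 h1 h2) hr] with x hx hxK
    rw [hx hxK]
  set v := volume (Sr (one n) 1) with hv
  have hvt : v ≠ ⊤ := (Sr_fin n 1).ne
  have hv0 : 0 < v := Sr_pos n
  have hvr : 0 < v.toReal := ENNReal.toReal_pos hv0.ne' hvt
  have hveq : v = ENNReal.ofReal v.toReal := (ENNReal.ofReal_toReal hvt).symm
  obtain ⟨ε, hε, hεδ⟩ : ∃ ε : ℝ, 0 < ε ∧ ε + ε * v.toReal < δ * v.toReal := by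
    refine ⟨δ * v.toReal / (2 * (1 + v.toReal)), by positivity, ?_⟩
    have h : δ * v.toReal / (2 * (1 + v.toReal)) + δ * v.toReal / (2 * (1 + v.toReal)) * v.toReal
      = δ * v.toReal / 2 := by field_simp
    rw [h]
    have := mul_pos hδ hvr
    linarith
  have hfInt : Integrable ((Sr (one n) 1).indicator f) volume := by
    rw [integrable_indicator_iff (Sr_meas _ _)]
    refine Measure.integrableOn_of_bounded (M := 1) (Sr_fin n 1).ne hfm.aestronglyMeasurable ?_
    exact Filter.Eventually.of_forall hfb
  obtain ⟨F, hFc, hFi, hFcont, -⟩ := hfInt.exists_hasCompactSupport_lintegral_sub_le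
    (ε := ENNReal.ofReal ε) (by simpa using hε)
  have hFu := hFc.uniformContinuous_of_continuous hFcont
  obtain ⟨ρ, hρ, hFρ⟩ := Metric.uniformContinuous_iff.mp hFu ε hε
  obtain ⟨k, hk⟩ := exists_pow_lt_of_lt_one (show 0 < ρ / 2 by positivity)
    (show 1 - del n < 1 by linarith [del_pos n])
  have hdn : 0 ≤ (1 - del n) ^ k := pow_nonneg (by linarith [del_lt n]) _
  obtain ⟨M', hM1⟩ := exists_nat_gt (2 / ρ)
  have hM'pos : (0:ℝ) < M' := lt_trans (by positivity) hM1
  have hM : 0 < M' := by exact_mod_cast hM'pos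
  have hMρ : 1 / (M':ℝ) < ρ / 2 := by
    rw [div_lt_iff₀ hρ] at hM1
    rw [div_lt_iff₀ hM'pos]; linarith
  by_contra hno
  push Not at hno
  have hcell : ∀ lj : Idx (k * NN n) × Fin M',
      ENNReal.ofReal δ * volume (cell n M' lj.1.1 lj.2) ≤
        ∫⁻ x in cell n M' lj.1.1 lj.2, (edist (f x) (F x) + ENNReal.ofReal ε) := by
    rintro ⟨l, j⟩
    obtain ⟨p, hp, hp1⟩ := tile_pt n l.1
    have hpK := tile_sub n _ hp
    set γ := F ((((j:ℕ):ℝ) / M') • p) with hγ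
    have hlt : ENNReal.ofReal δ * volume (cell n M' l.1 j) < ∫⁻ x in cell n M' l.1 j, edist (f x) γ := by
      by_contra hle
      push Not at hle
      have h1 := cell_to_tile hM l.1 j (hhom γ) (B := ENNReal.ofReal (1 + |γ|)) ENNReal.ofReal_ne_top
        (fun x => by
          rw [edist_dist, Real.dist_eq]
          apply ENNReal.ofReal_le_ofReal
          have h3 := abs_sub (f x) γ
          have h4 := hfb x
          linarith) hle
      have h2 := tile_to_all l.1 (hhom γ) (fun b hb => by
        simp only [f_MW hf1 hf0 (ex l.1) b hb]) h1
      exact absurd (hno γ) (not_lt.mpr h2)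
    refine hlt.le.trans (setLIntegral_mono_ae' (cell_meas _ _ _ _) (Filter.Eventually.of_forall ?_))
    intro x hx
    refine (edist_triangle _ (F x) _).trans ?_
    gcongr
    rw [edist_dist]
    apply ENNReal.ofReal_le_ofReal
    apply le_of_lt
    apply hFρ
    rw [dist_pi_lt_iff hρ]
    intro i
    rw [cell_iff hM] at hx
    obtain ⟨hxt, hx1, hx2⟩ := hx
    have hd := diam k l.1 l.2 hxt hp i
    have hx0 := one_dot_pos (tile_sub n _ hxt)
    have hxle : one n ⬝ᵥ x ≤ 1 := by
      refine hx2.le.trans ?_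
      rw [div_le_one hM'pos]
      have := j.2
      exact_mod_cast this
    rw [hp1, mul_one, mul_one] at hd
    have hpi0 := hpK i
    have hpi1 := le_one_dot hpK i
    rw [hp1] at hpi1
    have hdd : |x i - p i * (one n ⬝ᵥ x)| < ρ / 2 := by
      refine lt_of_le_of_lt hd (lt_of_le_of_lt ?_ hk)
      nlinarith
    have hx2' : one n ⬝ᵥ x - (j:ℕ) / M' < ρ / 2 := by
      have : (((j:ℕ):ℝ)+1)/M' = (j:ℕ)/M' + 1/M' := by ring
      linarith
    have hd3 : |p i * (one n ⬝ᵥ x) - ((j:ℕ):ℝ)/M' * p i| < ρ / 2 := by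
      rw [show p i * (one n ⬝ᵥ x) - ((j:ℕ):ℝ)/M' * p i = p i * (one n ⬝ᵥ x - (j:ℕ)/M') by ring,
        abs_of_nonneg (mul_nonneg hpi0.le (by linarith))]
      nlinarith
    rw [Real.dist_eq, Pi.smul_apply, smul_eq_mul]
    have := abs_sub_le (x i) (p i * (one n ⬝ᵥ x)) (((j:ℕ):ℝ)/M' * p i)
    linarith
  have htot : ENNReal.ofReal δ * v ≤ ENNReal.ofReal ε + ENNReal.ofReal ε * v := by
    calc ENNReal.ofReal δ * v = ENNReal.ofReal δ * ∑' l : Idx (k * NN n) × Fin M', volume (cell n M' l.1.1 l.2) := by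
          congr 1
          have := lint_cell n (k * NN n) hM (fun _ => 1)
          simpa only [setLIntegral_const, one_mul] using this
      _ = ∑' l : Idx (k * NN n) × Fin M', ENNReal.ofReal δ * volume (cell n M' l.1.1 l.2) := by
          rw [ENNReal.tsum_mul_left]
      _ ≤ ∑' l : Idx (k * NN n) × Fin M', ∫⁻ x in cell n M' l.1.1 l.2, (edist (f x) (F x) + ENNReal.ofReal ε) :=
          ENNReal.tsum_le_tsum hcell
      _ = ∫⁻ x in Sr (one n) 1, (edist (f x) (F x) + ENNReal.ofReal ε) := (lint_cell n _ hM _).symm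
      _ ≤ _ := by
        rw [lintegral_add_right _ measurable_const, setLIntegral_const]
        gcongr
        refine le_trans ?_ hFi
        refine le_trans (le_of_eq ?_) (setLIntegral_le_lintegral (Sr (one n) 1) _)
        refine setLIntegral_congr_fun (Sr_meas _ _) ?_
        intro x hx
        simp only [Set.indicator_of_mem hx, edist_eq_enorm_sub]
  rw [hveq, ← ENNReal.ofReal_mul hδ.le, ← ENNReal.ofReal_mul hε.le,
    ← ENNReal.ofReal_add hε.le (by positivity), ENNReal.ofReal_le_ofReal_iff (by positivity)] at htot
  linarith

end Selmer

namespace Selmer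

lemma null_of_int {n : ℕ} {f : V n → ℝ} (hfm : AEMeasurable f volume) {γ : ℝ}
    (hh : Hom (fun x => edist (f x) γ)) (h : ∫⁻ x in Sr (one n) 1, edist (f x) γ = 0) :
    ∀ᵐ x, x ∈ K n → f x = γ := by
  have hN : ∀ N : ℕ, ∀ᵐ x, x ∈ Sr (one n) (N:ℝ) → f x = γ := by
    intro N
    have h1 := Sr_scale hh (r := (N:ℝ)) (by positivity)
    rw [h, mul_zero, lintegral_eq_zero_iff' (AEMeasurable.restrict (hfm.edist aemeasurable_const))] at h1
    have := (ae_restrict_iff' (Sr_meas _ _)).mp h1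
    filter_upwards [this] with x hx hxs
    exact edist_eq_zero.mp (hx hxs)
  filter_upwards [ae_all_iff.mpr hN] with x hx hxK
  obtain ⟨N, hN⟩ := exists_nat_gt (one n ⬝ᵥ x)
  exact hx N ⟨hxK, hN⟩

lemma dich {n : ℕ} {f : V n → ℝ} (hfm : AEMeasurable f volume) (hf01 : ∀ x, f x = 0 ∨ f x = 1)
    (hf1 : ∀ b ∈ K n, f (m1 n b) = f b) (hf0 : ∀ b ∈ K n, f (m0 n b) = f b) :
    (∀ᵐ x, x ∈ K n → f x = 0) ∨ (∀ᵐ x, x ∈ K n → f x = 1) := by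
  have hfb : ∀ x, |f x| ≤ 1 := fun x => by rcases hf01 x with h | h <;> simp [h]
  have hhom : ∀ γ : ℝ, Hom (fun x => edist (f x) γ) := by
    intro γ r hr
    filter_upwards [hom_all (fun lam h1 h2 => stepI hfm hfb hf1 hf0 h1 h2) hr] with x hx hxK
    rw [hx hxK]
  set C := 2 ^ (n+2) * volume (Sr (one n) 1) with hC
  have hCt : C ≠ ⊤ := ENNReal.mul_ne_top (by simp) (Sr_fin n 1).ne
  have hδ : ∀ δ : ℝ, 0 < δ → min (∫⁻ x in Sr (one n) 1, edist (f x) 0) (∫⁻ x in Sr (one n) 1, edist (f x) 1)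
      ≤ 2 * (ENNReal.ofReal δ * C) := by
    intro δ hδ
    obtain ⟨γ, hγ⟩ := exists_const hfm hfb hf1 hf0 hδ
    rw [← hC] at hγ
    have e2 : (2:ENNReal) = ENNReal.ofReal 2 := by simp
    have hpt : ∀ γ' : ℝ, (∀ x, |f x - γ'| ≤ 2 * |f x - γ|) →
        ∫⁻ x in Sr (one n) 1, edist (f x) γ' ≤ 2 * (ENNReal.ofReal δ * C) := by
      intro γ' h
      calc ∫⁻ x in Sr (one n) 1, edist (f x) γ' ≤ ∫⁻ x in Sr (one n) 1, 2 * edist (f x) γ := by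
            refine lintegral_mono fun x => ?_
            rw [edist_dist, edist_dist, e2, ← ENNReal.ofReal_mul (by norm_num)]
            exact ENNReal.ofReal_le_ofReal (h x)
        _ = 2 * ∫⁻ x in Sr (one n) 1, edist (f x) γ := lintegral_const_mul' _ _ (by simp)
        _ ≤ _ := by gcongr
    rcases le_total γ (1/2) with h | h
    · refine (min_le_left _ _).trans (hpt 0 fun x => ?_)
      rcases hf01 x with hx | hx
      · simp [hx]
      · rw [hx, abs_of_nonneg (by linarith : 0 ≤ 1 - γ)]; norm_num; linarith
    · refine (min_le_right _ _).trans (hpt 1 fun x => ?_)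
      rcases hf01 x with hx | hx
      · rw [hx, zero_sub, zero_sub, abs_neg, abs_neg, abs_of_nonneg (by linarith : 0 ≤ γ)]; norm_num; linarith
      · simp [hx]
  have hmin : min (∫⁻ x in Sr (one n) 1, edist (f x) 0) (∫⁻ x in Sr (one n) 1, edist (f x) 1) = 0 := by
    by_contra hne
    have hpos := pos_iff_ne_zero.mpr hne
    have hCr : C ≤ ENNReal.ofReal (C.toReal + 1) := by
      rw [← ENNReal.ofReal_toReal hCt]
      apply ENNReal.ofReal_le_ofReal
      rw [ENNReal.toReal_ofReal ENNReal.toReal_nonneg]; linarith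
    obtain ⟨r, hr0, hr⟩ := ENNReal.lt_iff_exists_real_btwn.mp hpos
    have hr' : 0 < r := by simpa using hr.1
    have := hδ (r / (2 * (C.toReal + 1))) (div_pos hr' (by positivity))
    have h3 : 2 * (ENNReal.ofReal (r / (2 * (C.toReal + 1))) * C) ≤ ENNReal.ofReal r := by
      calc _ ≤ 2 * (ENNReal.ofReal (r / (2 * (C.toReal + 1))) * ENNReal.ofReal (C.toReal + 1)) := by gcongr
        _ = _ := by
          rw [show (2:ENNReal) = ENNReal.ofReal 2 by simp, ← ENNReal.ofReal_mul (by positivity),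
            ← ENNReal.ofReal_mul (by positivity)]
          congr 1
          field_simp
    exact absurd (this.trans h3) (not_le.mpr hr.2)
  rcases min_eq_bot.mp hmin with h | h
  · exact Or.inl (null_of_int hfm (hhom 0) h)
  · exact Or.inr (null_of_int hfm (hhom 1) h)

end Selmer

namespace Selmer

/-- Coordinate functional. -/
def pr {n : ℕ} (i : Fin (n + 2)) : V n →ₗ[ℝ] ℝ := LinearMap.proj i

lemma pr_apply {n : ℕ} (i : Fin (n + 2)) (x : V n) : pr i x = x i := rfl

/-- The extended sequence `x 0, …, x (n+1), x 0 + x 1`. -/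
noncomputable def hatL (n k : ℕ) : V n →ₗ[ℝ] ℝ :=
  if h : k < n + 2 then pr ⟨k, h⟩ else pr 0 + pr 1

lemma hatL_lt {n k : ℕ} (h : k < n + 2) (x : V n) : hatL n k x = x ⟨k, h⟩ := by
  simp [hatL, h, pr_apply]

lemma hatL_top {n : ℕ} (x : V n) : hatL n (n + 2) x = x 0 + x 1 := by
  simp [hatL, pr_apply]

noncomputable def Psi (n : ℕ) : V n →ₗ[ℝ] V n :=
  LinearMap.pi (fun i => if (i : ℕ) = 0 then pr 1 - pr 0
    else hatL n (n + 3 - i) - hatL n (n + 2 - i))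

lemma Psi_zero {n : ℕ} (x : V n) : Psi n x 0 = x 1 - x 0 := by simp [Psi, pr_apply]

lemma Psi_succ {n : ℕ} (x : V n) (j : Fin (n + 1)) :
    Psi n x j.succ = hatL n (n + 2 - j) x - hatL n (n + 1 - j) x := by
  have h1 : n + 3 - ((j : ℕ) + 1) = n + 2 - j := by omega
  have h2 : n + 2 - ((j : ℕ) + 1) = n + 1 - j := by omega
  simp [Psi, h1, h2]

lemma hat_diff {n : ℕ} (x : V n) (k : ℕ) (hk : 1 ≤ k) (hk' : k < n + 2) :
    hatL n (k + 1) x - hatL n k x = Psi n x (Fin.succ ⟨n + 1 - k, by omega⟩) := by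
  rw [Psi_succ]
  have h1 : n + 2 - (n + 1 - k) = k + 1 := by omega
  have h2 : n + 1 - (n + 1 - k) = k := by omega
  simp only [h1, h2]

lemma Psi_inj (n : ℕ) : Function.Injective (Psi n) := by
  rw [← LinearMap.ker_eq_bot, LinearMap.ker_eq_bot']
  intro x hx
  have h0 : x 1 = x 0 := by
    have := Psi_zero x; rw [hx] at this; simp at this; linarith
  have hk : ∀ k, k ≤ n + 1 → hatL n (k + 1) x = x 1 := by
    intro k
    induction k with
    | zero => intro _; rw [hatL_lt (by omega)]; rfl
    | succ k ih =>
      intro h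
      have := hat_diff x (k + 1) (by omega) (by omega)
      rw [hx, ih (by omega)] at this
      simp at this
      linarith
  have h1 := hk (n + 1) le_rfl
  rw [hatL_top] at h1
  have h2 : x 0 = 0 := by linarith
  funext i
  rcases i with ⟨i, hi⟩
  cases i with
  | zero => exact h2
  | succ i =>
    have := hk i (by omega)
    rw [hatL_lt hi] at this
    rw [this, h0, h2]; rfl

/-- Inverse branch of the Selmer map. -/
noncomputable def N0 {n : ℕ} (y : V n) : V n :=
  fun i => if i = Fin.last (n + 1) then y 0 + y 1 else y (i + 1)

lemma N0_apply {n : ℕ} (y : V n) (i : Fin (n + 2)) : N0 y i = hatL n (i + 1) y := by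
  unfold N0
  split_ifs with h
  · subst h; simp [hatL_top]
  · have h1 : (i : ℕ) + 1 < n + 2 := by
      have := i.2
      have h2 : (i : ℕ) ≠ n + 1 := fun h' => h (Fin.ext (by simpa using h'))
      omega
    rw [hatL_lt h1]
    congr 1
    ext
    rw [Fin.val_add_one_of_lt (by rw [Fin.lt_def]; simp; omega)]

lemma hat_N0 {n : ℕ} (y : V n) (k : ℕ) (hk : k < n + 2) : hatL n k (N0 y) = hatL n (k + 1) y := by
  rw [hatL_lt hk, N0_apply]

lemma hat_one {n : ℕ} (y : V n) : hatL n 1 y = y 1 := by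
  rw [hatL_lt (by omega)]; rfl

lemma N0_zero {n : ℕ} (y : V n) : N0 y 0 = y 1 := by
  rw [N0_apply]; simp [hat_one]

lemma N0_one {n : ℕ} (y : V n) : N0 y 1 = hatL n 2 y := by
  rw [N0_apply]; simp

lemma hat_sw {n : ℕ} (y : V n) (k : ℕ) (hk : 2 ≤ k) (hk' : k ≤ n + 2) :
    hatL n k (fun i => y (Equiv.swap 0 1 i)) = hatL n k y := by
  rcases Nat.lt_or_ge k (n + 2) with h | h
  · rw [hatL_lt h, hatL_lt h, Equiv.swap_apply_of_ne_of_ne]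
    · intro h'; have := congrArg Fin.val h'; simp at this; omega
    · intro h'; have := congrArg Fin.val h'; simp at this; omega
  · have : k = n + 2 := by omega
    subst this
    rw [hatL_top, hatL_top]; simp [add_comm]

lemma m1_succ_pos {n : ℕ} (b : V n) (j : ℕ) (hj : j + 1 < n + 1) :
    m1 n b (Fin.succ ⟨j + 1, hj⟩) = b (Fin.succ ⟨j, by omega⟩) := by
  rw [m1_succ]
  congr 2
  ext
  rw [Fin.val_sub_one_of_ne_zero (by intro h; have := congrArg Fin.val h; simp at this)]
  simp

lemma Psi_last {n : ℕ} (y : V n) : Psi n y (Fin.last (n + 1)) = hatL n 2 y - y 1 := by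
  rw [← hat_one y, hat_diff y 1 le_rfl (by omega)]
  congr 1

lemma Psi_one {n : ℕ} (y : V n) : Psi n y 1 = y 0 + y 1 - hatL n (n + 1) y := by
  have := Psi_succ y 0
  simp [hatL_top] at this
  exact this

lemma Psi_N0_one {n : ℕ} (y : V n) : Psi n (N0 y) 1 = hatL n 2 y - y 0 := by
  rw [Psi_one, hat_N0 _ _ (by omega), hatL_top, N0_zero, N0_one]; ring

lemma Psi_N0_pos {n : ℕ} (y : V n) (j : ℕ) (hj : j + 1 < n + 1) :
    Psi n (N0 y) (Fin.succ ⟨j + 1, hj⟩) = hatL n (n + 2 - j) y - hatL n (n + 1 - j) y := by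
  rw [Psi_succ, hat_N0 _ _ (by simp; omega), hat_N0 _ _ (by simp; omega)]
  have h1 : n + 2 - (j + 1) + 1 = n + 2 - j := by omega
  have h2 : n + 1 - (j + 1) + 1 = n + 1 - j := by omega
  simp only [h1, h2]

lemma Psi_N1 {n : ℕ} (y : V n) :
    Psi n (N0 (fun i => y (Equiv.swap 0 1 i))) = m1 n (Psi n y) := by
  funext i
  rcases Fin.eq_zero_or_eq_succ i with rfl | ⟨j, rfl⟩
  · rw [Psi_zero, N0_zero, N0_one, hat_sw y 2 le_rfl (by omega), m1_zero, Psi_zero, Psi_last]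
    simp
  · rcases j with ⟨j, hj⟩
    cases j with
    | zero =>
      have h1 : (Fin.succ ⟨0, hj⟩ : Fin (n + 2)) = 1 := rfl
      rw [h1, Psi_N0_one, hat_sw y 2 le_rfl (by omega), m1_one, Psi_last]
      simp
    | succ j =>
      rw [Psi_N0_pos, m1_succ_pos, Psi_succ, hat_sw y _ (by omega) (by omega),
        hat_sw y _ (by omega) (by omega)]

lemma Psi_N0 {n : ℕ} (y : V n) : Psi n (N0 y) = m0 n (Psi n y) := by
  funext i
  rw [m0_apply]
  rcases Fin.eq_zero_or_eq_succ i with rfl | ⟨j, rfl⟩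
  · rw [Equiv.swap_apply_left, Psi_zero, N0_zero, N0_one, m1_one, Psi_last]
  · rcases j with ⟨j, hj⟩
    cases j with
    | zero =>
      have h1 : (Fin.succ ⟨0, hj⟩ : Fin (n + 2)) = 1 := rfl
      rw [h1, Equiv.swap_apply_right, Psi_N0_one, m1_zero, Psi_zero, Psi_last]
      ring
    | succ j =>
      rw [Equiv.swap_apply_of_ne_of_ne, Psi_N0_pos, m1_succ_pos, Psi_succ]
      · intro h'; have := congrArg Fin.val h'; simp at this
      · intro h'; have := congrArg Fin.val h'; simp at this

/-- the tuple before sorting -/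
noncomputable def tup {n : ℕ} (x : V n) : V n :=
  fun i => if i = Fin.last (n + 1) then x (Fin.last (n + 1)) - x 0 else x i

lemma selmer_eq {n : ℕ} (x : V n) : selmerAlg n x = tup x ∘ Tuple.sort (tup x) := rfl

lemma tup_N0 {n : ℕ} (y : V n) : tup (N0 y) = y ∘ finRotate (n + 2) := by
  funext i
  simp only [tup, Function.comp, finRotate_apply]
  split_ifs with h
  · subst h
    rw [N0_zero]; simp [N0]
  · simp [N0, h]

lemma selmer_N0 {n : ℕ} (x : V n) (hx : Monotone x) (τ : Equiv.Perm (Fin (n + 2))) :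
    selmerAlg n (N0 (fun i => x (τ i))) = x := by
  rw [selmer_eq, tup_N0]
  have : (fun i => x (τ i)) ∘ finRotate (n + 2) = x ∘ ((finRotate (n + 2)).trans τ) := by
    funext i; simp
  rw [this, Tuple.comp_perm_comp_sort_eq_comp_sort, Tuple.sort_eq_refl_iff_monotone.mpr hx]
  simp

lemma hat_mono_K {n : ℕ} (x : V n) (hx : Psi n x ∈ K n) (i j : ℕ) (hi : 1 ≤ i) (hij : i ≤ j)
    (hj : j ≤ n + 2) : hatL n i x ≤ hatL n j x := by
  induction j, hij using Nat.le_induction with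
  | base => exact le_rfl
  | succ j hij ih =>
    have h1 := ih (by omega)
    have h2 := hat_diff x j (by omega) (by omega)
    have h3 := hx (Fin.succ ⟨n + 1 - j, by omega⟩)
    linarith

lemma K_pos {n : ℕ} (x : V n) (hx : Psi n x ∈ K n) : 0 < x 0 := by
  have h1 := hat_mono_K x hx 1 (n + 1) le_rfl (by omega) (by omega)
  have h2 := hx 1
  rw [Psi_one] at h2
  rw [hat_one] at h1
  linarith

lemma K_mono {n : ℕ} (x : V n) (hx : Psi n x ∈ K n) : Monotone x := by
  have h0 := hx 0
  rw [Psi_zero] at h0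
  have key : ∀ i : Fin (n + 2), 1 ≤ (i : ℕ) → x 1 ≤ x i := by
    intro i hi
    have := hat_mono_K x hx 1 i le_rfl hi (by omega)
    rwa [hat_one, hatL_lt i.2] at this
  intro i j hij
  have hij' : (i : ℕ) ≤ j := hij
  rcases Nat.eq_zero_or_pos (i : ℕ) with hi | hi
  · have hi' : i = 0 := Fin.ext hi
    subst hi'
    rcases Nat.eq_zero_or_pos (j : ℕ) with hj | hj
    · have hj' : j = 0 := Fin.ext hj
      rw [hj']
    · have := key j hj
      linarith
  · have := hat_mono_K x hx i j hi hij' (by omega)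
    rwa [hatL_lt i.2, hatL_lt j.2] at this

lemma N0_mem {n : ℕ} (x : V n) (hx : Psi n x ∈ K n) : N0 x ∈ SigmaCone n := by
  have h0 := hx 0
  rw [Psi_zero] at h0
  refine ⟨?_, ?_⟩
  · rw [N0_zero]; have := K_pos x hx; linarith
  · intro i j hij
    rw [N0_apply, N0_apply]
    exact hat_mono_K x hx _ _ (by omega) (by simpa using hij) (by omega)

lemma N1_mem {n : ℕ} (x : V n) (hx : Psi n x ∈ K n) :
    N0 (fun i => x (Equiv.swap 0 1 i)) ∈ SigmaCone n := by
  have h0 := hx 0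
  rw [Psi_zero] at h0
  have hp := K_pos x hx
  refine ⟨?_, ?_⟩
  · rw [N0_zero]; simp; linarith
  · intro i j hij
    have hij' : (i : ℕ) ≤ j := hij
    rcases Nat.eq_zero_or_pos (j : ℕ) with hj | hj
    · have : i = j := Fin.ext (by omega)
      rw [this]
    · rw [N0_apply _ j, hat_sw x _ (by omega) (by omega)]
      rcases Nat.eq_zero_or_pos (i : ℕ) with hi | hi
      · have hi' : i = 0 := Fin.ext hi
        subst hi'
        rw [N0_zero, Equiv.swap_apply_right]
        have := hat_mono_K x hx 1 (j + 1) le_rfl (by omega) (by omega)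
        rw [hat_one] at this
        linarith
      · rw [N0_apply _ i, hat_sw x _ (by omega) (by omega)]
        exact hat_mono_K x hx _ _ (by omega) (by omega) (by omega)

end Selmer

namespace Selmer

noncomputable def tupL (n : ℕ) : V n →ₗ[ℝ] V n :=
  LinearMap.pi (fun i => if i = Fin.last (n + 1) then pr (Fin.last (n + 1)) - pr 0 else pr i)

lemma tupL_apply {n : ℕ} (x : V n) : tupL n x = tup x := by
  funext i
  simp only [tupL, tup, LinearMap.pi_apply]
  split_ifs <;> simp [pr_apply]

lemma zero_ne_last (n : ℕ) : (0 : Fin (n + 2)) ≠ Fin.last (n + 1) := by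
  intro h; have := congrArg Fin.val h; simp at this

lemma tupL_inj (n : ℕ) : Function.Injective (tupL n) := by
  rw [← LinearMap.ker_eq_bot, LinearMap.ker_eq_bot']
  intro x hx
  rw [tupL_apply] at hx
  have h : ∀ i, tup x i = 0 := fun i => by rw [hx]; rfl
  have h0 : x 0 = 0 := by
    have := h 0
    simpa [tup, zero_ne_last] using this
  funext i
  have hi := h i
  simp only [tup] at hi
  split_ifs at hi with h'
  · subst h'; simp; linarith
  · exact hi

lemma selmer_preim_null {n : ℕ} {s : Set (V n)} (hs : volume s = 0) :
    volume (selmerAlg n ⁻¹' s) = 0 := by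
  have hsub : selmerAlg n ⁻¹' s ⊆ ⋃ σ : Equiv.Perm (Fin (n + 2)),
      ((LinearMap.funLeft ℝ ℝ σ : V n →ₗ[ℝ] V n) ∘ₗ tupL n) ⁻¹' s := by
    intro x hx
    refine Set.mem_iUnion.mpr ⟨Tuple.sort (tup x), ?_⟩
    have : ((LinearMap.funLeft ℝ ℝ (Tuple.sort (tup x)) : V n →ₗ[ℝ] V n) ∘ₗ tupL n) x
        = selmerAlg n x := by
      rw [selmer_eq, LinearMap.comp_apply, tupL_apply]; rfl
    rw [Set.mem_preimage, this]
    exact hx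
  refine measure_mono_null hsub (measure_iUnion_null fun σ => ?_)
  have hdet := det_ne_of_inj (L := (LinearMap.funLeft ℝ ℝ σ : V n →ₗ[ℝ] V n) ∘ₗ tupL n) (by
    rw [LinearMap.coe_comp]
    exact (LinearMap.funLeft_injective_of_surjective ℝ ℝ σ σ.surjective).comp (tupL_inj n))
  exact (Measure.LinearMap.quasiMeasurePreserving volume _ hdet).preimage_null hs

lemma cone_nonneg {n : ℕ} {x : V n} (hx : x ∈ SigmaCone n) (i : Fin (n + 2)) : x 0 ≤ x i :=
  hx.2 (Fin.zero_le i)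

lemma selmer_maps {n : ℕ} {x : V n} (hx : x ∈ SigmaCone n) : selmerAlg n x ∈ SigmaCone n := by
  refine ⟨?_, Tuple.monotone_sort (tup x)⟩
  have : ∀ i, 0 ≤ tup x i := by
    intro i
    simp only [tup]
    split_ifs
    · have := cone_nonneg hx (Fin.last (n + 1)); linarith
    · exact hx.1.trans (cone_nonneg hx i)
  exact this _

lemma selmer_sum {n : ℕ} (x : V n) : ∑ i, selmerAlg n x i = ∑ i, x i - x 0 := by
  have h1 : ∑ i, selmerAlg n x i = ∑ i, tup x i := by
    rw [selmer_eq]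
    exact Equiv.sum_comp (Tuple.sort (tup x)) (tup x)
  have h2 : ∀ i, tup x i = x i - if i = Fin.last (n + 1) then x 0 else 0 := by
    intro i
    simp only [tup]
    split_ifs with h
    · rw [h]
    · simp
  rw [h1, Finset.sum_congr rfl (fun i _ => h2 i), Finset.sum_sub_distrib]
  simp

lemma selmer_zero {n : ℕ} {x : V n} (hx : x ∈ SigmaCone n)
    (hD : x 0 + x 1 < x (Fin.last (n + 1))) : selmerAlg n x 0 = x 0 := by
  have h1 := cone_nonneg hx 1
  have hge : ∀ i, x 0 ≤ tup x i := by
    intro i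
    simp only [tup]
    split_ifs
    · linarith
    · exact cone_nonneg hx i
  apply le_antisymm
  · have hm : Monotone (selmerAlg n x) := Tuple.monotone_sort (tup x)
    have h2 := hm (Fin.zero_le ((Tuple.sort (tup x)).symm 0))
    have h3 : selmerAlg n x ((Tuple.sort (tup x)).symm 0) = x 0 := by
      rw [selmer_eq]
      simp [tup, zero_ne_last]
    rwa [h3] at h2
  · exact hge _

/-- The fundamental domain. -/
def DomD (n : ℕ) : Set (V n) := {x | x (Fin.last (n + 1)) ≤ x 0 + x 1}

lemma G_null {n : ℕ} {G : Set (V n)} (hG : G ⊆ SigmaCone n)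
    (hS : ∀ x ∈ G, selmerAlg n x ∈ G) (hD : volume (G ∩ DomD n) = 0) : volume G = 0 := by
  have hk : ∀ k : ℕ, volume {x ∈ G | 0 < x 0 ∧ ∑ i, x i < k * x 0} = 0 := by
    intro k
    induction k with
    | zero =>
      refine measure_mono_null (t := ∅) ?_ (by simp)
      rintro x ⟨hx, h0, hs⟩
      have : 0 ≤ ∑ i, x i := Finset.sum_nonneg fun i _ => h0.le.trans (cone_nonneg (hG hx) i)
      simp at hs
      linarith
    | succ k ih =>
      refine measure_mono_null (t := (G ∩ DomD n) ∪ selmerAlg n ⁻¹' _) ?_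
        (measure_union_null hD (selmer_preim_null ih))
      rintro x ⟨hx, h0, hs⟩
      by_cases hxD : x ∈ DomD n
      · exact Or.inl ⟨hx, hxD⟩
      · right
        have hxD' : x 0 + x 1 < x (Fin.last (n + 1)) := not_le.mp hxD
        refine ⟨hS x hx, ?_, ?_⟩
        · rw [selmer_zero (hG hx) hxD']; exact h0
        · rw [selmer_zero (hG hx) hxD', selmer_sum]
          push_cast at hs
          linarith
  have hz : volume {x : V n | pr (n := n) 0 x = 0} = 0 := hyper_null _ (by
    intro h
    have := LinearMap.congr_fun h (Pi.single 0 1)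
    simp [pr_apply] at this)
  refine measure_mono_null (t := {x : V n | pr (n := n) 0 x = 0} ∪ ⋃ k : ℕ, _) ?_
    (measure_union_null hz (measure_iUnion_null hk))
  intro x hx
  rcases (hG hx).1.eq_or_lt with h | h
  · exact Or.inl h.symm
  · right
    obtain ⟨k, hk⟩ := exists_nat_gt ((∑ i, x i) / x 0)
    rw [div_lt_iff₀ h] at hk
    exact Set.mem_iUnion.mpr ⟨k, hx, h, hk⟩

lemma D_diff_null (n : ℕ) : volume {x : V n | x ∈ SigmaCone n ∧ x ∈ DomD n ∧ Psi n x ∉ K n} = 0 := by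
  have hi : ∀ i : Fin (n + 2), volume {x : V n | (pr i ∘ₗ Psi n) x = 0} = 0 := by
    intro i
    apply hyper_null
    intro h
    obtain ⟨x, hx⟩ := LinearMap.surjective_of_injective (Psi_inj n) (Pi.single i 1)
    have := LinearMap.congr_fun h x
    simp [hx, pr_apply] at this
  refine measure_mono_null ?_ (measure_iUnion_null hi)
  rintro x ⟨hx, hD, hK⟩
  have hnn : ∀ i, 0 ≤ Psi n x i := by
    intro i
    rcases Fin.eq_zero_or_eq_succ i with rfl | ⟨j, rfl⟩
    · rw [Psi_zero]; linarith [cone_nonneg hx 1]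
    · rw [Psi_succ]
      rw [hatL_lt (k := n + 1 - j) (by omega)]
      rcases Nat.eq_zero_or_pos (j : ℕ) with h | h
      · simp only [h, Nat.sub_zero]
        rw [hatL_top]
        have : x (Fin.last (n + 1)) ≤ x 0 + x 1 := hD
        have e : (⟨n + 1, by omega⟩ : Fin (n + 2)) = Fin.last (n + 1) := rfl
        rw [e]
        linarith
      · rw [hatL_lt (k := n + 2 - j) (by omega)]
        exact sub_nonneg.mpr (hx.2 (by rw [Fin.le_def]; simp; omega))
  have : ∃ i, ¬ 0 < Psi n x i := by
    by_contra hcon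
    push Not at hcon
    exact hK hcon
  obtain ⟨i, hi⟩ := this
  exact Set.mem_iUnion.mpr ⟨i, le_antisymm (not_lt.mp hi) (hnn i)⟩

lemma main {n : ℕ} (A : Set (V n))
    (hA : NullMeasurableSet A volume) (hsub : A ⊆ SigmaCone n)
    (hinv : {x ∈ SigmaCone n | selmerAlg n x ∈ A} = A) :
    volume A = 0 ∨ volume (SigmaCone n \ A) = 0 := by
  classical
  have hinv' : ∀ x ∈ SigmaCone n, (selmerAlg n x ∈ A ↔ x ∈ A) := by
    intro x hx
    constructor
    · intro h; rw [← hinv]; exact ⟨hx, h⟩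
    · intro h; rw [← hinv] at h; exact h.2
  let e : V n ≃ₗ[ℝ] V n := LinearEquiv.ofInjectiveEndo (Psi n) (Psi_inj n)
  have he : ∀ x, e x = Psi n x := fun x => rfl
  have heK : ∀ b, Psi n (e.symm b) = b := fun b => by rw [← he, LinearEquiv.apply_symm_apply]
  have hes : ∀ x, e.symm (Psi n x) = x := fun x => by rw [← he, LinearEquiv.symm_apply_apply]
  have hq : Measure.QuasiMeasurePreserving (e.symm : V n → V n) volume volume :=
    Measure.LinearMap.quasiMeasurePreserving volume (e.symm : V n →ₗ[ℝ] V n)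
      (det_ne_of_inj e.symm.injective)
  have hqP : Measure.QuasiMeasurePreserving (Psi n : V n → V n) volume volume :=
    Measure.LinearMap.quasiMeasurePreserving volume (Psi n) (det_ne_of_inj (Psi_inj n))
  let f : V n → ℝ := ((e.symm : V n → V n) ⁻¹' A).indicator (fun _ => 1)
  have hfm : AEMeasurable f volume := aemeasurable_const.indicator₀ (hA.preimage hq)
  have hf1' : ∀ b, e.symm b ∈ A → f b = 1 := fun b hb => Set.indicator_of_mem (by exact hb) _
  have hf0' : ∀ b, e.symm b ∉ A → f b = 0 := fun b hb => Set.indicator_of_notMem (by exact hb) _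
  have hcongr : ∀ b b', (e.symm b ∈ A ↔ e.symm b' ∈ A) → f b = f b' := by
    intro b b' h
    by_cases hb : e.symm b ∈ A
    · rw [hf1' _ hb, hf1' _ (h.mp hb)]
    · rw [hf0' _ hb, hf0' _ (fun h' => hb (h.mpr h'))]
  have hd := dich (n := n) (f := f) hfm (by
      intro b
      by_cases hb : e.symm b ∈ A
      · exact Or.inr (hf1' _ hb)
      · exact Or.inl (hf0' _ hb))
    (by
      intro b hb
      apply hcongr
      have hx : Psi n (e.symm b) ∈ K n := by rw [heK]; exact hb
      have h1 : e.symm (m1 n b) = N0 (fun i => e.symm b (Equiv.swap 0 1 i)) := by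
        have := Psi_N1 (e.symm b)
        rw [heK] at this
        rw [← this, hes]
      rw [h1, ← hinv' _ (N1_mem _ hx), selmer_N0 _ (K_mono _ hx)])
    (by
      intro b hb
      apply hcongr
      have hx : Psi n (e.symm b) ∈ K n := by rw [heK]; exact hb
      have h1 : e.symm (m0 n b) = N0 (e.symm b) := by
        have := Psi_N0 (e.symm b)
        rw [heK] at this
        rw [← this, hes]
      have h2 := selmer_N0 _ (K_mono _ hx) 1
      rw [h1, ← hinv' _ (N0_mem _ hx)]
      simp only [Equiv.Perm.one_apply] at h2
      rw [h2])
  rcases hd with h | h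
  · left
    refine G_null hsub (fun x hx => (hinv' x (hsub hx)).mpr hx) ?_
    have h2 := hqP.ae h
    rw [ae_iff] at h2
    refine measure_mono_null ?_ (measure_union_null h2 (D_diff_null n))
    rintro x ⟨hx, hxD⟩
    by_cases hxK : Psi n x ∈ K n
    · left
      intro hc
      have h3 := hc hxK
      rw [hf1' _ (by rw [hes]; exact hx)] at h3
      norm_num at h3
    · exact Or.inr ⟨hsub hx, hxD, hxK⟩
  · right
    refine G_null Set.sdiff_subset
      (fun x hx => ⟨selmer_maps hx.1, fun h' => hx.2 ((hinv' x hx.1).mp h')⟩) ?_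
    have h2 := hqP.ae h
    rw [ae_iff] at h2
    refine measure_mono_null ?_ (measure_union_null h2 (D_diff_null n))
    rintro x ⟨hx, hxD⟩
    by_cases hxK : Psi n x ∈ K n
    · left
      intro hc
      have h3 := hc hxK
      rw [hf0' _ (by rw [hes]; exact hx.2)] at h3
      norm_num at h3
    · exact Or.inr ⟨hx.1, hxD, hxK⟩

end Selmer

/-- For every `d ≥ 2`, the Selmer algorithm `S : Σ_d → Σ_d` is ergodic with respect to
`d`-dimensional Lebesgue measure restricted to `Σ_d`. -/
theorem selmerAlg_ergodic (n : ℕ) (A : Set (Fin (n + 2) → ℝ))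
    (hA : NullMeasurableSet A volume) (hsub : A ⊆ SigmaCone n)
    (hinv : {x ∈ SigmaCone n | selmerAlg n x ∈ A} = A) :
    volume A = 0 ∨ volume (SigmaCone n \ A) = 0 := by
  exact Selmer.main A hA hsub hinv
end

section
/- The homogeneous Euclidean algorithm 𝓘 : ℝ₊² → ℝ₊² is ergodic with respect to 2-dimensional Lebesgue measure: every Lebesgue-measurable set A ⊆ ℝ₊² with {y ∈ ℝ₊² : 𝓘(y) ∈ A} = A satisfies λ(A) = 0 or λ(ℝ₊² ∖ A) = 0. -/
open MeasureTheory

/-- The positive cone `ℝ₊² = {(x₁,x₂) : x₁ ≥ 0, x₂ ≥ 0}`. -/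
def posQuad : Set (ℝ × ℝ) := {p | 0 ≤ p.1 ∧ 0 ≤ p.2}

/-- The homogeneous Euclidean algorithm:
`𝓘(x₁,x₂) = (x₁−x₂, x₂)` if `x₁ ≥ x₂`, and `(x₁, x₂−x₁)` otherwise. -/
noncomputable def euclidAlg (p : ℝ × ℝ) : ℝ × ℝ :=
  if p.2 ≤ p.1 then (p.1 - p.2, p.2) else (p.1, p.2 - p.1)


section helpers
open Set Filter Topology

/-- Invariance under the monoid `SL₂(ℕ)`. -/
lemma ea_monoid (f : ℝ × ℝ → ℝ) (h1 : ∀ x y : ℝ, 0 < x → 0 < y → f (x + y, y) = f (x, y))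
    (h2 : ∀ x y : ℝ, 0 < x → 0 < y → f (x, x + y) = f (x, y)) :
    ∀ (n a b c d : ℕ), a + b + c + d ≤ n → a * d = b * c + 1 → ∀ x y : ℝ, 0 < x → 0 < y →
      f (a * x + b * y, c * x + d * y) = f (x, y) := by
  intro n
  induction n with
  | zero =>
    intro a b c d hn hd
    have : a = 0 := by omega
    subst this
    omega
  | succ n ih =>
    intro a b c d hn hd x y hx hy
    have ha : 0 < a := by
      rcases Nat.eq_zero_or_pos a with h | h
      · subst h; omega
      · exact h
    have hd0 : 0 < d := by
      rcases Nat.eq_zero_or_pos d with h | h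
      · subst h; omega
      · exact h
    by_cases hA : c ≤ a ∧ d ≤ b
    · obtain ⟨u, rfl⟩ := Nat.exists_eq_add_of_le hA.1
      obtain ⟨v, rfl⟩ := Nat.exists_eq_add_of_le hA.2
      have hdet : u * d = v * c + 1 := by nlinarith
      have hu : 0 < u := by
        rcases Nat.eq_zero_or_pos u with h | h
        · subst h; omega
        · exact h
      rw [← ih u v c d (by omega) hdet x y hx hy, ← h1 (u * x + v * y)]
      · congr 1
        push_cast
        ext <;> simp <;> ring
      · have : (0 : ℝ) < u := by exact_mod_cast hu
        positivity
      · have : (0 : ℝ) < d := by exact_mod_cast hd0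
        positivity
    by_cases hB : a ≤ c ∧ b ≤ d
    · obtain ⟨u, rfl⟩ := Nat.exists_eq_add_of_le hB.1
      obtain ⟨v, rfl⟩ := Nat.exists_eq_add_of_le hB.2
      have hdet : a * v = b * u + 1 := by nlinarith
      have hv : 0 < v := by
        rcases Nat.eq_zero_or_pos v with h | h
        · subst h; omega
        · exact h
      rw [← ih a b u v (by omega) hdet x y hx hy, ← h2 _ (u * x + v * y)]
      · congr 1
        push_cast
        ext <;> simp <;> ring
      · have : (0 : ℝ) < a := by exact_mod_cast ha
        positivity
      · have : (0 : ℝ) < v := by exact_mod_cast hv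
        positivity
    rcases le_or_gt c a with hca | hca
    · have hbd : b < d := by
        by_contra h; exact hA ⟨hca, by omega⟩
      have hca' : c < a := by
        by_contra h; exact hB ⟨by omega, hbd.le⟩
      have : (c + 1) * (b + 1) ≤ a * d := Nat.mul_le_mul hca' hbd
      have hb : b = 0 := by nlinarith
      have hc : c = 0 := by nlinarith
      subst hb hc
      have h1' : a = 1 ∧ d = 1 := by
        have : a * d = 1 := by omega
        exact ⟨Nat.eq_one_of_mul_eq_one_right this, Nat.eq_one_of_mul_eq_one_left this⟩
      simp [h1'.1, h1'.2]
    · have hdb : d < b := by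
        by_contra h; exact hB ⟨hca.le, by omega⟩
      have : a * d ≤ c * b := Nat.mul_le_mul hca.le hdb.le
      have : c * b = b * c := mul_comm _ _
      omega

/-- Bounded measurable functions are interval integrable. -/
lemma ea_ii (g : ℝ → ℝ) (hg : Measurable g) (C : ℝ) (hC : ∀ w, |g w| ≤ C) (a b : ℝ) :
    IntervalIntegrable g volume a b := by
  rw [intervalIntegrable_iff]
  refine MeasureTheory.Measure.integrableOn_of_bounded (M := C) ?_ hg.aestronglyMeasurable ?_
  · simp [uIoc]
  · exact Eventually.of_forall hC

/-- Averages of a periodic function. -/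
lemma ea_periodic (g : ℝ → ℝ) (hg : Measurable g) (h0 : ∀ w, 0 ≤ g w) (h1 : ∀ w, g w ≤ 1)
    (t : ℝ) (ht : 0 < t) (hp : ∀ w, 0 < w → g (t + w) = g w) (w1 w2 : ℝ) (hw1 : 0 ≤ w1)
    (hw : w1 ≤ w2) :
    |(∫ w in w1..w2, g w) - (w2 - w1) * (t⁻¹ * ∫ w in 0..t, g w)| ≤ t := by
  have hii : ∀ a b, IntervalIntegrable g volume a b :=
    ea_ii g hg 1 (fun w => abs_le.2 ⟨by linarith [h0 w], h1 w⟩)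
  have hper : ∀ w, 0 ≤ w → ∫ u in w..(w + t), g u = ∫ u in 0..t, g u := by
    intro w hw
    have e1 : ∫ u in 0..w, g (t + u) = ∫ u in 0..w, g u := by
      rw [intervalIntegral.integral_of_le hw, intervalIntegral.integral_of_le hw]
      exact setIntegral_congr_fun measurableSet_Ioc (fun u hu => hp u hu.1)
    rw [intervalIntegral.integral_comp_add_left] at e1
    have e2 := intervalIntegral.integral_add_adjacent_intervals (hii 0 w) (hii w (w + t))
    have e3 := intervalIntegral.integral_add_adjacent_intervals (hii 0 t) (hii t (w + t))
    rw [add_zero, add_comm t w] at e1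
    linarith
  have hn : ∀ n : ℕ, ∫ u in w1..(w1 + n * t), g u = n * ∫ u in 0..t, g u := by
    intro n
    induction n with
    | zero => simp
    | succ n ih =>
      have e := intervalIntegral.integral_add_adjacent_intervals (hii w1 (w1 + n * t))
        (hii (w1 + n * t) (w1 + n * t + t))
      rw [hper _ (by positivity), ih] at e
      push_cast
      rw [show w1 + (n + 1) * t = w1 + n * t + t by ring, ← e]
      ring
  have hb : ∀ a b, a ≤ b → 0 ≤ (∫ u in a..b, g u) ∧ (∫ u in a..b, g u) ≤ b - a := by
    intro a b hab
    refine ⟨intervalIntegral.integral_nonneg hab (fun u _ => h0 u), ?_⟩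
    have := intervalIntegral.integral_mono_on hab (hii a b)
      (intervalIntegrable_const (c := (1 : ℝ))) (fun u _ => h1 u)
    simpa using this
  set n := ⌊(w2 - w1) / t⌋₊ with hndef
  have hn1 : n * t ≤ w2 - w1 := by
    have := Nat.floor_le (a := (w2 - w1) / t) (div_nonneg (by linarith) ht.le)
    rwa [le_div_iff₀ ht] at this
  have hn2 : w2 - w1 ≤ n * t + t := by
    have := (Nat.lt_floor_add_one ((w2 - w1) / t)).le
    rw [div_le_iff₀ ht] at this
    linarith
  have e := intervalIntegral.integral_add_adjacent_intervals (hii w1 (w1 + n * t))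
        (hii (w1 + n * t) w2)
  rw [hn] at e
  obtain ⟨b1, b2⟩ := hb (w1 + n * t) w2 (by linarith)
  obtain ⟨c1, c2⟩ := hb 0 t ht.le
  set I := ∫ u in 0..t, g u
  set R := ∫ u in (w1 + n * t)..w2, g u
  have hI0 : 0 ≤ t⁻¹ * I := by positivity
  have hI1 : t⁻¹ * I ≤ 1 := by
    rw [inv_mul_le_iff₀ ht]; linarith
  have hI : I = t * (t⁻¹ * I) := by field_simp
  set J := t⁻¹ * I
  rw [← e]
  have : n * I + R - (w2 - w1) * J = R - (w2 - w1 - n * t) * J := by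
    rw [hI]; ring
  rw [this]
  have k1 : 0 ≤ (w2 - w1 - n * t) * J := mul_nonneg (by linarith) hI0
  have k2 : (w2 - w1 - n * t) * J ≤ (w2 - w1 - n * t) * 1 :=
    mul_le_mul_of_nonneg_left hI1 (by linarith)
  rw [abs_le]
  constructor <;> linarith

lemma ea_bezout (p q : ℕ) (hp : 0 < p) (hq : 0 < q) (h : Nat.Coprime p q) :
    ∃ a b : ℕ, a * q = p * b + 1 ∧ b ≤ q := by
  rcases Nat.lt_or_ge 1 p with h1 | h1
  · obtain ⟨m, hm, hmod⟩ := Nat.exists_mul_mod_eq_one_of_coprime h.symm h1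
    refine ⟨m, q * m / p, ?_, ?_⟩
    · have := Nat.div_add_mod (q * m) p
      rw [hmod] at this
      rw [this, mul_comm]
    · apply Nat.div_le_of_le_mul
      nlinarith
  · have : p = 1 := by omega
    subst this
    exact ⟨1, q - 1, by omega, by omega⟩

/-- Dirichlet approximations with large denominators. -/
lemma ea_dirichlet (s : ℝ) (hs : 0 < s) (hirr : Irrational s) (n : ℕ) :
    ∃ p q a b : ℕ, n ≤ q ∧ 0 < q ∧ a * q = p * b + 1 ∧ b ≤ q ∧ |s - p / q| ≤ 1 / (q : ℝ) ^ 2 := by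
  have hinf := Real.infinite_rat_abs_sub_lt_one_div_den_sq_of_irrational hirr
  obtain ⟨N, hN⟩ := exists_nat_gt (max (n : ℝ) (1 / s))
  have hNn : (n : ℝ) < N := lt_of_le_of_lt (le_max_left _ _) hN
  have hNs : 1 / s < N := lt_of_le_of_lt (le_max_right _ _) hN
  obtain ⟨M, hM⟩ := exists_nat_gt ((s + 1) * N)
  have hfin : {r : ℚ | |s - r| < 1 / (r.den : ℝ) ^ 2 ∧ r.den < N}.Finite := by
    have hbox : (Set.Icc (-(M : ℤ)) M ×ˢ Set.Icc 0 N : Set (ℤ × ℕ)).Finite :=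
      (Set.finite_Icc _ _).prod (Set.finite_Icc _ _)
    refine Set.Finite.of_finite_image (f := fun r : ℚ => (r.num, r.den)) (hbox.subset ?_) ?_
    · rintro _ ⟨r, ⟨hr, hrN⟩, rfl⟩
      have hd : (1 : ℝ) ≤ r.den := by exact_mod_cast r.den_pos
      have hle : 1 / (r.den : ℝ) ^ 2 ≤ 1 := by
        rw [div_le_one (by positivity)]; nlinarith
      have hr' := abs_lt.1 hr
      have hrN' : (r.den : ℝ) ≤ N := by exact_mod_cast hrN.le
      have hnum : (r.num : ℝ) = r * r.den := by
        exact_mod_cast (Rat.mul_den_eq_num r).symm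
      have u1 : (r : ℝ) * r.den ≤ (s + 1) * N := by
        calc (r : ℝ) * r.den ≤ (s + 1) * r.den := by gcongr; linarith
          _ ≤ _ := by gcongr
      have u2 : -((s + 1) * N) ≤ (r : ℝ) * r.den := by
        have : -(s + 1) * r.den ≤ (r : ℝ) * r.den := by gcongr; linarith
        have : (s + 1) * r.den ≤ (s + 1) * N := by gcongr
        linarith
      simp only [Set.mem_prod, Set.mem_Icc, zero_le, true_and]
      refine ⟨⟨?_, ?_⟩, hrN.le⟩
      · have : (-(M : ℝ)) ≤ r.num := by rw [hnum]; linarith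
        exact_mod_cast this
      · have : (r.num : ℝ) ≤ M := by rw [hnum]; linarith
        exact_mod_cast this
    · intro r _ r' _ h
      simp only [Prod.mk.injEq] at h
      exact Rat.ext h.1 h.2
  obtain ⟨r, hr, hr2⟩ := (hinf.sdiff hfin).nonempty
  have hr : |s - r| < 1 / (r.den : ℝ) ^ 2 := hr
  have hden : N ≤ r.den := by
    by_contra h
    exact hr2 ⟨hr, by omega⟩
  have hdenR : (N : ℝ) ≤ r.den := by exact_mod_cast hden
  have hd : (1 : ℝ) ≤ r.den := by exact_mod_cast r.den_pos
  have hpos : (0 : ℝ) < r := by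
    have h1 : 1 / (r.den : ℝ) ^ 2 ≤ s := by
      rw [div_le_iff₀ (by positivity)]
      rw [div_lt_iff₀ hs] at hNs
      nlinarith
    linarith [(abs_lt.1 hr).2]
  have hnumpos : 0 < r.num := Rat.num_pos.2 (by exact_mod_cast hpos)
  have hp : (r.num.natAbs : ℤ) = r.num := Int.natAbs_of_nonneg hnumpos.le
  obtain ⟨a, b, hab, hb⟩ := ea_bezout r.num.natAbs r.den (by omega) r.den_pos r.reduced
  refine ⟨r.num.natAbs, r.den, a, b, ?_, r.den_pos, hab, hb, ?_⟩
  · have : n < N := by exact_mod_cast hNn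
    omega
  · have : ((r.num.natAbs : ℕ) : ℝ) = (r.num : ℝ) := by
      rw [← Int.cast_natCast, hp]
    rw [this, show (r.num : ℝ) / r.den = (r : ℝ) by exact_mod_cast Rat.num_div_den r]
    exact hr.le

lemma ea_meas (G : ℝ → ℝ → ℝ) (hG : Measurable (Function.uncurry G)) (a b : ℝ) :
    Measurable (fun t => ∫ y in a..b, G t y) := by
  simp only [intervalIntegral]
  exact (hG.stronglyMeasurable.integral_prod_right).measurable.sub
    (hG.stronglyMeasurable.integral_prod_right).measurable

lemma ea_swap (G : ℝ → ℝ → ℝ) (hG : Measurable (Function.uncurry G)) (C a b c d : ℝ)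
    (hC : ∀ x ∈ uIoc a b, ∀ y ∈ uIoc c d, |G x y| ≤ C) :
    ∫ x in a..b, ∫ y in c..d, G x y = ∫ y in c..d, ∫ x in a..b, G x y := by
  apply intervalIntegral_intervalIntegral_swap
  refine MeasureTheory.Measure.integrableOn_of_bounded (M := C) ?_ hG.aestronglyMeasurable ?_
  · rw [Measure.volume_eq_prod, Measure.prod_prod]
    exact (ENNReal.mul_lt_top (by simp [uIoc]) (by simp [uIoc])).ne
  · filter_upwards [ae_restrict_mem (measurableSet_uIoc.prod measurableSet_uIoc)] with z hz
    exact hC z.1 hz.1 z.2 hz.2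

/-- radial integral along the ray of slope `s` -/
noncomputable def eaPhi (f : ℝ × ℝ → ℝ) (r s : ℝ) : ℝ := ∫ y in 0..r, f (s * y, y) * y

/-- mean over a period -/
noncomputable def eaM (f : ℝ × ℝ → ℝ) (t : ℝ) : ℝ := ∫ u in 0..1, f (t, t * u)

noncomputable def eaN (f : ℝ × ℝ → ℝ) (κ : ℝ) : ℝ := ∫ t in 0..κ, (1 - t / κ) * eaM f t

lemma eaM_eq (f : ℝ × ℝ → ℝ) (t : ℝ) (ht : t ≠ 0) : eaM f t = t⁻¹ * ∫ w in 0..t, f (t, w) := by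
  rw [eaM, intervalIntegral.integral_comp_mul_left (fun w => f (t, w)) ht]
  simp

lemma ea_key (f : ℝ × ℝ → ℝ) (hf : Measurable f) (h0 : ∀ z, 0 ≤ f z) (hf1 : ∀ z, f z ≤ 1)
    (h1 : ∀ x y : ℝ, 0 < x → 0 < y → f (x + y, y) = f (x, y))
    (h2 : ∀ x y : ℝ, 0 < x → 0 < y → f (x, x + y) = f (x, y))
    (p q a b : ℕ) (hq : 0 < q) (hab : a * q = p * b + 1) (hb : b ≤ q)
    (h r : ℝ) (hh : 0 < h) (hr : 0 < r) (hqh : (q : ℝ) ^ 2 * h ≤ 1) :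
    |(∫ s in (p / q : ℝ)..(p / q + h), eaPhi f r s) - r * eaN f (q * h * r) / q|
      ≤ (q * h * r) ^ 2 / 2 := by
  have hqR : (0 : ℝ) < q := by exact_mod_cast hq
  have hbR : (b : ℝ) ≤ q := by exact_mod_cast hb
  have habs : ∀ z, |f z| ≤ 1 := fun z => abs_le.2 ⟨by linarith [h0 z], hf1 z⟩
  obtain ⟨κ, hκ⟩ : ∃ κ : ℝ, κ = q * h := ⟨_, rfl⟩
  have hκ0 : 0 < κ := by rw [hκ]; positivity
  have hκb : κ * b ≤ 1 := by
    calc κ * b ≤ κ * q := by gcongr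
      _ = q ^ 2 * h := by rw [hκ]; ring
      _ ≤ 1 := hqh
  -- the integrand in the coordinates `(t, y)`
  let g : ℝ → ℝ → ℝ := fun t y => f ((t + p * y) / q, y)
  let G : ℝ → ℝ → ℝ := fun t y => if t ≤ κ * y then g t y else 0
  have hgm : Measurable (Function.uncurry g) := by
    apply hf.comp
    fun_prop
  have hGm : Measurable (Function.uncurry G) := by
    refine Measurable.ite ?_ hgm measurable_const
    exact measurableSet_le (by fun_prop) (by fun_prop)
  have hGb : ∀ t y, |G t y| ≤ 1 := by
    intro t y
    simp only [G]
    split_ifs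
    · exact habs _
    · simp
  have hA : (∫ s in (p / q : ℝ)..(p / q + h), eaPhi f r s)
      = (q : ℝ)⁻¹ * ∫ t in 0..κ * r, ∫ y in 0..r, G t y := by
    simp only [eaPhi]
    rw [ea_swap (fun s y => f (s * y, y) * y) _ r, ea_swap G hGm 1,
      ← intervalIntegral.integral_const_mul]
    · rw [intervalIntegral.integral_of_le hr.le, intervalIntegral.integral_of_le hr.le]
      refine setIntegral_congr_fun measurableSet_Ioc (fun y hy => ?_)
      have hy0 : 0 < y := hy.1
      have e1 : ∫ t in 0..κ * r, G t y = ∫ t in 0..κ * y, g t y := by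
        have := intervalIntegral.integral_indicator (μ := volume) (f := fun t => g t y)
          (a₁ := 0) (a₂ := κ * y) (a₃ := κ * r) ⟨by positivity, by gcongr; exact hy.2⟩
        rw [← this]
        rfl
      have e2 := intervalIntegral.integral_comp_mul_add (a := (p / q : ℝ)) (b := p / q + h)
        (fun t => g t y) (c := q * y) (by positivity) (-(p * y))
      rw [e1, intervalIntegral.integral_mul_const]
      have e3 : (fun s => f (s * y, y)) = fun s => g (q * y * s + -(p * y)) y := by
        funext s
        simp only [g]
        congr 2
        field_simp
        ring
      rw [e3, e2]
      have e4 : (q : ℝ) * y * (p / q) + -(p * y) = 0 := by field_simp; ring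
      have e5 : (q : ℝ) * y * (p / q + h) + -(p * y) = κ * y := by rw [hκ]; field_simp; ring
      rw [e4, e5, smul_eq_mul]
      field_simp
    · intro t _ y _
      exact hGb t y
    · intro s _ y hy
      rw [uIoc_of_le hr.le] at hy
      rw [abs_mul, abs_of_pos hy.1]
      calc |f (s * y, y)| * y ≤ 1 * y := by gcongr; exacts [hy.1.le, habs _]
        _ ≤ r := by linarith [hy.2]
    · apply Measurable.mul _ measurable_snd
      apply hf.comp
      fun_prop
  have hB : ∀ t ∈ Ioc 0 (κ * r), |(∫ y in 0..r, G t y) - (r - t / κ) * eaM f t| ≤ q * t := by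
    intro t ht
    have ht0 : 0 < t := ht.1
    have htr : t / κ ≤ r := by rw [div_le_iff₀ hκ0]; linarith [ht.2]
    have e1 : ∫ y in 0..r, G t y = ∫ y in (t / κ)..r, g t y := by
      have hii : ∀ c d, IntervalIntegrable (fun y => G t y) volume c d :=
        ea_ii _ (hGm.comp (measurable_const.prodMk measurable_id)) 1 (fun y => hGb t y)
      rw [← intervalIntegral.integral_add_adjacent_intervals (hii 0 (t / κ)) (hii (t / κ) r)]
      have z1 : ∫ y in 0..(t / κ), G t y = 0 := by
        rw [intervalIntegral.integral_of_le (by positivity), integral_Ioc_eq_integral_Ioo]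
        refine setIntegral_eq_zero_of_forall_eq_zero (fun y hy => ?_)
        have := (lt_div_iff₀ hκ0).1 hy.2
        simp only [G]
        rw [if_neg (by linarith)]
      rw [z1, zero_add, intervalIntegral.integral_of_le htr, intervalIntegral.integral_of_le htr]
      refine setIntegral_congr_fun measurableSet_Ioc (fun y hy => ?_)
      have := (div_lt_iff₀ hκ0).1 hy.1
      simp only [G]
      rw [if_pos (by linarith)]
    obtain ⟨w1, hw1⟩ : ∃ w1 : ℝ, w1 = (t / κ - t * b) / q := ⟨_, rfl⟩
    obtain ⟨w2, hw2⟩ : ∃ w2 : ℝ, w2 = (r - t * b) / q := ⟨_, rfl⟩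
    have hw1' : q * w1 + t * b = t / κ := by rw [hw1]; field_simp; ring
    have hw2' : q * w2 + t * b = r := by rw [hw2]; field_simp; ring
    have hw10 : 0 ≤ w1 := by
      rw [hw1]
      apply div_nonneg _ hqR.le
      rw [sub_nonneg, le_div_iff₀ hκ0]
      nlinarith
    have hw12 : w1 ≤ w2 := by
      rw [hw1, hw2]; gcongr
    have e2 : ∫ y in (t / κ)..r, g t y = q * ∫ w in w1..w2, f (t, w) := by
      have := intervalIntegral.integral_comp_mul_add (a := w1) (b := w2)
        (fun y => g t y) (c := q) hqR.ne' (t * b)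
      rw [hw1', hw2'] at this
      have e3 : ∫ w in w1..w2, g t (q * w + t * b) = ∫ w in w1..w2, f (t, w) := by
        rw [intervalIntegral.integral_of_le hw12, intervalIntegral.integral_of_le hw12]
        refine setIntegral_congr_fun measurableSet_Ioc (fun w hw => ?_)
        have hw0 : 0 < w := lt_of_le_of_lt hw10 hw.1
        simp only [g]
        rw [← ea_monoid f h1 h2 _ a p b q le_rfl hab t w ht0 hw0]
        have habR : (a : ℝ) * q = p * b + 1 := by exact_mod_cast hab
        congr 2
        · field_simp
          linear_combination (-t) * habR
        · ring
      rw [e3, smul_eq_mul] at this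
      rw [this]
      field_simp
    have e4 := ea_periodic (fun w => f (t, w)) (hf.comp (measurable_const.prodMk measurable_id))
      (fun w => h0 _) (fun w => hf1 _) t ht0 (fun w hw => h2 t w ht0 hw) w1 w2 hw10 hw12
    rw [← eaM_eq f t ht0.ne'] at e4
    have e5 : r - t / κ = q * (w2 - w1) := by rw [← hw1', ← hw2']; ring
    rw [e1, e2, e5, mul_assoc, ← mul_sub, abs_mul, abs_of_pos hqR]
    gcongr
  have hN : r * eaN f (q * h * r) = ∫ t in 0..κ * r, (r - t / κ) * eaM f t := by
    rw [← hκ, eaN, ← intervalIntegral.integral_const_mul]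
    congr 1
    funext t
    field_simp
  have hMm : Measurable (eaM f) := by
    apply ea_meas (fun t u => f (t, t * u))
    apply hf.comp
    fun_prop
  have hMb : ∀ t, |eaM f t| ≤ 1 := by
    intro t
    have := intervalIntegral.norm_integral_le_of_norm_le_const (a := 0) (b := 1) (C := 1)
      (f := fun u => f (t, t * u)) (fun u _ => habs _)
    simpa [eaM] using this
  have hi1 : IntervalIntegrable (fun t => ∫ y in 0..r, G t y) volume 0 (κ * r) := by
    refine ea_ii _ (ea_meas G hGm 0 r) r (fun t => ?_) _ _
    have := intervalIntegral.norm_integral_le_of_norm_le_const (a := 0) (b := r) (C := 1)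
      (f := fun y => G t y) (fun u _ => hGb _ _)
    simpa [abs_of_pos hr] using this
  have hi2 : IntervalIntegrable (fun t => (r - t / κ) * eaM f t) volume 0 (κ * r) := by
    refine IntervalIntegrable.continuousOn_mul (ea_ii _ hMm 1 hMb 0 (κ * r)) ?_
    fun_prop
  rw [hA, hN, div_eq_inv_mul, ← mul_sub, ← intervalIntegral.integral_sub hi1 hi2, abs_mul,
    abs_of_pos (inv_pos.2 hqR), inv_mul_le_iff₀ hqR]
  have hfin := intervalIntegral.norm_integral_le_of_norm_le (μ := volume)
    (a := 0) (b := κ * r) (f := fun t => (∫ y in 0..r, G t y) - (r - t / κ) * eaM f t)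
    (g := fun t => q * t) (by positivity) (Eventually.of_forall hB)
    (by apply Continuous.intervalIntegrable; fun_prop)
  refine hfin.trans (le_of_eq ?_)
  rw [intervalIntegral.integral_const_mul, integral_id, hκ]
  ring

lemma ea_zero (X C c0 : ℝ) (hc0 : 0 < c0) (h : ∀ c, 0 < c → c ≤ c0 → |X| ≤ c * C) : X = 0 := by
  by_contra hX
  have hX' : 0 < |X| := abs_pos.2 hX
  have hC : 0 < C := by
    have := h c0 hc0 le_rfl
    by_contra hC
    nlinarith
  have := h (min c0 (|X| / (2 * C))) (by positivity) (min_le_left _ _)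
  have h2 : min c0 (|X| / (2 * C)) * C ≤ |X| / (2 * C) * C := by
    gcongr
    exact min_le_right _ _
  have h3 : |X| / (2 * C) * C = |X| / 2 := by field_simp
  linarith

lemma eaPhi_meas (f : ℝ × ℝ → ℝ) (hf : Measurable f) (r : ℝ) : Measurable (eaPhi f r) := by
  apply ea_meas (fun s y => f (s * y, y) * y)
  apply Measurable.mul _ measurable_snd
  apply hf.comp
  fun_prop

lemma eaPhi_bound (f : ℝ × ℝ → ℝ) (habs : ∀ z, |f z| ≤ 1) (r : ℝ) (hr : 0 < r) (s : ℝ) :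
    |eaPhi f r s| ≤ r * r := by
  have := intervalIntegral.norm_integral_le_of_norm_le_const (a := 0) (b := r) (C := r)
    (f := fun y => f (s * y, y) * y) (fun y hy => by
      rw [uIoc_of_le hr.le] at hy
      rw [Real.norm_eq_abs, abs_mul, abs_of_pos hy.1]
      calc |f (s * y, y)| * y ≤ 1 * y := by gcongr; exacts [hy.1.le, habs _]
        _ ≤ r := by linarith [hy.2])
  simpa [eaPhi, abs_of_pos hr] using this

lemma ea_locInt (g : ℝ → ℝ) (hg : Measurable g) (C : ℝ) (hC : ∀ w, |g w| ≤ C) :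
    LocallyIntegrable g volume := by
  have : LocallyIntegrable (fun _ : ℝ => C) volume := locallyIntegrable_const C
  refine this.mono hg.aestronglyMeasurable (Eventually.of_forall fun w => ?_)
  exact (hC w).trans (le_abs_self C)

/-- Lebesgue differentiation along rational approximations. -/
def eaGood (f : ℝ × ℝ → ℝ) (r s : ℝ) : Prop :=
  ∀ c > 0, ∀ ε > 0, ∃ N : ℕ, ∀ p q : ℕ, N ≤ q → 0 < q → |s - p / q| ≤ 1 / (q : ℝ) ^ 2 →
    |(q : ℝ) ^ 2 / c * (∫ u in (p / q : ℝ)..(p / q + c / (q : ℝ) ^ 2), eaPhi f r u) - eaPhi f r s|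
      ≤ ε

lemma ea_good (f : ℝ × ℝ → ℝ) (hf : Measurable f) (habs : ∀ z, |f z| ≤ 1) (r : ℝ) (hr : 0 < r) :
    ∀ᵐ s, eaGood f r s := by
  have hii : ∀ a b, IntervalIntegrable (eaPhi f r) volume a b :=
    ea_ii _ (eaPhi_meas f hf r) (r * r) (eaPhi_bound f habs r hr)
  filter_upwards [LocallyIntegrable.ae_hasDerivAt_integral
    (ea_locInt _ (eaPhi_meas f hf r) (r * r) (eaPhi_bound f habs r hr))] with s hs c hc ε hε
  have hd := (hs s).isLittleO
  have hε' : 0 < ε / (2 / c + 1) := by positivity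
  have hd2 := hd.bound hε'
  obtain ⟨δ, hδ, hball⟩ := Metric.eventually_nhds_iff.1 hd2
  simp only [intervalIntegral.integral_same, sub_zero, Real.dist_eq, Real.norm_eq_abs,
    smul_eq_mul] at hball
  obtain ⟨N, hN⟩ := exists_nat_gt ((1 + c) / δ)
  refine ⟨N, fun p q hNq hq hpq => ?_⟩
  have hqR : (1 : ℝ) ≤ q := by exact_mod_cast hq
  have hNqR : (N : ℝ) ≤ q := by exact_mod_cast hNq
  have hsmall : 1 / (q : ℝ) ^ 2 + c / (q : ℝ) ^ 2 < δ := by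
    rw [← add_div, div_lt_iff₀ (by positivity)]
    rw [div_lt_iff₀ hδ] at hN
    have k1 : (N : ℝ) * δ ≤ q * δ := by gcongr
    have k2 : q * δ ≤ δ * (q : ℝ) ^ 2 := by nlinarith [mul_nonneg hδ.le (by linarith : (0 : ℝ) ≤ q)]
    linarith
  have hcq : 0 < c / (q : ℝ) ^ 2 := by positivity
  have da : |(p / q : ℝ) - s| ≤ 1 / (q : ℝ) ^ 2 := by rw [abs_sub_comm]; exact hpq
  have db : |(p / q + c / (q : ℝ) ^ 2 : ℝ) - s| ≤ 1 / (q : ℝ) ^ 2 + c / (q : ℝ) ^ 2 := by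
    rw [abs_le] at da ⊢
    constructor <;> linarith [da.1, da.2]
  have ba := hball (y := (p / q : ℝ)) (by linarith)
  have bb := hball (y := (p / q + c / (q : ℝ) ^ 2 : ℝ)) (by linarith)
  have hadd := intervalIntegral.integral_add_adjacent_intervals (hii s (p / q : ℝ))
    (hii (p / q : ℝ) (p / q + c / (q : ℝ) ^ 2))
  set I := ∫ u in (p / q : ℝ)..(p / q + c / (q : ℝ) ^ 2), eaPhi f r u
  set Ia := ∫ u in s..(p / q : ℝ), eaPhi f r u
  set Ib := ∫ u in s..(p / q + c / (q : ℝ) ^ 2), eaPhi f r u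
  set φ := eaPhi f r s
  have ba' := ba.trans (mul_le_mul_of_nonneg_left da hε'.le)
  have bb' := bb.trans (mul_le_mul_of_nonneg_left db hε'.le)
  have key : |I - c / (q : ℝ) ^ 2 * φ| ≤
      ε / (2 / c + 1) * (1 / (q : ℝ) ^ 2 + (1 / (q : ℝ) ^ 2 + c / (q : ℝ) ^ 2)) := by
    rw [abs_le] at ba' bb' ⊢
    constructor <;> nlinarith [ba'.1, ba'.2, bb'.1, bb'.2]
  have e1 : (q : ℝ) ^ 2 / c * I - φ = (q : ℝ) ^ 2 / c * (I - c / (q : ℝ) ^ 2 * φ) := by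
    field_simp
  have e2 : (q : ℝ) ^ 2 / c * (ε / (2 / c + 1) *
      (1 / (q : ℝ) ^ 2 + (1 / (q : ℝ) ^ 2 + c / (q : ℝ) ^ 2))) = ε := by
    field_simp
    ring
  rw [e1, abs_mul, abs_of_pos (by positivity : 0 < (q : ℝ) ^ 2 / c), ← e2]
  gcongr

lemma ea_irr : ∀ᵐ s : ℝ, Irrational s := by
  have : (Set.range ((↑) : ℚ → ℝ)).Countable := Set.countable_range _
  exact this.ae_notMem volume

lemma ea_scale (f : ℝ × ℝ → ℝ) (hf : Measurable f) (h0 : ∀ z, 0 ≤ f z) (hf1 : ∀ z, f z ≤ 1)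
    (h1 : ∀ x y : ℝ, 0 < x → 0 < y → f (x + y, y) = f (x, y))
    (h2 : ∀ x y : ℝ, 0 < x → 0 < y → f (x, x + y) = f (x, y))
    (r s : ℝ) (hr : 0 < r) (hs : 0 < s) (hirr : Irrational s) (hgr : eaGood f r s)
    (hg1 : eaGood f 1 s) : eaPhi f r s = r ^ 2 * eaPhi f 1 s := by
  rw [← sub_eq_zero]
  refine ea_zero _ ((1 + r) * r ^ 2 / 2 + 1 + r ^ 2) (min 1 (1 / r)) (by positivity) ?_
  intro c hc hc0
  have hc1 : c ≤ 1 := hc0.trans (min_le_left _ _)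
  have hcr : c * r ≤ 1 := by
    have := hc0.trans (min_le_right _ _)
    rwa [le_div_iff₀ hr] at this
  obtain ⟨N1, hN1⟩ := hgr c hc c hc
  obtain ⟨N2, hN2⟩ := hg1 (c * r) (by positivity) c hc
  obtain ⟨p, q, a, b, hn, hq, hab, hb, hpq⟩ := ea_dirichlet s hs hirr (max N1 N2)
  have A1 := hN1 p q ((le_max_left _ _).trans hn) hq hpq
  have A2 := hN2 p q ((le_max_right _ _).trans hn) hq hpq
  have hqR : (0 : ℝ) < q := by exact_mod_cast hq
  have B1 := ea_key f hf h0 hf1 h1 h2 p q a b hq hab hb (c / (q : ℝ) ^ 2) r (by positivity) hr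
    (by rw [mul_div_cancel₀ _ (by positivity)]; exact hc1)
  have B2 := ea_key f hf h0 hf1 h1 h2 p q a b hq hab hb (c * r / (q : ℝ) ^ 2) 1 (by positivity)
    one_pos (by rw [mul_div_cancel₀ _ (by positivity)]; exact hcr)
  have e0 : q * (c * r / (q : ℝ) ^ 2) * 1 = q * (c / (q : ℝ) ^ 2) * r := by ring
  have e3 : q * (c / (q : ℝ) ^ 2) * r = c * r / q := by field_simp
  rw [e0, one_mul] at B2
  rw [e3] at B1 B2
  set n := eaN f (c * r / q)
  set X1 := ∫ u in (p / q : ℝ)..(p / q + c / (q : ℝ) ^ 2), eaPhi f r u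
  set X2 := ∫ u in (p / q : ℝ)..(p / q + c * r / (q : ℝ) ^ 2), eaPhi f 1 u
  have key : |X1 - r * X2| ≤ (1 + r) * ((c * r / q) ^ 2 / 2) := by
    have B2' := mul_le_mul_of_nonneg_left B2 hr.le
    rw [← abs_of_pos hr, ← abs_mul, abs_of_pos hr] at B2'
    have e : r * (X2 - n / q) = r * X2 - r * n / q := by ring
    rw [e] at B2'
    rw [abs_le] at B1 B2' ⊢
    constructor <;> linarith [B1.1, B1.2, B2'.1, B2'.2]
  have key2 : |(q : ℝ) ^ 2 / c * X1 - r ^ 2 * ((q : ℝ) ^ 2 / (c * r) * X2)|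
      ≤ c * ((1 + r) * r ^ 2 / 2) := by
    have e1 : (q : ℝ) ^ 2 / c * X1 - r ^ 2 * ((q : ℝ) ^ 2 / (c * r) * X2)
        = (q : ℝ) ^ 2 / c * (X1 - r * X2) := by field_simp
    have e2 : (q : ℝ) ^ 2 / c * ((1 + r) * ((c * r / q) ^ 2 / 2)) = c * ((1 + r) * r ^ 2 / 2) := by
      field_simp
    rw [e1, ← e2, abs_mul, abs_of_pos (by positivity : 0 < (q : ℝ) ^ 2 / c)]
    gcongr
  have A2' := mul_le_mul_of_nonneg_left A2 (sq_nonneg r)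
  have hr2 : 0 < r ^ 2 := by positivity
  rw [← abs_of_pos hr2, ← abs_mul, abs_of_pos hr2, mul_sub] at A2'
  rw [abs_le] at A1 A2' key2 ⊢
  constructor <;> nlinarith [A1.1, A1.2, A2'.1, A2'.2, key2.1, key2.2]

lemma ea_scale_ae (f : ℝ × ℝ → ℝ) (hf : Measurable f) (h0 : ∀ z, 0 ≤ f z) (hf1 : ∀ z, f z ≤ 1)
    (h1 : ∀ x y : ℝ, 0 < x → 0 < y → f (x + y, y) = f (x, y))
    (h2 : ∀ x y : ℝ, 0 < x → 0 < y → f (x, x + y) = f (x, y))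
    (r : ℝ) (hr : 0 < r) : ∀ᵐ s, 0 < s → eaPhi f r s = r ^ 2 * eaPhi f 1 s := by
  have habs : ∀ z, |f z| ≤ 1 := fun z => abs_le.2 ⟨by linarith [h0 z], hf1 z⟩
  filter_upwards [ea_irr, ea_good f hf habs r hr, ea_good f hf habs 1 one_pos] with s a b c hs
  exact ea_scale f hf h0 hf1 h1 h2 r s hr hs a b c

lemma ea_N (f : ℝ × ℝ → ℝ) (hf : Measurable f) (h0 : ∀ z, 0 ≤ f z) (hf1 : ∀ z, f z ≤ 1)
    (h1 : ∀ x y : ℝ, 0 < x → 0 < y → f (x + y, y) = f (x, y))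
    (h2 : ∀ x y : ℝ, 0 < x → 0 < y → f (x, x + y) = f (x, y))
    (κ : ℝ) (hκ : 0 < κ) : eaN f κ = eaN f 1 * κ := by
  have est : ∀ κ : ℝ, 0 < κ → ∀ h : ℝ, 0 < h → h ≤ 1 →
      |h⁻¹ * (∫ s in 0..h, eaPhi f 1 s) - eaN f κ / κ| ≤ h / 2 := by
    intro κ hκ h hh hh1
    have hr : 0 < κ / h := by positivity
    have B := ea_key f hf h0 hf1 h1 h2 0 1 1 0 one_pos rfl zero_le_one h (κ / h) hh hr
      (by simpa using hh1)
    have e1 : ∫ s in 0..h, eaPhi f (κ / h) s = (κ / h) ^ 2 * ∫ s in 0..h, eaPhi f 1 s := by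
      rw [← intervalIntegral.integral_const_mul, intervalIntegral.integral_of_le hh.le,
        intervalIntegral.integral_of_le hh.le]
      refine setIntegral_congr_ae measurableSet_Ioc ?_
      filter_upwards [ea_scale_ae f hf h0 hf1 h1 h2 (κ / h) hr] with s hs hs2
      exact hs hs2.1
    have e2 : ((1 : ℕ) : ℝ) * h * (κ / h) = κ := by push_cast; field_simp
    rw [e2] at B
    simp only [Nat.cast_zero, Nat.cast_one, div_one, zero_add] at B
    rw [e1] at B
    have e3 : h⁻¹ * (∫ s in 0..h, eaPhi f 1 s) - eaN f κ / κ =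
        h / κ ^ 2 * ((κ / h) ^ 2 * (∫ s in 0..h, eaPhi f 1 s) - κ / h * eaN f κ) := by
      field_simp
    have e4 : h / 2 = h / κ ^ 2 * (κ ^ 2 / 2) := by field_simp
    rw [e3, e4, abs_mul, abs_of_pos (by positivity : 0 < h / κ ^ 2)]
    gcongr
  have : eaN f κ / κ - eaN f 1 = 0 := by
    refine ea_zero _ 1 1 one_pos (fun h hh hh1 => ?_)
    have a := est κ hκ h hh hh1
    have b := est 1 one_pos h hh hh1
    rw [div_one] at b
    rw [abs_le] at a b ⊢
    constructor <;> linarith [a.1, a.2, b.1, b.2]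
  have h3 : eaN f κ / κ = eaN f 1 := by linarith
  rw [← h3]
  field_simp

lemma ea_one (f : ℝ × ℝ → ℝ) (hf : Measurable f) (h0 : ∀ z, 0 ≤ f z) (hf1 : ∀ z, f z ≤ 1)
    (h1 : ∀ x y : ℝ, 0 < x → 0 < y → f (x + y, y) = f (x, y))
    (h2 : ∀ x y : ℝ, 0 < x → 0 < y → f (x, x + y) = f (x, y))
    (s : ℝ) (hs : 0 < s) (hirr : Irrational s) (hg1 : eaGood f 1 s) :
    eaPhi f 1 s = eaN f 1 := by
  rw [← sub_eq_zero]
  refine ea_zero _ 2 1 one_pos ?_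
  intro c hc hc1
  obtain ⟨N1, hN1⟩ := hg1 c hc c hc
  obtain ⟨p, q, a, b, hn, hq, hab, hb, hpq⟩ := ea_dirichlet s hs hirr N1
  have A1 := hN1 p q hn hq hpq
  have hqR : (0 : ℝ) < q := by exact_mod_cast hq
  have B1 := ea_key f hf h0 hf1 h1 h2 p q a b hq hab hb (c / (q : ℝ) ^ 2) 1 (by positivity)
    one_pos (by rw [mul_div_cancel₀ _ (by positivity)]; exact hc1)
  have e3 : q * (c / (q : ℝ) ^ 2) * 1 = c / q := by field_simp
  rw [e3, ea_N f hf h0 hf1 h1 h2 _ (by positivity)] at B1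
  set n := eaN f 1
  set X1 := ∫ u in (p / q : ℝ)..(p / q + c / (q : ℝ) ^ 2), eaPhi f 1 u
  have key2 : |(q : ℝ) ^ 2 / c * X1 - n| ≤ c * (1 / 2) := by
    have e1 : (q : ℝ) ^ 2 / c * X1 - n = (q : ℝ) ^ 2 / c * (X1 - 1 * (n * (c / q)) / q) := by
      field_simp
    have e2 : (q : ℝ) ^ 2 / c * ((c / q) ^ 2 / 2) = c * (1 / 2) := by
      field_simp
    rw [e1, ← e2, abs_mul, abs_of_pos (by positivity : 0 < (q : ℝ) ^ 2 / c)]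
    gcongr
  rw [abs_le] at A1 key2 ⊢
  constructor <;> linarith [A1.1, A1.2, key2.1, key2.2]

/-- Almost everywhere constancy in the coordinates `(s, y)`. -/
lemma ea_const (f : ℝ × ℝ → ℝ) (hf : Measurable f) (h0 : ∀ z, 0 ≤ f z) (hf1 : ∀ z, f z ≤ 1)
    (h1 : ∀ x y : ℝ, 0 < x → 0 < y → f (x + y, y) = f (x, y))
    (h2 : ∀ x y : ℝ, 0 < x → 0 < y → f (x, x + y) = f (x, y))
    : ∃ K : ℝ, ∀ᵐ s, 0 < s → ∀ᵐ y, 0 < y → f (s * y, y) = K := by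
  have habs : ∀ z, |f z| ≤ 1 := fun z => abs_le.2 ⟨by linarith [h0 z], hf1 z⟩
  refine ⟨2 * eaN f 1, ?_⟩
  have hall : ∀ᵐ s, ∀ r : ℚ, 0 < r → 0 < s → eaPhi f r s = (r : ℝ) ^ 2 * eaPhi f 1 s := by
    rw [ae_all_iff]
    intro r
    by_cases hr : 0 < r
    · filter_upwards [ea_scale_ae f hf h0 hf1 h1 h2 (r : ℝ) (by exact_mod_cast hr)] with s hs _
      exact hs
    · exact Eventually.of_forall fun s h => absurd h hr
  filter_upwards [hall, ea_irr, ea_good f hf habs 1 one_pos] with s hs hirr hg hs0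
  have hone := ea_one f hf h0 hf1 h1 h2 s hs0 hirr hg
  have hli : LocallyIntegrable (fun y => f (s * y, y) * y) volume := by
    have : LocallyIntegrable (fun y : ℝ => y) volume := continuous_id.locallyIntegrable
    refine this.mono ?_ (Eventually.of_forall fun y => ?_)
    · apply Measurable.aestronglyMeasurable
      apply Measurable.mul _ measurable_id
      apply hf.comp
      fun_prop
    · rw [norm_mul]
      have := habs (s * y, y)
      calc ‖f (s * y, y)‖ * ‖y‖ ≤ 1 * ‖y‖ := by gcongr; exact this
        _ = ‖y‖ := one_mul _
  have hcont : Continuous fun r => eaPhi f r s := by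
    apply intervalIntegral.continuous_primitive
    intro a b
    exact (hli.integrableOn_isCompact isCompact_uIcc).intervalIntegrable
  have hreal : ∀ r ∈ Ioi (0 : ℝ), eaPhi f r s = r ^ 2 * eaN f 1 := by
    have hcl : IsClosed {r : ℝ | eaPhi f r s = r ^ 2 * eaN f 1} :=
      isClosed_eq hcont (by fun_prop)
    intro r hr
    have hsub : Ioi (0 : ℝ) ∩ Set.range ((↑) : ℚ → ℝ) ⊆ {r : ℝ | eaPhi f r s = r ^ 2 * eaN f 1} := by
      rintro _ ⟨hx, ⟨x, rfl⟩⟩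
      have := hs x (by exact_mod_cast (mem_Ioi.1 hx)) hs0
      rw [hone] at this
      exact this
    have hd : Ioi (0 : ℝ) ⊆ closure (Ioi (0 : ℝ) ∩ Set.range ((↑) : ℚ → ℝ)) :=
      Rat.denseRange_cast.open_subset_closure_inter isOpen_Ioi
    exact closure_minimal hsub hcl (hd hr)
  filter_upwards [LocallyIntegrable.ae_hasDerivAt_integral hli] with y hy hy0
  have d1 : HasDerivAt (fun r => eaPhi f r s) (f (s * y, y) * y) y := hy 0
  have d2 : HasDerivAt (fun r : ℝ => r ^ 2 * eaN f 1) (2 * y * eaN f 1) y := by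
    have := (hasDerivAt_pow 2 y).mul_const (eaN f 1)
    simpa using this
  have d3 : HasDerivAt (fun r => eaPhi f r s) (2 * y * eaN f 1) y := by
    refine d2.congr_of_eventuallyEq ?_
    filter_upwards [Ioi_mem_nhds hy0] with r hr
    exact hreal r hr
  have := d1.unique d3
  have hh : (f (s * y, y) - 2 * eaN f 1) * y = 0 := by linarith
  rcases mul_eq_zero.1 hh with h | h
  · linarith
  · exact absurd h hy0.ne'

lemma ea_const_prod (f : ℝ × ℝ → ℝ) (hf : Measurable f) (h0 : ∀ z, 0 ≤ f z) (hf1 : ∀ z, f z ≤ 1)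
    (h1 : ∀ x y : ℝ, 0 < x → 0 < y → f (x + y, y) = f (x, y))
    (h2 : ∀ x y : ℝ, 0 < x → 0 < y → f (x, x + y) = f (x, y))
    : ∃ K : ℝ, ∀ᵐ z : ℝ × ℝ, 0 < z.1 → 0 < z.2 → f z = K := by
  obtain ⟨K, hK⟩ := ea_const f hf h0 hf1 h1 h2
  refine ⟨K, ?_⟩
  have hK2 : ∀ᵐ s : ℝ, ∀ᵐ y : ℝ, 0 < s → 0 < y → f (s * y, y) = K := by
    filter_upwards [hK] with s hs
    by_cases h : 0 < s
    · filter_upwards [hs h] with y hy _ using hy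
    · exact Eventually.of_forall fun y h' => absurd h' h
  have hm : MeasurableSet {z : ℝ × ℝ | 0 < z.1 → 0 < z.2 → f (z.1 * z.2, z.2) = K} := by
    have m1 : Measurable fun z : ℝ × ℝ => f (z.1 * z.2, z.2) := by
      apply hf.comp
      fun_prop
    have := ((measurableSet_lt measurable_const measurable_fst).compl.union
      ((measurableSet_lt measurable_const measurable_snd).compl.union
        (m1 (measurableSet_singleton K))) :
        MeasurableSet ({z : ℝ × ℝ | (0 : ℝ) < z.1}ᶜ ∪ ({z : ℝ × ℝ | (0 : ℝ) < z.2}ᶜ ∪ _)))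
    convert this using 1
    ext z
    simp only [mem_ofPred_eq, mem_union, mem_compl_iff, mem_preimage, mem_singleton_iff]
    tauto
  have hK3 : ∀ᵐ y : ℝ, ∀ᵐ s : ℝ, 0 < s → 0 < y → f (s * y, y) = K :=
    (Measure.ae_ae_comm hm).1 hK2
  have hm2 : MeasurableSet {z : ℝ × ℝ | 0 < z.1 → 0 < z.2 → f z = K} := by
    have := ((measurableSet_lt measurable_const measurable_fst).compl.union
      ((measurableSet_lt measurable_const measurable_snd).compl.union
        (hf (measurableSet_singleton K))) :
        MeasurableSet ({z : ℝ × ℝ | (0 : ℝ) < z.1}ᶜ ∪ ({z : ℝ × ℝ | (0 : ℝ) < z.2}ᶜ ∪ _)))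
    convert this using 1
    ext z
    simp only [mem_ofPred_eq, mem_union, mem_compl_iff, mem_preimage, mem_singleton_iff]
    tauto
  have hK4 : ∀ᵐ y : ℝ, ∀ᵐ x : ℝ, 0 < x → 0 < y → f (x, y) = K := by
    filter_upwards [hK3] with y hy
    by_cases hy0 : 0 < y
    · have hq : Measure.QuasiMeasurePreserving (fun x : ℝ => y⁻¹ * x) volume volume := by
        refine ⟨by fun_prop, ?_⟩
        rw [Real.map_volume_mul_left (by positivity)]
        exact Measure.smul_absolutelyContinuous
      filter_upwards [hq.ae hy] with x hx hx0 _
      have := hx (by positivity) hy0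
      rwa [show y⁻¹ * x * y = x by field_simp] at this
    · exact Eventually.of_forall fun x _ h => absurd h hy0
  have hK5 : ∀ᵐ x : ℝ, ∀ᵐ y : ℝ, 0 < x → 0 < y → f (x, y) = K :=
    (Measure.ae_ae_comm hm2).2 hK4
  rw [Measure.volume_eq_prod]
  exact (Measure.ae_prod_iff_ae_ae hm2).2 hK5
end helpers

lemma euclidAlg_qmp : Measure.QuasiMeasurePreserving euclidAlg volume volume := by
  have hS1 : MeasurePreserving (fun z : ℝ × ℝ => (z.1, z.2 - z.1)) := by
    have := measurePreserving_prod_neg_add (μ := (volume : Measure ℝ)) (ν := (volume : Measure ℝ))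
    rw [Measure.volume_eq_prod]
    convert this using 2 with z
    ext <;> simp [sub_eq_neg_add]
  have hS2 : MeasurePreserving (fun z : ℝ × ℝ => (z.1 - z.2, z.2)) := by
    have hsw : MeasurePreserving (Prod.swap : ℝ × ℝ → ℝ × ℝ) := Measure.measurePreserving_swap
    exact (hsw.comp (hS1.comp hsw))
  have hmeas : Measurable euclidAlg := by
    refine Measurable.ite (measurableSet_le measurable_snd measurable_fst) ?_ ?_ <;> fun_prop
  refine ⟨hmeas, Measure.AbsolutelyContinuous.mk fun s hs h0 => ?_⟩
  rw [Measure.map_apply hmeas hs]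
  have hsub : euclidAlg ⁻¹' s ⊆ (fun z : ℝ × ℝ => (z.1 - z.2, z.2)) ⁻¹' s ∪
      (fun z : ℝ × ℝ => (z.1, z.2 - z.1)) ⁻¹' s := by
    intro z hz
    simp only [Set.mem_preimage, euclidAlg] at hz
    split_ifs at hz
    · exact Or.inl hz
    · exact Or.inr hz
  refine measure_mono_null hsub (measure_union_null ?_ ?_)
  · rw [hS2.measure_preimage hs.nullMeasurableSet, h0]
  · rw [hS1.measure_preimage hs.nullMeasurableSet, h0]

/-- The homogeneous Euclidean algorithm is ergodic with respect to
2-dimensional Lebesgue measure. -/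
theorem euclidAlg_ergodic (A : Set (ℝ × ℝ)) (hA : NullMeasurableSet A volume)
    (hsub : A ⊆ posQuad) (hinv : {y ∈ posQuad | euclidAlg y ∈ A} = A) :
    volume A = 0 ∨ volume (posQuad \ A) = 0 := by
  have hpre : euclidAlg ⁻¹' A = A := by
    refine Set.Subset.antisymm (fun z hz => ?_) (fun z hz => ?_)
    · rw [← hinv]
      refine ⟨?_, hz⟩
      have h := hsub hz
      simp only [euclidAlg, posQuad] at h
      split_ifs at h with hc
      · have h1 : 0 ≤ z.1 - z.2 := h.1
        have h2 : 0 ≤ z.2 := h.2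
        exact ⟨by linarith, h2⟩
      · have h1 : 0 ≤ z.1 := h.1
        have h2 : 0 ≤ z.2 - z.1 := h.2
        exact ⟨h1, by linarith⟩
    · rw [← hinv] at hz
      exact hz.2
  obtain ⟨t, htm, hta, htinv⟩ := euclidAlg_qmp.exists_preimage_eq_of_preimage_ae hA
    (Filter.EventuallyEq.of_eq hpre)
  have hmem : ∀ z, euclidAlg z ∈ t ↔ z ∈ t := fun z => by
    conv_rhs => rw [← htinv]
    rfl
  classical
  let f : ℝ × ℝ → ℝ := fun z => if z ∈ t then 1 else 0
  have hfm : Measurable f := Measurable.ite htm measurable_const measurable_const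
  have h1 : ∀ x y : ℝ, 0 < x → 0 < y → f (x + y, y) = f (x, y) := by
    intro x y hx hy
    have : euclidAlg (x + y, y) = (x, y) := by
      simp [euclidAlg, hx.le]
    have := hmem (x + y, y)
    simp_all [f]
  have h2 : ∀ x y : ℝ, 0 < x → 0 < y → f (x, x + y) = f (x, y) := by
    intro x y hx hy
    have : euclidAlg (x, x + y) = (x, y) := by
      simp [euclidAlg, hy]
    have := hmem (x, x + y)
    simp_all [f]
  obtain ⟨K, hK⟩ := ea_const_prod f hfm
    (fun z => by simp only [f]; split_ifs <;> norm_num)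
    (fun z => by simp only [f]; split_ifs <;> norm_num) h1 h2
  have hb : ∀ᵐ z : ℝ × ℝ, z ∈ posQuad → 0 < z.1 ∧ 0 < z.2 := by
    have n1 : ∀ᵐ z : ℝ × ℝ, z.1 ≠ 0 := by
      have : ∀ᵐ x : ℝ, x ≠ 0 := by simp [ae_iff]
      exact Measure.quasiMeasurePreserving_fst.ae this
    have n2 : ∀ᵐ z : ℝ × ℝ, z.2 ≠ 0 := by
      have : ∀ᵐ x : ℝ, x ≠ 0 := by simp [ae_iff]
      exact Measure.quasiMeasurePreserving_snd.ae this
    filter_upwards [n1, n2] with z a b hz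
    exact ⟨lt_of_le_of_ne hz.1 a.symm, lt_of_le_of_ne hz.2 b.symm⟩
  have hta' : ∀ᵐ z, (z ∈ t ↔ z ∈ A) := hta.mem_iff
  by_cases hK1 : K = 1
  · right
    rw [measure_eq_zero_iff_ae_notMem]
    filter_upwards [hK, hb, hta'] with z a b c hz
    have := a (b hz.1).1 (b hz.1).2
    have hzt : z ∉ t := fun h => hz.2 (c.1 h)
    simp [f, hzt, hK1] at this
  · left
    rw [measure_eq_zero_iff_ae_notMem]
    filter_upwards [hK, hb, hta'] with z a b c hz
    have := a (b (hsub hz)).1 (b (hsub hz)).2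
    have hzt : z ∈ t := c.2 hz
    simp only [f, hzt, if_true] at this
    exact hK1 this.symm
end
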